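/- (Carleman estimate with time-frozen coefficients.) Assume A(0,0) = Iₙ. There exist a universal constant N and δ ∈ (0,1) such that for every α ≥ N(1 + ‖V(·,0)‖₁^{1/2}), setting λ = α/δ², for every 0 < a ≤ 1/(4λ) and every w ∈ C₀^∞(B₄ × [0, 1/(2λ))): α² ∫_{t≥a} σ^{-2α} w² G + ∫_{t≥a} σ^{1-2α} |∇w|² (θ(λt)/t) G ≤ N ∫_{t≥a} σ^{1-2α} (div(A(x,0)∇w) + ∂_t w + V(x,0)w)² G + N^{2α} λ^{2α+N} sup_{t ≥ a} ∫_{ℝⁿ} (w² + t|∇w|²) dx + σ(a)^{-2α} ( −(a/N) ∫_{ℝⁿ} |∇w(x,a)|² G(x,a) dx + Nα ∫_{ℝⁿ} w(x,a)² G(x,a) dx ). -/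

import Mathlib

open MeasureTheory Set Filter

noncomputable section

abbrev Eu (n : ℕ) : Type := EuclideanSpace ℝ (Fin n)

/-- `i`-th spatial partial derivative. -/
noncomputable def pd (n : ℕ) (i : Fin n) (f : Eu n → ℝ) (x : Eu n) : ℝ :=
  fderiv ℝ f x (EuclideanSpace.single i 1)

/-- Spatial divergence `div (A ∇u)` for a time-dependent coefficient matrix. -/
noncomputable def divAGrad (n : ℕ) (A : Eu n → ℝ → Matrix (Fin n) (Fin n) ℝ)
    (u : Eu n → ℝ → ℝ) (x : Eu n) (t : ℝ) : ℝ :=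
  ∑ i, pd n i (fun y => ∑ j, A y t i j * pd n j (fun z => u z t) y) x

/-- Squared Frobenius norm of the spatial Hessian. -/
noncomputable def hessSq (n : ℕ) (w : Eu n → ℝ → ℝ) (x : Eu n) (t : ℝ) : ℝ :=
  ∑ i, ∑ j, (pd n i (fun y => pd n j (fun z => w z t) y) x) ^ 2

/-- Symmetry, uniform ellipticity and space-time (parabolic) Lipschitz regularity of `A`. -/
def IsEllipLip (n : ℕ) (Λ K : ℝ) (A : Eu n → ℝ → Matrix (Fin n) (Fin n) ℝ) : Prop :=
  (∀ x t, (A x t).IsSymm) ∧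
  (∀ (x : Eu n) (t : ℝ) (ξ : Eu n),
      Λ⁻¹ * ‖ξ‖ ^ 2 ≤ ∑ i, ∑ j, A x t i j * ξ i * ξ j ∧
        ∑ i, ∑ j, A x t i j * ξ i * ξ j ≤ Λ * ‖ξ‖ ^ 2) ∧
  (∀ (x y : Eu n) (t s : ℝ) (i j : Fin n),
      |A x t i j - A y s i j| ≤ K * (‖x - y‖ + |t - s| ^ ((1:ℝ)/2)))

/-- The weight `θ(t) = t^{1/2} (log(1/t))^{3/2}`. -/
noncomputable def thetaFn (t : ℝ) : ℝ := t ^ ((1:ℝ)/2) * (Real.log (1/t)) ^ ((3:ℝ)/2)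

/-- Gaussian kernel `G(x,t) = t^{-n/2} e^{-|x|²/(4t)}`. -/
noncomputable def Gk (n : ℕ) (x : Eu n) (t : ℝ) : ℝ :=
  t ^ (-(n:ℝ)/2) * Real.exp (-‖x‖ ^ 2 / (4 * t))

/-- The function `σ` (with derivative `σ'`) solving
`(d/dt) log (σ/(t σ')) = θ(λ t)/t`, `σ(0) = 0`, `σ'(0) = 1` on `[0, 1/λ]`. -/
def SigmaODE (lam : ℝ) (σ σ' : ℝ → ℝ) : Prop :=
  σ 0 = 0 ∧ σ' 0 = 1 ∧
  ContinuousOn σ' (Icc 0 (1/lam)) ∧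
  (∀ t ∈ Icc (0:ℝ) (1/lam), HasDerivWithinAt σ (σ' t) (Icc 0 (1/lam)) t) ∧
  (∀ t ∈ Ioc (0:ℝ) (1/lam), 0 < σ t ∧ 0 < σ' t) ∧
  (∀ t ∈ Ioc (0:ℝ) (1/lam),
    HasDerivWithinAt (fun s => Real.log (σ s) - Real.log s - Real.log (σ' s))
      (thetaFn (lam * t) / t) (Icc 0 (1/lam)) t)

/-- Smooth functions compactly supported in `S × [0, T)`. -/
def TestFn (n : ℕ) (S : Set (Eu n)) (T : ℝ) (w : Eu n → ℝ → ℝ) : Prop :=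
  ContDiff ℝ (⊤ : ℕ∞) (fun p : Eu n × ℝ => w p.1 p.2) ∧
  HasCompactSupport (fun p : Eu n × ℝ => w p.1 p.2) ∧
  tsupport (fun p : Eu n × ℝ => w p.1 p.2) ⊆ S ×ˢ Ico 0 T

/-- `‖V‖_{L^∞(Q₄)}`. -/
noncomputable def VsupQ4 (n : ℕ) (V : Eu n → ℝ → ℝ) : ℝ :=
  sSup {y | ∃ x ∈ Metric.ball (0:Eu n) 4, ∃ t ∈ Icc (0:ℝ) 16, y = |V x t|}

/-- `‖∇ₓV‖_{L^∞(Q₄)}`. -/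
noncomputable def VgradSupQ4 (n : ℕ) (V : Eu n → ℝ → ℝ) : ℝ :=
  sSup {y | ∃ x ∈ Metric.ball (0:Eu n) 4, ∃ t ∈ Icc (0:ℝ) 16,
    y = ‖gradient (fun z => V z t) x‖}

/-- `‖V‖₁ = ‖V‖_{L^∞(Q₄)} + ‖∇ₓV‖_{L^∞(Q₄)}`. -/
noncomputable def Vnorm1 (n : ℕ) (V : Eu n → ℝ → ℝ) : ℝ := VsupQ4 n V + VgradSupQ4 n V

/-- `[V]_{1/2}`, the `1/2`-Hölder seminorm of `V` in time on `Q₄`. -/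
noncomputable def Vhalf (n : ℕ) (V : Eu n → ℝ → ℝ) : ℝ :=
  sSup {y | ∃ x ∈ Metric.ball (0:Eu n) 4, ∃ t ∈ Icc (0:ℝ) 16, ∃ s ∈ Icc (0:ℝ) 16,
    t ≠ s ∧ y = |V x t - V x s| / |t - s| ^ ((1:ℝ)/2)}

/-- Regularity of `V`: bounded, `C¹` in space with bounded spatial gradient,
and uniformly `1/2`-Hölder continuous in time on `Q₄`. -/
def VReg (n : ℕ) (V : Eu n → ℝ → ℝ) : Prop :=
  (∃ C, ∀ x ∈ Metric.ball (0:Eu n) 4, ∀ t ∈ Icc (0:ℝ) 16, |V x t| ≤ C) ∧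
  (∀ t ∈ Icc (0:ℝ) 16, ContDiffOn ℝ 1 (fun x => V x t) (Metric.ball (0:Eu n) 4)) ∧
  (∃ C, ∀ x ∈ Metric.ball (0:Eu n) 4, ∀ t ∈ Icc (0:ℝ) 16,
      ‖gradient (fun z => V z t) x‖ ≤ C) ∧
  (∃ C, ∀ x ∈ Metric.ball (0:Eu n) 4, ∀ t ∈ Icc (0:ℝ) 16, ∀ s ∈ Icc (0:ℝ) 16,
      |V x t - V x s| ≤ C * |t - s| ^ ((1:ℝ)/2))

/-- `u` is a classical solution of `∂ₜu + div(A∇u) + Vu = 0` in `Q₄ = B₄ × [0,16]`: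
`C²` in space, `C¹` in time, and the equation holds pointwise. -/
def IsSolQ4 (n : ℕ) (A : Eu n → ℝ → Matrix (Fin n) (Fin n) ℝ) (V u : Eu n → ℝ → ℝ) : Prop :=
  (∀ t ∈ Icc (0:ℝ) 16, ContDiffOn ℝ 2 (fun x => u x t) (Metric.ball (0:Eu n) 4)) ∧
  (∀ x ∈ Metric.ball (0:Eu n) 4, ContDiffOn ℝ 1 (fun s => u x s) (Icc (0:ℝ) 16)) ∧
  (∀ x ∈ Metric.ball (0:Eu n) 4, ∀ t ∈ Icc (0:ℝ) 16,
      deriv (fun s => u x s) t + divAGrad n A u x t + V x t * u x t = 0)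

/-- `‖V(·,0)‖_{L^∞(B₄)}`. -/
noncomputable def V0sup (n : ℕ) (V0 : Eu n → ℝ) : ℝ :=
  sSup {y | ∃ x ∈ Metric.ball (0:Eu n) 4, y = |V0 x|}

/-- `‖∇V(·,0)‖_{L^∞(B₄)}`. -/
noncomputable def V0gradSup (n : ℕ) (V0 : Eu n → ℝ) : ℝ :=
  sSup {y | ∃ x ∈ Metric.ball (0:Eu n) 4, y = ‖gradient V0 x‖}

open scoped NNReal Topology

section tools
variable {n : ℕ}

lemma LL_mul {E : Type*} [PseudoEMetricSpace E] {f g : E → ℝ} (hf : LocallyLipschitz f) (hg : LocallyLipschitz g) :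
    LocallyLipschitz (fun x => f x * g x) := by
  have h : LocallyLipschitz (fun p : ℝ × ℝ => p.1 * p.2) :=
    ContDiff.locallyLipschitz (𝕂 := ℝ) (contDiff_fst.mul contDiff_snd)
  exact h.comp (hf.prodMk hg)

lemma LL_add {f g : Eu n → ℝ} (hf : LocallyLipschitz f) (hg : LocallyLipschitz g) :
    LocallyLipschitz (fun x => f x + g x) := by
  have h : LocallyLipschitz (fun p : ℝ × ℝ => p.1 + p.2) :=
    ContDiff.locallyLipschitz (𝕂 := ℝ) (contDiff_fst.add contDiff_snd)
  exact h.comp (hf.prodMk hg)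

lemma LL_sub {f g : Eu n → ℝ} (hf : LocallyLipschitz f) (hg : LocallyLipschitz g) :
    LocallyLipschitz (fun x => f x - g x) := by
  have h : LocallyLipschitz (fun p : ℝ × ℝ => p.1 - p.2) :=
    ContDiff.locallyLipschitz (𝕂 := ℝ) (contDiff_fst.sub contDiff_snd)
  exact h.comp (hf.prodMk hg)

lemma LL_const (c : ℝ) : LocallyLipschitz (fun _ : Eu n => c) := LocallyLipschitz.const c

lemma LL_sum {ι : Type*} (s : Finset ι) {f : ι → Eu n → ℝ}
    (hf : ∀ i, LocallyLipschitz (f i)) : LocallyLipschitz (fun x => ∑ i ∈ s, f i x) := by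
  classical
  induction s using Finset.induction_on with
  | empty => simpa using LL_const 0
  | insert a s ha ih =>
    simp only [Finset.sum_insert ha]
    exact LL_add (hf a) ih

lemma lipschitz_of_LL {E : Type*} [NormedAddCommGroup E] [ProperSpace E] {f : E → ℝ} (hf : LocallyLipschitz f) (hs : HasCompactSupport f) :
    ∃ C : ℝ≥0, LipschitzWith C f := by
  obtain ⟨R, hR⟩ := hs.isBounded.subset_closedBall 0
  obtain ⟨M, hM⟩ := hf.continuous.bounded_above_of_compact_support hs
  have hM0 : 0 ≤ M := (norm_nonneg _).trans (hM 0)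
  obtain ⟨C, hC⟩ := (hf.locallyLipschitzOn (s := Metric.closedBall 0 (R+1))
    ).exists_lipschitzOnWith_of_compact (isCompact_closedBall (0 : E) (R+1))
  have hz : ∀ x, R < ‖x‖ → f x = 0 := by
    intro x hx
    by_contra h
    have := hR (subset_tsupport f (Function.mem_support.2 h))
    simp at this
    linarith
  have key : ∀ x y : E, ‖x‖ ≤ R → ‖f x - f y‖ ≤ (C + M) * ‖x - y‖ := by
    intro x y hx
    by_cases hy : ‖y‖ ≤ R + 1
    · have := hC.norm_sub_le (x := x) (y := y) (by simp; linarith) (by simpa using hy)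
      have : 0 ≤ M * ‖x - y‖ := by positivity
      nlinarith
    · push Not at hy
      rw [hz y (by linarith), sub_zero]
      have h1 : 1 ≤ ‖x - y‖ := by
        have := norm_sub_norm_le y x
        rw [norm_sub_rev] at this
        linarith
      have := hM x
      have : 0 ≤ (C:ℝ) * ‖x - y‖ := by positivity
      nlinarith
  refine ⟨C + ⟨M, hM0⟩, LipschitzWith.of_dist_le_mul fun x y => ?_⟩
  rw [dist_eq_norm, dist_eq_norm]
  change _ ≤ (C + M) * _
  by_cases hx : ‖x‖ ≤ R
  · exact key x y hx
  · by_cases hy : ‖y‖ ≤ R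
    · rw [norm_sub_rev, norm_sub_rev x y]; exact key y x hy
    · push Not at hx hy
      rw [hz x hx, hz y hy]; simp; positivity

lemma int_pd_zero {f : Eu n → ℝ} (hf : LocallyLipschitz f) (hs : HasCompactSupport f)
    (i : Fin n) : Integrable (fun x => pd n i f x) ∧ ∫ x, pd n i f x = 0 := by
  obtain ⟨C, hC⟩ := lipschitz_of_LL hf hs
  have hae : (fun x => lineDeriv ℝ f x (EuclideanSpace.single i 1)) =ᵐ[volume]
      fun x => pd n i f x := by
    filter_upwards [hC.ae_differentiableAt] with x hx
    exact hx.lineDeriv_eq_fderiv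
  constructor
  · have hm : Measurable (fun x => pd n i f x) := measurable_fderiv_apply_const ℝ f _
    have hsup : HasCompactSupport (fun x => pd n i f x) := hs.fderiv_apply ℝ _
    have hb : ∀ x, ‖pd n i f x‖ ≤ C := by
      intro x
      have h1 := (fderiv ℝ f x).le_opNorm (EuclideanSpace.single i 1)
      have h2 := norm_fderiv_le_of_lipschitz ℝ hC (x₀ := x)
      simp at h1
      exact h1.trans h2
    rw [← integrableOn_iff_integrable_of_support_subset (subset_tsupport _)]
    exact Measure.integrableOn_of_bounded (M := C) hsup.isCompact.measure_lt_top.ne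
      hm.aestronglyMeasurable (ae_of_all _ hb)
  · have h := LipschitzWith.integral_lineDeriv_mul_eq (μ := volume) (LipschitzWith.const (1:ℝ)) hC hs
      (-(EuclideanSpace.single i 1 : Eu n))
    simp [lineDeriv] at h
    rw [← integral_congr_ae hae]; exact h.symm

end tools

section pointwise
variable {n : ℕ}

/-- `(B x)_i` -/
def Xf (B : Fin n → Fin n → Eu n → ℝ) (i : Fin n) (y : Eu n) : ℝ := ∑ j, B i j y * y j
/-- `(B g)_i` -/
def Pf (B : Fin n → Fin n → Eu n → ℝ) (g : Fin n → Eu n → ℝ) (i : Fin n) (y : Eu n) : ℝ :=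
  ∑ j, B i j y * g j y
/-- `⟨B x, g⟩` -/
def bf (B : Fin n → Fin n → Eu n → ℝ) (g : Fin n → Eu n → ℝ) (y : Eu n) : ℝ :=
  ∑ j, Xf B j y * g j y
/-- `⟨B g, g⟩` -/
def qf (B : Fin n → Fin n → Eu n → ℝ) (g : Fin n → Eu n → ℝ) (y : Eu n) : ℝ :=
  ∑ i, ∑ j, B i j y * (g i y * g j y)
/-- main part of `(∂ₜ G - div (B ∇ G)) / G` -/
def F0f (B : Fin n → Fin n → Eu n → ℝ) (τ : ℝ) (y : Eu n) : ℝ :=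
  τ ^ 2 * (∑ i, y i * y i - ∑ i, ∑ j, B i j y * (y i * y j))
/-- zeroth order part of the antisymmetric operator -/
def kf (B : Fin n → Fin n → Eu n → ℝ) (τ k : ℝ) (y : Eu n) : ℝ := F0f B τ y / 2 + k
/-- zeroth order part of the symmetric operator -/
def cf (B : Fin n → Fin n → Eu n → ℝ) (V : Eu n → ℝ) (τ k : ℝ) (y : Eu n) : ℝ :=
  V y - kf B τ k y
/-- antisymmetric operator -/
def Kf (B : Fin n → Fin n → Eu n → ℝ) (g : Fin n → Eu n → ℝ) (w wt : Eu n → ℝ) (τ k : ℝ)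
    (y : Eu n) : ℝ := wt y + τ * bf B g y + kf B τ k y * w y
/-- energy density -/
def ef (B : Fin n → Fin n → Eu n → ℝ) (g : Fin n → Eu n → ℝ) (V w : Eu n → ℝ) (τ k : ℝ)
    (y : Eu n) : ℝ := cf B V τ k y * w y ^ 2 - qf B g y
/-- the flux -/
def Yf (B : Fin n → Fin n → Eu n → ℝ) (g : Fin n → Eu n → ℝ) (V w wt G : Eu n → ℝ) (ω τ k : ℝ)
    (i : Fin n) (y : Eu n) : ℝ :=
  ω * (G y * (2 * (Kf B g w wt τ k y * Pf B g i y) + τ * (ef B g V w τ k y * Xf B i y)))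

/-- derivative of `(B x)_i` in direction `v` -/
def dXe (B : Fin n → Fin n → ℝ) (dB : Fin n → Fin n → Eu n →L[ℝ] ℝ) (x : Eu n)
    (i : Fin n) (v : Eu n) : ℝ := ∑ j, (B i j * v j + dB i j v * x j)

/-- derivative of `F₀` in direction `v` -/
def dF0e (B : Fin n → Fin n → ℝ) (dB : Fin n → Fin n → Eu n →L[ℝ] ℝ) (τ : ℝ) (x v : Eu n) : ℝ :=
  τ ^ 2 * (∑ i, 2 * (x i * v i) -
    ∑ i, ∑ j, (B i j * (x i * v j + x j * v i) + dB i j v * (x i * x j)))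

lemma clm_apply_sum (L : Eu n →L[ℝ] ℝ) (v : Eu n) :
    L v = ∑ i, v i * L (EuclideanSpace.single i 1) := by
  have hv : v = ∑ i, v i • (EuclideanSpace.single i (1:ℝ) : Eu n) := by
    ext j
    simp [Finset.sum_apply, Pi.single_apply]
  conv_lhs => rw [hv]
  simp

lemma hasFDerivAt_coord (i : Fin n) (x : Eu n) :
    HasFDerivAt (fun y : Eu n => y i) (EuclideanSpace.proj (𝕜 := ℝ) i) x :=
  (EuclideanSpace.proj (𝕜 := ℝ) i : Eu n →L[ℝ] ℝ).hasFDerivAt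

/-- existence of a derivative with prescribed values -/
def HasDV (f : Eu n → ℝ) (d : Eu n → ℝ) (x : Eu n) : Prop :=
  ∃ L : Eu n →L[ℝ] ℝ, HasFDerivAt f L x ∧ ∀ v, L v = d v

lemma HasDV.of {f : Eu n → ℝ} {L : Eu n →L[ℝ] ℝ} {x : Eu n} (h : HasFDerivAt f L x) :
    HasDV f (fun v => L v) x := ⟨L, h, fun _ => rfl⟩

lemma HasDV.congr {f : Eu n → ℝ} {d d' : Eu n → ℝ} {x : Eu n} (h : HasDV f d x)
    (hd : ∀ v, d v = d' v) : HasDV f d' x := by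
  obtain ⟨L, h1, h2⟩ := h
  exact ⟨L, h1, fun v => (h2 v).trans (hd v)⟩

lemma HasDV.mul {f g : Eu n → ℝ} {d e : Eu n → ℝ} {x : Eu n} (hf : HasDV f d x)
    (hg : HasDV g e x) : HasDV (fun y => f y * g y) (fun v => f x * e v + g x * d v) x := by
  obtain ⟨L, h1, h2⟩ := hf
  obtain ⟨M, h3, h4⟩ := hg
  refine ⟨_, h1.mul h3, fun v => ?_⟩
  simp [h2, h4]

lemma HasDV.add {f g : Eu n → ℝ} {d e : Eu n → ℝ} {x : Eu n} (hf : HasDV f d x)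
    (hg : HasDV g e x) : HasDV (fun y => f y + g y) (fun v => d v + e v) x := by
  obtain ⟨L, h1, h2⟩ := hf
  obtain ⟨M, h3, h4⟩ := hg
  refine ⟨_, h1.add h3, fun v => ?_⟩
  simp [h2, h4]

lemma HasDV.sub {f g : Eu n → ℝ} {d e : Eu n → ℝ} {x : Eu n} (hf : HasDV f d x)
    (hg : HasDV g e x) : HasDV (fun y => f y - g y) (fun v => d v - e v) x := by
  obtain ⟨L, h1, h2⟩ := hf
  obtain ⟨M, h3, h4⟩ := hg
  refine ⟨_, h1.sub h3, fun v => ?_⟩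
  simp [h2, h4]

lemma HasDV.const (c : ℝ) (x : Eu n) : HasDV (fun _ : Eu n => c) (fun _ => 0) x :=
  ⟨0, hasFDerivAt_const c x, fun _ => rfl⟩

lemma HasDV.const_mul {f : Eu n → ℝ} {d : Eu n → ℝ} {x : Eu n} (c : ℝ) (hf : HasDV f d x) :
    HasDV (fun y => c * f y) (fun v => c * d v) x :=
  ((HasDV.const c x).mul hf).congr (fun v => by ring)

lemma HasDV.sum {f : Fin n → Eu n → ℝ} {d : Fin n → Eu n → ℝ} {x : Eu n}
    (hf : ∀ i, HasDV (f i) (d i) x) : HasDV (fun y => ∑ i, f i y) (fun v => ∑ i, d i v) x := by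
  choose L h1 h2 using hf
  refine ⟨_, HasFDerivAt.fun_sum (fun i _ => h1 i), fun v => ?_⟩
  simp [h2]

lemma HasDV.pd_eq {f d : Eu n → ℝ} {x : Eu n} (hf : HasDV f d x) (i : Fin n) :
    pd n i f x = d (EuclideanSpace.single i 1) := by
  obtain ⟨L, h1, h2⟩ := hf
  rw [pd, h1.fderiv, h2]

lemma HasDV.apply_sum {f d : Eu n → ℝ} {x : Eu n} (hf : HasDV f d x) (v : Eu n) :
    d v = ∑ i, v i * d (EuclideanSpace.single i 1) := by
  obtain ⟨L, h1, h2⟩ := hf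
  simp only [← h2]
  exact clm_apply_sum L v

lemma HasDV.coord (i : Fin n) (x : Eu n) : HasDV (fun y : Eu n => y i) (fun v => v i) x :=
  ⟨_, hasFDerivAt_coord i x, fun _ => rfl⟩

/-- The divergence of the flux. -/
lemma div_flux (B : Fin n → Fin n → Eu n → ℝ) (g : Fin n → Eu n → ℝ) (V w wt G : Eu n → ℝ)
    (ω τ k : ℝ) (x : Eu n)
    (dB : Fin n → Fin n → Eu n →L[ℝ] ℝ) (dg : Fin n → Eu n →L[ℝ] ℝ) (dV dw dwt : Eu n →L[ℝ] ℝ)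
    (hB : ∀ i j, HasFDerivAt (B i j) (dB i j) x) (hg : ∀ j, HasFDerivAt (g j) (dg j) x)
    (hV : HasFDerivAt V dV x) (hw : HasFDerivAt w dw x) (hwt : HasFDerivAt wt dwt x)
    (hG : HasDV G (fun v => - (τ * G x * ∑ i, x i * v i)) x)
    (hsym : ∀ i j y, B i j y = B j i y)
    (hwg : ∀ j, dw (EuclideanSpace.single j 1) = g j x)
    (hhess : ∀ j k, dg j (EuclideanSpace.single k 1) = dg k (EuclideanSpace.single j 1))
    (P X : Eu n) (hP : ∀ i, P i = Pf B g i x) (hX : ∀ i, X i = Xf B i x) :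
    ∑ i, pd n i (Yf B g V w wt G ω τ k i) x =
      ω * G x * (2 * Kf B g w wt τ k x * (∑ i, pd n i (Pf B g i) x - τ * bf B g x)
        + τ * ef B g V w τ k x * (∑ i, dXe (fun i j => B i j x) dB x i (EuclideanSpace.single i 1)
            - τ * ∑ i, ∑ j, B i j x * (x i * x j))
        + 2 * (dwt P + τ * ∑ j, dXe (fun i j => B i j x) dB x j P * g j x
            + w x * (dF0e (fun i j => B i j x) dB τ x P / 2) + kf B τ k x * qf B g x)
        + τ * ((dV X - dF0e (fun i j => B i j x) dB τ x X / 2) * w x ^ 2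
            + 2 * cf B V τ k x * w x * bf B g x
            - ∑ i, ∑ j, dB i j X * (g i x * g j x))) := by
  have DB := fun i j => HasDV.of (hB i j)
  have Dg := fun j => HasDV.of (hg j)
  have DX : ∀ i, HasDV (Xf B i) (fun v => dXe (fun i j => B i j x) dB x i v) x := fun i =>
    (HasDV.sum (fun j => (DB i j).mul (HasDV.coord j x))).congr (fun v => by
      simp only [dXe]; exact Finset.sum_congr rfl fun j _ => by ring)
  have DP : ∀ i, HasDV (Pf B g i) (fun v => ∑ j, (B i j x * dg j v + g j x * dB i j v)) x :=
    fun i => HasDV.sum (fun j => (DB i j).mul (Dg j))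
  have Db : HasDV (bf B g) (fun v => ∑ j, (Xf B j x * dg j v
      + g j x * dXe (fun i j => B i j x) dB x j v)) x :=
    HasDV.sum (fun j => (DX j).mul (Dg j))
  have Dq : HasDV (qf B g) (fun v => ∑ i, ∑ j, (B i j x * (g i x * dg j v + g j x * dg i v)
      + g i x * g j x * dB i j v)) x :=
    HasDV.sum (fun i => HasDV.sum (fun j => (DB i j).mul ((Dg i).mul (Dg j))))
  have DF : HasDV (F0f B τ) (fun v => dF0e (fun i j => B i j x) dB τ x v) x := by
    refine (HasDV.const_mul (τ ^ 2) ((HasDV.sum (fun i => (HasDV.coord i x).mul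
      (HasDV.coord i x))).sub (HasDV.sum (fun i => HasDV.sum (fun j => (DB i j).mul
        ((HasDV.coord i x).mul (HasDV.coord j x))))))).congr (fun v => ?_)
    simp only [dF0e]
    congr 2
    · exact Finset.sum_congr rfl fun j _ => by ring
    · exact Finset.sum_congr rfl fun i _ => Finset.sum_congr rfl fun j _ => by ring
  have Dk : HasDV (kf B τ k) (fun v => dF0e (fun i j => B i j x) dB τ x v / 2) x := by
    have := (HasDV.const_mul (1/2) DF).add (HasDV.const k x)
    obtain ⟨L, h1, h2⟩ := this
    refine ⟨L, ?_, fun v => ?_⟩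
    · convert h1 using 2; simp only [kf]; ring
    · rw [h2]; ring
  have Dc : HasDV (cf B V τ k) (fun v => dV v - dF0e (fun i j => B i j x) dB τ x v / 2) x :=
    (HasDV.of hV).sub Dk
  have DK : HasDV (Kf B g w wt τ k) _ x :=
    ((HasDV.of hwt).add (HasDV.const_mul τ Db)).add (Dk.mul (HasDV.of hw))
  have Dw2 : HasDV (fun y => w y ^ 2) (fun v => 2 * w x * dw v) x := by
    obtain ⟨L, h1, h2⟩ := (HasDV.of hw).mul (HasDV.of hw)
    refine ⟨L, ?_, fun v => ?_⟩
    · convert h1 using 2; ring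
    · rw [h2]; ring
  have De : HasDV (ef B g V w τ k) _ x := (Dc.mul Dw2).sub Dq
  have DY : ∀ i, HasDV (Yf B g V w wt G ω τ k i) _ x := fun i =>
    HasDV.const_mul ω (hG.mul ((HasDV.const_mul 2 (DK.mul (DP i))).add
      (HasDV.const_mul τ (De.mul (DX i)))))
  -- evaluate
  have eP : ∀ i, pd n i (Pf B g i) x = _ := fun i => (DP i).pd_eq i
  have sK := DK.apply_sum P
  have se := De.apply_sum X
  have hdP : ∀ v : Eu n, dw v = ∑ j, v j * g j x := fun v => by
    rw [clm_apply_sum]; simp only [hwg]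
  have hbP : ∑ i, x i * P i = bf B g x := by
    simp only [hP, bf, Pf, Xf, Finset.mul_sum, Finset.sum_mul]
    rw [Finset.sum_comm]
    exact Finset.sum_congr rfl fun i _ => Finset.sum_congr rfl fun j _ => by
      rw [hsym i j]; ring
  have hqP : ∑ j, P j * g j x = qf B g x := by
    simp only [hP, qf, Pf, Finset.sum_mul]
    exact Finset.sum_congr rfl fun i _ => Finset.sum_congr rfl fun j _ => by ring
  have hbX : ∑ j, X j * g j x = bf B g x := by simp only [hX, bf]
  have hxX : ∑ j, x j * X j = ∑ i, ∑ j, B i j x * (x i * x j) := by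
    simp only [hX, Xf, Finset.mul_sum]
    exact Finset.sum_congr rfl fun i _ => Finset.sum_congr rfl fun j _ => by ring
  have hHs : ∑ j, X j * dg j P = ∑ j, P j * dg j X := by
    simp only [clm_apply_sum (dg _) P, clm_apply_sum (dg _) X, Finset.mul_sum]
    rw [Finset.sum_comm]
    exact Finset.sum_congr rfl fun i _ => Finset.sum_congr rfl fun j _ => by
      rw [hhess i j]; ring
  have hBg : ∀ v, ∑ i, ∑ j, (B i j x * (g i x * dg j v + g j x * dg i v)
      + g i x * g j x * dB i j v) = 2 * ∑ j, P j * dg j v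
        + ∑ i, ∑ j, dB i j v * (g i x * g j x) := by
    intro v
    have h1 : ∑ i, ∑ j, B i j x * (g i x * dg j v) = ∑ j, P j * dg j v := by
      rw [Finset.sum_comm]
      refine Finset.sum_congr rfl fun i _ => ?_
      simp only [hP, Pf, Finset.sum_mul]
      exact Finset.sum_congr rfl fun j _ => by rw [hsym j i]; ring
    have h2 : ∑ i, ∑ j, B i j x * (g j x * dg i v) = ∑ j, P j * dg j v := by
      refine Finset.sum_congr rfl fun i _ => ?_
      simp only [hP, Pf, Finset.sum_mul]
      exact Finset.sum_congr rfl fun j _ => by ring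
    simp only [mul_add, Finset.sum_add_distrib, h1, h2]
    have h3 : ∑ i, ∑ j, g i x * g j x * dB i j v = ∑ i, ∑ j, dB i j v * (g i x * g j x) :=
      Finset.sum_congr rfl fun i _ => Finset.sum_congr rfl fun j _ => by ring
    rw [h3]; ring
  have hx1 : ∀ i, ∑ j, x j * (EuclideanSpace.single i (1:ℝ) : Eu n) j = x i := by
    intro i; simp
  rw [Finset.sum_congr rfl (fun i _ => (DY i).pd_eq i)]
  rw [Finset.sum_congr rfl (fun i _ => eP i)]
  simp only [hx1]
  rw [← hbP, ← hxX]
  have hsum : ∀ (DKi Dei Dpi Dxi : Fin n → ℝ) (κ e : ℝ), 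
     ∑ i, ω * (G x * (2 * (κ * Dpi i + P i * DKi i) + τ * (e * Dxi i + X i * Dei i))
       + (2 * (κ * P i) + τ * (e * X i)) * -(τ * G x * x i)) = 
      ω * G x * (2 * κ * (∑ i, Dpi i - τ * ∑ i, x i * P i)
        + τ * e * (∑ i, Dxi i - τ * ∑ i, x i * X i)
        + 2 * (∑ i, P i * DKi i) + τ * (∑ i, X i * Dei i)) := by
    intro DKi Dei Dpi Dxi κ e
    simp only [Finset.mul_sum, ← Finset.sum_add_distrib, ← Finset.sum_sub_distrib]
    exact Finset.sum_congr rfl fun i _ => by ring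
  simp only [← hP, ← hX] at sK ⊢
  rw [hsum, ← sK, ← se]
  have h6 : ∑ j, (X j * dg j P + g j x * dXe (fun i j => B i j x) dB x j P) =
     ∑ j, P j * dg j X + ∑ j, dXe (fun i j => B i j x) dB x j P * g j x := by
    rw [← hHs, Finset.sum_add_distrib]; congr 1
    exact Finset.sum_congr rfl fun i _ => by ring
  simp only [hBg, hdP, hqP, hbX, hbP, h6]
  ring

end pointwise

section bounds
variable {n : ℕ}

lemma coord_le (x : Eu n) (i : Fin n) : |x i| ≤ ‖x‖ := by
  have := PiLp.norm_apply_le x i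
  simpa using this

lemma norm_single_one (i : Fin n) : ‖(EuclideanSpace.single i (1:ℝ) : Eu n)‖ = 1 := by simp

lemma bil_le (M : Fin n → Fin n → ℝ) (m : ℝ) (hM : ∀ i j, |M i j| ≤ m) (u v : Eu n) :
    |∑ i, ∑ j, M i j * (u i * v j)| ≤ (n:ℝ)^2 * m * ‖u‖ * ‖v‖ := by
  calc |∑ i, ∑ j, M i j * (u i * v j)| ≤ ∑ i, ∑ j, |M i j * (u i * v j)| :=
        (Finset.abs_sum_le_sum_abs _ _).trans (Finset.sum_le_sum fun i _ =>
          Finset.abs_sum_le_sum_abs _ _)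
    _ ≤ ∑ i : Fin n, ∑ j : Fin n, m * (‖u‖ * ‖v‖) := by
        refine Finset.sum_le_sum fun i _ => Finset.sum_le_sum fun j _ => ?_
        rw [abs_mul, abs_mul]
        have := coord_le u i
        have := coord_le v j
        have := hM i j
        have : 0 ≤ m := (abs_nonneg _).trans this
        gcongr
    _ = _ := by simp; ring

lemma delta_sum (M : Fin n → Fin n → ℝ) (u v : Eu n) :
    ∑ i, u i * v i - ∑ i, ∑ j, M i j * (u i * v j) =
      ∑ i, ∑ j, ((if i = j then 1 else 0) - M i j) * (u i * v j) := by
  simp [sub_mul, Finset.sum_sub_distrib]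

set_option maxHeartbeats 1000000 in
lemma mat_bounds (n : ℕ) (K : ℝ) (hK : 0 ≤ K) : ∃ D : ℝ, 1 ≤ D ∧
    ∀ (B : Fin n → Fin n → ℝ) (dB : Fin n → Fin n → Eu n →L[ℝ] ℝ) (x g P X : Eu n) (τ : ℝ),
      0 ≤ τ → ‖x‖ ≤ 4 →
      (∀ i j, |B i j - (if i = j then 1 else 0)| ≤ K * ‖x‖) →
      (∀ i j v, |dB i j v| ≤ K * ‖v‖) →
      (∀ i, P i = ∑ j, B i j * g j) → (∀ i, X i = ∑ j, B i j * x j) →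
      |∑ i, ∑ j, B i j * (g i * g j)| ≤ D * ‖g‖ ^ 2 ∧
      |τ * (∑ i, dXe B dB x i (EuclideanSpace.single i 1) - n)| ≤ D * τ * ‖x‖ ∧
      |2 * τ * (∑ i, ∑ j, B i j * (g i * g j)) + τ * (∑ i, ∑ j, dB i j X * (g i * g j)
        - 2 * ∑ j, dXe B dB x j P * g j)| ≤ D * τ * ‖x‖ * ‖g‖ ^ 2 ∧
      |dF0e B dB τ x P| ≤ D * τ ^ 2 * ‖x‖ ^ 2 * ‖g‖ ∧
      |τ * dF0e B dB τ x X| ≤ D * τ ^ 3 * ‖x‖ ^ 3 ∧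
      |τ ^ 2 * (∑ i, x i * x i - ∑ i, ∑ j, B i j * (x i * x j))| ≤ D * τ ^ 2 * ‖x‖ ^ 3 ∧
      ‖X‖ ≤ D * ‖x‖ := by
  set nn : ℝ := (n:ℝ)^2 with hnn
  set m : ℝ := 1 + 4 * K with hm
  set Cm : ℝ := nn * m with hCm
  have hnn0 : 0 ≤ nn := by positivity
  have hm0 : 1 ≤ m := by rw [hm]; linarith
  have hCm0 : 0 ≤ Cm := by positivity
  refine ⟨5 * (nn + 1) * (K + 1) * (Cm + 1), ?_, ?_⟩
  · have h1 : 1 ≤ nn + 1 := by linarith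
    have h2 : 1 ≤ K + 1 := by linarith
    have h3 : 1 ≤ Cm + 1 := by linarith
    nlinarith [one_le_mul_of_one_le_of_one_le (one_le_mul_of_one_le_of_one_le h1 h2) h3]
  intro B dB x g P X τ hτ hx hB hdB hP hX
  set D : ℝ := 5 * (nn + 1) * (K + 1) * (Cm + 1) with hD
  have hDa : Cm ≤ D := by rw [hD]; ring_nf; nlinarith [mul_nonneg hnn0 hK, mul_nonneg hnn0 hCm0, mul_nonneg hK hCm0, mul_nonneg (mul_nonneg hnn0 hK) hCm0]
  have hDb : 5 * (nn * K * Cm) ≤ D := by rw [hD]; ring_nf; nlinarith [mul_nonneg hnn0 hK, mul_nonneg hnn0 hCm0, mul_nonneg hK hCm0, mul_nonneg (mul_nonneg hnn0 hK) hCm0]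
  have hDc : 5 * (nn * K) ≤ D := by rw [hD]; ring_nf; nlinarith [mul_nonneg hnn0 hK, mul_nonneg hnn0 hCm0, mul_nonneg hK hCm0, mul_nonneg (mul_nonneg hnn0 hK) hCm0]
  have hr := norm_nonneg x
  have hγ := norm_nonneg g
  set r := ‖x‖ with hrr
  set γ := ‖g‖ with hgg
  have hBm : ∀ i j, |B i j| ≤ m := by
    intro i j
    have h1 := hB i j
    have h2 : |if i = j then (1:ℝ) else 0| ≤ 1 := by split_ifs <;> simp
    have h3 : |B i j| ≤ |B i j - (if i = j then 1 else 0)| + |if i = j then (1:ℝ) else 0| := by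
      have := abs_add_le (B i j - (if i = j then 1 else 0)) (if i = j then 1 else 0)
      rwa [sub_add_cancel] at this
    have h4 : K * r ≤ K * 4 := by gcongr
    rw [hm]; linarith
  have hBd : ∀ i j, |(if i = j then (1:ℝ) else 0) - B i j| ≤ K * r := by
    intro i j; rw [abs_sub_comm]; exact hB i j
  have mulnorm : ∀ u v : Eu n, (∀ i, u i = ∑ j, B i j * v j) → ‖u‖ ≤ Cm * ‖v‖ := by
    intro u v huv
    have h1 : ‖u‖ ^ 2 = ∑ i, ∑ j, B i j * (u i * v j) := by
      rw [EuclideanSpace.real_norm_sq_eq]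
      refine Finset.sum_congr rfl fun i _ => ?_
      rw [pow_two]; nth_rewrite 2 [huv i]
      rw [Finset.mul_sum]
      exact Finset.sum_congr rfl fun j _ => by ring
    have h2 := (le_abs_self _).trans (bil_le B m hBm u v)
    rw [← h1] at h2
    by_contra hcon
    push Not at hcon
    have : 0 < ‖u‖ := lt_of_le_of_lt (by positivity) hcon
    have := mul_lt_mul_of_pos_left hcon this
    rw [hCm] at this
    nlinarith
  have hPn := mulnorm P g hP
  have hXn := mulnorm X x hX
  have hPn0 := norm_nonneg P
  have hXn0 := norm_nonneg X
  have dBb : ∀ v i j, |dB i j v| ≤ K * ‖v‖ := fun v i j => hdB i j v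
  have hdF : ∀ v : Eu n, |dF0e B dB τ x v| ≤ τ ^ 2 * (3 * (nn * K) * r ^ 2 * ‖v‖) := by
    intro v
    have e : dF0e B dB τ x v = τ ^ 2 * ((∑ i, ∑ j, ((if i = j then 1 else 0) - B i j) * (x i * v j))
        + (∑ i, ∑ j, ((if i = j then 1 else 0) - B i j) * (v i * x j))
        - ∑ i, ∑ j, dB i j v * (x i * x j)) := by
      rw [← delta_sum, ← delta_sum, dF0e]
      congr 1
      have a1 : ∑ i, 2 * (x i * v i) = ∑ i, x i * v i + ∑ i, v i * x i := by
        rw [← Finset.sum_add_distrib]; exact Finset.sum_congr rfl fun i _ => by ring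
      have a2 : ∑ i, ∑ j, (B i j * (x i * v j + x j * v i) + dB i j v * (x i * x j)) =
        ∑ i, ∑ j, B i j * (x i * v j) + ∑ i, ∑ j, B i j * (v i * x j)
          + ∑ i, ∑ j, dB i j v * (x i * x j) := by
        simp only [← Finset.sum_add_distrib]
        exact Finset.sum_congr rfl fun i _ => Finset.sum_congr rfl fun j _ => by ring
      rw [a1, a2]; ring
    rw [e, abs_mul, abs_of_nonneg (by positivity : 0 ≤ τ ^ 2)]
    gcongr
    have b1 := bil_le _ _ hBd x v
    have b2 := bil_le _ _ hBd v x
    have b3 := bil_le _ _ (dBb v) x x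
    rw [← hrr, ← hnn] at b1 b2 b3
    refine (abs_sub _ _).trans ?_
    have := abs_add_le (∑ i, ∑ j, ((if i = j then 1 else 0) - B i j) * (x i * v j))
      (∑ i, ∑ j, ((if i = j then 1 else 0) - B i j) * (v i * x j))
    nlinarith
  have hq : |∑ i, ∑ j, B i j * (g i * g j)| ≤ Cm * γ ^ 2 := by
    have := bil_le _ _ hBm g g
    rw [← hgg] at this
    rw [hCm]; nlinarith
  refine ⟨?_, ?_, ?_, ?_, ?_, ?_, ?_⟩
  · exact hq.trans (by gcongr)
  · rw [abs_mul, abs_of_nonneg hτ]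
    have e : ∑ i, dXe B dB x i (EuclideanSpace.single i 1) - n =
        ∑ i, ((B i i - 1) + ∑ j, dB i j (EuclideanSpace.single i 1) * x j) := by
      simp [dXe, Finset.sum_add_distrib, Finset.sum_sub_distrib]
      ring
    have b1 : |∑ i, ((B i i - 1) + ∑ j, dB i j (EuclideanSpace.single i 1) * x j)| ≤
        2 * (nn * K * r) := by
      calc _ ≤ ∑ i, |(B i i - 1) + ∑ j, dB i j (EuclideanSpace.single i 1) * x j| :=
            Finset.abs_sum_le_sum_abs _ _
        _ ≤ ∑ i : Fin n, (K * r + n * (K * r)) := by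
            refine Finset.sum_le_sum fun i _ => (abs_add_le _ _).trans (add_le_add ?_ ?_)
            · simpa using hB i i
            · calc _ ≤ ∑ j, |dB i j (EuclideanSpace.single i 1) * x j| :=
                    Finset.abs_sum_le_sum_abs _ _
                _ ≤ ∑ j : Fin n, K * r := by
                    refine Finset.sum_le_sum fun j _ => ?_
                    rw [abs_mul]
                    have h1 := hdB i j (EuclideanSpace.single i 1)
                    rw [norm_single_one, mul_one] at h1
                    have h2 := coord_le x j
                    gcongr
                _ = _ := by simp
        _ = (n + nn) * (K * r) := by simp [hnn]; ring
        _ ≤ (nn + nn) * (K * r) := by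
            gcongr
            rw [hnn]
            rcases Nat.eq_zero_or_pos n with h | h
            · simp [h]
            · have : (1:ℝ) ≤ n := by exact_mod_cast h
              nlinarith
        _ = _ := by ring
    rw [e]
    have : 5 * (nn * K) * r ≤ D * r := by gcongr
    have h2 : 0 ≤ nn * K * r := by positivity
    calc _ ≤ τ * (2 * (nn * K * r)) := by gcongr
      _ ≤ τ * (D * r) := mul_le_mul_of_nonneg_left (by linarith) hτ
      _ = _ := by ring
  · have e : 2 * τ * (∑ i, ∑ j, B i j * (g i * g j)) + τ * (∑ i, ∑ j, dB i j X * (g i * g j)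
        - 2 * ∑ j, dXe B dB x j P * g j) =
        τ * (2 * (∑ i, ∑ j, ((if i = j then 1 else 0) - B i j) * (g i * P j))
          + ∑ i, ∑ j, dB i j X * (g i * g j) - 2 * ∑ i, ∑ j, dB i j P * (g i * x j)) := by
      rw [← delta_sum]
      have a1 : ∑ i, ∑ j, B i j * (g i * g j) = ∑ i, g i * P i := by
        refine Finset.sum_congr rfl fun i _ => ?_
        rw [hP, Finset.mul_sum]
        exact Finset.sum_congr rfl fun j _ => by ring
      have a2 : ∑ j, dXe B dB x j P * g j = ∑ i, ∑ j, B i j * (g i * P j) +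
          ∑ i, ∑ j, dB i j P * (g i * x j) := by
        rw [← Finset.sum_add_distrib]
        refine Finset.sum_congr rfl fun i _ => ?_
        rw [dXe, Finset.sum_mul, ← Finset.sum_add_distrib]
        exact Finset.sum_congr rfl fun j _ => by ring
      rw [a1, a2]; ring
    rw [e, abs_mul, abs_of_nonneg hτ]
    have b1 := bil_le _ _ hBd g P
    have b2 := bil_le _ _ (dBb X) g g
    have b3 := bil_le _ _ (dBb P) g x
    rw [← hgg] at b1 b2 b3
    rw [← hrr] at b3
    rw [← hnn] at b1 b2 b3
    have c1 : nn * (K * r) * γ * ‖P‖ ≤ nn * (K * r) * γ * (Cm * γ) := by gcongr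
    have c2 : nn * (K * ‖X‖) * γ * γ ≤ nn * (K * (Cm * r)) * γ * γ := by gcongr
    have c3 : nn * (K * ‖P‖) * γ * r ≤ nn * (K * (Cm * γ)) * γ * r := by gcongr
    have c4 : 5 * (nn * K * Cm) * (r * γ ^ 2) ≤ D * (r * γ ^ 2) := by gcongr
    have : |2 * (∑ i, ∑ j, ((if i = j then 1 else 0) - B i j) * (g i * P j))
          + ∑ i, ∑ j, dB i j X * (g i * g j) - 2 * ∑ i, ∑ j, dB i j P * (g i * x j)|
          ≤ D * (r * γ ^ 2) := by
      have d1 : nn * (K * r) * γ * (Cm * γ) = nn * K * Cm * (r * γ ^ 2) := by ring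
      have d2 : nn * (K * (Cm * r)) * γ * γ = nn * K * Cm * (r * γ ^ 2) := by ring
      have d3 : nn * (K * (Cm * γ)) * γ * r = nn * K * Cm * (r * γ ^ 2) := by ring
      rw [d1] at c1
      rw [d2] at c2
      rw [d3] at c3
      have f1 := b1.trans c1
      have f2 := b2.trans c2
      have f3 := b3.trans c3
      rw [abs_le] at f1 f2 f3 ⊢
      constructor <;> linarith [f1.1, f1.2, f2.1, f2.2, f3.1, f3.2]
    calc _ ≤ τ * (D * (r * γ ^ 2)) := by gcongr
      _ = _ := by ring
  · refine (hdF P).trans ?_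
    have c1 : 3 * (nn * K) * r ^ 2 * ‖P‖ ≤ 3 * (nn * K) * r ^ 2 * (Cm * γ) := by gcongr
    have c2 : 5 * (nn * K * Cm) * (r ^ 2 * γ) ≤ D * (r ^ 2 * γ) := by gcongr
    have c3 : 0 ≤ nn * K * Cm * (r ^ 2 * γ) := by positivity
    calc _ ≤ τ ^ 2 * (D * (r ^ 2 * γ)) := mul_le_mul_of_nonneg_left (by nlinarith) (by positivity)
      _ = _ := by ring
  · rw [abs_mul, abs_of_nonneg hτ]
    have c1 : 3 * (nn * K) * r ^ 2 * ‖X‖ ≤ 3 * (nn * K) * r ^ 2 * (Cm * r) := by gcongr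
    have c2 : 5 * (nn * K * Cm) * (r ^ 2 * r) ≤ D * (r ^ 2 * r) := by gcongr
    have c3 : 0 ≤ nn * K * Cm * (r ^ 2 * r) := by positivity
    calc _ ≤ τ * (τ ^ 2 * (3 * (nn * K) * r ^ 2 * ‖X‖)) := by gcongr; exact hdF X
      _ ≤ τ * (τ ^ 2 * (D * (r ^ 2 * r))) :=
        mul_le_mul_of_nonneg_left (mul_le_mul_of_nonneg_left (by nlinarith) (by positivity)) hτ
      _ = _ := by ring
  · rw [delta_sum, abs_mul, abs_of_nonneg (by positivity : 0 ≤ τ ^ 2)]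
    have b1 := bil_le _ _ hBd x x
    rw [← hnn, ← hrr] at b1
    have c2 : 5 * (nn * K) * r ^ 3 ≤ D * r ^ 3 := by gcongr
    have c3 : 0 ≤ nn * K * r ^ 3 := by positivity
    calc _ ≤ τ ^ 2 * (D * r ^ 3) := by gcongr; nlinarith
      _ = _ := by ring
  · exact hXn.trans (by gcongr)

end bounds

section errs

lemma abs_mul_le_of {a b A B : ℝ} (ha : |a| ≤ A) (hb : |b| ≤ B) : |a * b| ≤ A * B := by
  rw [abs_mul]
  exact mul_le_mul ha hb (abs_nonneg _) ((abs_nonneg _).trans ha)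

set_option maxHeartbeats 1000000 in
lemma bb_scalar {D M i t α ap β r γ q F1 Q2 dFP TX F0 V VX mp w : ℝ} (hD : 1 ≤ D) (hM0 : 0 ≤ M)
    (ht : 0 < t) (hi : i = 1 / t) (hα : 0 ≤ α) (hap0 : 0 ≤ ap) (hap : ap ≤ α * i)
    (hβ : 0 ≤ β) (hβt : β ≤ 15 * i) (hr : 0 ≤ r) (hr4 : r ≤ 4) (hγ : 0 ≤ γ)
    (hq : |q| ≤ D * γ ^ 2) (hF1 : |F1| ≤ D * (i / 2) * r)
    (hQ2 : |Q2| ≤ D * (i / 2) * r * γ ^ 2) (hdFP : |dFP| ≤ D * (i / 2) ^ 2 * r ^ 2 * γ)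
    (hTX : |TX| ≤ D * (i / 2) ^ 3 * r ^ 3) (hF0 : |F0| ≤ D * (i / 2) ^ 2 * r ^ 3)
    (hV : |V| ≤ α ^ 2) (hVX : |VX| ≤ 4 * D * α ^ 2) (hmp : |mp| ≤ M * (β * i)) :
    |q * F1 + Q2 - w * dFP - w ^ 2 * ((V - F0 / 2 - β / 4) * (i + β / 2 + F1) + ap * F1
      + i * F0 - mp + i / 2 * VX - TX / 2)|
      ≤ (40 * D ^ 2 + M) * (r * i * γ ^ 2 + r ^ 2 * i ^ 2 * (|w| * γ)
        + w ^ 2 * (r ^ 3 * i ^ 3 + α * r * i ^ 2 + α ^ 2 * i + β * i)) := by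
  have hi0 : 0 < i := by rw [hi]; positivity
  have hM : 0 ≤ M * (β * i) := (abs_nonneg _).trans hmp
  have hDD : D ≤ D ^ 2 := by nlinarith
  have hD2 : 1 ≤ D ^ 2 := by nlinarith
  -- first terms
  have e1 : |q * F1| ≤ D ^ 2 * (r * i * γ ^ 2) := by
    refine (abs_mul_le_of hq hF1).trans ?_
    have : 0 ≤ D ^ 2 * (r * i * γ ^ 2) := by positivity
    linarith
  have e2 : |Q2| ≤ D ^ 2 * (r * i * γ ^ 2) := by
    refine hQ2.trans ?_
    have h1 : 0 ≤ r * i * γ ^ 2 := by positivity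
    linarith [mul_le_mul_of_nonneg_right hDD h1, mul_nonneg (by linarith : 0 ≤ D) h1]
  have e3 : |w * dFP| ≤ D ^ 2 * (r ^ 2 * i ^ 2 * (|w| * γ)) := by
    refine (abs_mul_le_of le_rfl hdFP).trans ?_
    have h1 : 0 ≤ r ^ 2 * i ^ 2 * (|w| * γ) := by positivity
    linarith [mul_le_mul_of_nonneg_right hDD h1, mul_nonneg (by linarith : 0 ≤ D) h1]
  set a1 := r ^ 3 * i ^ 3 with ha1
  set a2 := α * r * i ^ 2 with ha2
  set a3 := α ^ 2 * i with ha3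
  set a4 := β * i with ha4
  have p1 : 0 ≤ a1 := by positivity
  have p2 : 0 ≤ a2 := by positivity
  have p3 : 0 ≤ a3 := by positivity
  have p4 : 0 ≤ a4 := by positivity
  have f1 : |V - F0 / 2 - β / 4| ≤ α ^ 2 + D * i ^ 2 * r ^ 3 + β := by
    have h : 0 ≤ D * i ^ 2 * r ^ 3 := by positivity
    rw [abs_le] at hV hF0 ⊢
    constructor <;> linarith [hV.1, hV.2, hF0.1, hF0.2]
  have f2 : |i + β / 2 + F1| ≤ 11 * D * i := by
    have h : D * i * r ≤ D * i * 4 := by gcongr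
    have h2 : 1 * i ≤ D * i := by gcongr
    rw [abs_le] at hF1 ⊢
    constructor <;> linarith [hF1.1, hF1.2]
  have f3 : |(V - F0 / 2 - β / 4) * (i + β / 2 + F1)| ≤ 11 * D ^ 2 * (a1 + a3 + a4) := by
    refine (abs_mul_le_of f1 f2).trans ?_
    have : (α ^ 2 + D * i ^ 2 * r ^ 3 + β) * (11 * D * i) = 11 * (D * a3 + D ^ 2 * a1 + D * a4) := by
      rw [ha1, ha3, ha4]; ring
    rw [this]
    linarith [mul_le_mul_of_nonneg_right hDD p3, mul_le_mul_of_nonneg_right hDD p4]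
  have f4 : |ap * F1| ≤ D ^ 2 * a2 := by
    refine (abs_mul_le_of (A := α * i) (by rwa [abs_of_nonneg hap0]) hF1).trans ?_
    have : α * i * (D * (i / 2) * r) = D * a2 / 2 := by rw [ha2]; ring
    rw [this]
    linarith [mul_le_mul_of_nonneg_right hDD p2, mul_nonneg (by linarith : 0 ≤ D) p2]
  have f5 : |i * F0| ≤ D ^ 2 * a1 := by
    refine (abs_mul_le_of (by rw [abs_of_pos hi0]) hF0).trans ?_
    have : i * (D * (i / 2) ^ 2 * r ^ 3) = D * a1 / 4 := by rw [ha1]; ring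
    rw [this]
    linarith [mul_le_mul_of_nonneg_right hDD p1, mul_nonneg (by linarith : 0 ≤ D) p1]
  have f6 : |i / 2 * VX| ≤ 2 * D ^ 2 * a3 := by
    refine (abs_mul_le_of (by rw [abs_of_nonneg (by positivity)]) hVX).trans ?_
    have : i / 2 * (4 * D * α ^ 2) = 2 * (D * a3) := by rw [ha3]; ring
    rw [this]
    linarith [mul_le_mul_of_nonneg_right hDD p3, mul_nonneg (by linarith : 0 ≤ D) p3]
  have f7 : |TX| ≤ D ^ 2 * a1 := by
    refine hTX.trans ?_
    have : D * (i / 2) ^ 3 * r ^ 3 = D * a1 / 8 := by rw [ha1]; ring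
    rw [this]
    linarith [mul_le_mul_of_nonneg_right hDD p1, mul_nonneg (by linarith : 0 ≤ D) p1]
  have e4 : |(V - F0 / 2 - β / 4) * (i + β / 2 + F1) + ap * F1
      + i * F0 - mp + i / 2 * VX - TX / 2| ≤ (40 * D ^ 2 + M) * (a1 + a2 + a3 + a4) := by
    have g1 : 0 ≤ D ^ 2 * a1 := by positivity
    have g2 : 0 ≤ D ^ 2 * a2 := by positivity
    have g3 : 0 ≤ D ^ 2 * a3 := by positivity
    have g4 : 0 ≤ D ^ 2 * a4 := by positivity
    have g5 : 0 ≤ M * a1 := by positivity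
    have g6 : 0 ≤ M * a2 := by positivity
    have g7 : 0 ≤ M * a3 := by positivity
    have hex : (40 * D ^ 2 + M) * (a1 + a2 + a3 + a4) = 40 * (D ^ 2 * a1) + 40 * (D ^ 2 * a2)
      + 40 * (D ^ 2 * a3) + 40 * (D ^ 2 * a4) + M * a1 + M * a2 + M * a3 + M * a4 := by ring
    have hex3 : 11 * D ^ 2 * (a1 + a3 + a4) = 11 * (D ^ 2 * a1) + 11 * (D ^ 2 * a3)
      + 11 * (D ^ 2 * a4) := by ring
    rw [hex3] at f3
    rw [hex]
    rw [abs_le] at f3 f4 f5 f6 f7 hmp ⊢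
    constructor <;> linarith [f3.1, f3.2, f4.1, f4.2, f5.1, f5.2, f6.1, f6.2, f7.1, f7.2,
      hmp.1, hmp.2]
  have e5 : |w ^ 2 * ((V - F0 / 2 - β / 4) * (i + β / 2 + F1) + ap * F1
      + i * F0 - mp + i / 2 * VX - TX / 2)| ≤ w ^ 2 * ((40 * D ^ 2 + M) * (a1 + a2 + a3 + a4)) :=
    abs_mul_le_of (by rw [abs_of_nonneg (by positivity)]) e4
  have b1 : 0 ≤ r * i * γ ^ 2 := by positivity
  have b2 : 0 ≤ r ^ 2 * i ^ 2 * (|w| * γ) := by positivity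
  have h1 := mul_nonneg (by positivity : 0 ≤ D ^ 2) b1
  have h2 := mul_nonneg (by positivity : 0 ≤ D ^ 2) b2
  have h3 := mul_nonneg hM0 b1
  have h4 := mul_nonneg hM0 b2
  have hex : (40 * D ^ 2 + M) * (r * i * γ ^ 2 + r ^ 2 * i ^ 2 * (|w| * γ)
        + w ^ 2 * (a1 + a2 + a3 + a4)) = 40 * (D ^ 2 * (r * i * γ ^ 2)) + M * (r * i * γ ^ 2)
        + 40 * (D ^ 2 * (r ^ 2 * i ^ 2 * (|w| * γ))) + M * (r ^ 2 * i ^ 2 * (|w| * γ))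
        + w ^ 2 * ((40 * D ^ 2 + M) * (a1 + a2 + a3 + a4)) := by ring
  rw [hex]
  rw [abs_le] at e1 e2 e3 e5 ⊢
  constructor <;> linarith [e1.1, e1.2, e2.1, e2.2, e3.1, e3.2, e5.1, e5.2]
end errs

section ptmain
variable {n : ℕ}

/-- time derivative of `ω G e` -/
def PhiT (B : Fin n → Fin n → Eu n → ℝ) (g : Fin n → Eu n → ℝ) (V w wt : Eu n → ℝ)
    (dgt : Fin n → ℝ) (G : Eu n → ℝ) (ω i β ap mp : ℝ) (x : Eu n) : ℝ :=
  ω * G x * ((i + β - 2 * ap + ((i / 2) ^ 2 * (∑ j, x j * x j) - n * (i / 2)))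
      * ef B g V w (i / 2) (-ap + β / 4) x
    + (i * F0f B (i / 2) x - ap * (i + β) - mp) * w x ^ 2
    + 2 * cf B V (i / 2) (-ap + β / 4) x * w x * wt x - 2 * ∑ j, Pf B g j x * dgt j)

lemma alg_identity (ωG K dP τ b e dX xBx xx dwtP sig w dFP kk q dVX dFX c Rg ap β mp V wt F0 F1 i nn : ℝ)
    (hτ : τ = i / 2) (he : e = c * w ^ 2 - q) (hc : c = V - kk) (hkk : kk = F0 / 2 + (-ap + β / 4))
    (hK : K = wt + τ * b + kk * w) (hF0 : F0 = τ ^ 2 * (xx - xBx)) (hF1 : F1 = τ * (dX - nn)) :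
    ωG * (2 * K * (dP - τ * b) + τ * e * (dX - τ * xBx)
      + 2 * (dwtP + τ * sig + w * (dFP / 2) + kk * q)
      + τ * ((dVX - dFX / 2) * w ^ 2 + 2 * c * w * b - Rg))
    + ωG * ((i + β - 2 * ap + (τ ^ 2 * xx - nn * τ)) * e + (i * F0 - ap * (i + β) - mp) * w ^ 2
      + 2 * c * w * wt - 2 * dwtP) =
    2 * (ωG * ((dP - τ * b + c * w) * K)) - ωG * ((β / 2) * (q + ap * w ^ 2) +
      (q * F1 + (2 * τ * q + τ * (Rg - 2 * sig)) - w * dFP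
        - w ^ 2 * ((V - F0 / 2 - β / 4) * (i + β / 2 + F1) + ap * F1
      + i * F0 - mp + i / 2 * dVX - (τ * dFX) / 2))) := by
  subst hF1 he
  rw [hK, hc, hkk, hF0, hτ]
  ring

lemma fin_alg {ωG E CE S K M : ℝ} (hωG : 0 ≤ ωG) (hlow : -CE ≤ E) :
    2 * (2 * (ωG * (S * K)) - ωG * (M + E)) + 2 * ωG * (M - CE) ≤ ωG * (S + K) ^ 2 := by
  nlinarith [mul_nonneg hωG (sq_nonneg (S - K)), mul_le_mul_of_nonneg_left hlow hωG]

/-- size of the error terms -/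
def ErrT (i r γ w α β : ℝ) : ℝ := r * i * γ ^ 2 + r ^ 2 * i ^ 2 * (|w| * γ)
        + w ^ 2 * (r ^ 3 * i ^ 3 + α * r * i ^ 2 + α ^ 2 * i + β * i)

set_option maxHeartbeats 2000000 in
lemma pt_main (n : ℕ) (K : ℝ) (hK : 0 ≤ K) : ∃ C : ℝ, 1 ≤ C ∧
    ∀ (B : Fin n → Fin n → Eu n → ℝ) (g : Fin n → Eu n → ℝ) (V w wt G : Eu n → ℝ)
    (ω i t α ap β mp : ℝ) (x gv : Eu n)
    (dB : Fin n → Fin n → Eu n →L[ℝ] ℝ) (dg : Fin n → Eu n →L[ℝ] ℝ) (dV dw dwt : Eu n →L[ℝ] ℝ),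
    (∀ i j, HasFDerivAt (B i j) (dB i j) x) → (∀ j, HasFDerivAt (g j) (dg j) x) →
    HasFDerivAt V dV x → HasFDerivAt w dw x → HasFDerivAt wt dwt x →
    HasDV G (fun v => - (i / 2 * G x * ∑ i, x i * v i)) x →
    (∀ i j y, B i j y = B j i y) →
    (∀ j, dw (EuclideanSpace.single j 1) = g j x) →
    (∀ j k, dg j (EuclideanSpace.single k 1) = dg k (EuclideanSpace.single j 1)) →
    (∀ j, gv j = g j x) → ‖x‖ ≤ 4 →
    (∀ i j, |B i j x - (if i = j then 1 else 0)| ≤ K * ‖x‖) →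
    (∀ i j v, |dB i j v| ≤ K * ‖v‖) →
    |V x| ≤ α ^ 2 → (∀ v, |dV v| ≤ α ^ 2 * ‖v‖) → 0 < t → i = 1 / t → 0 ≤ α → 0 ≤ ap →
    ap ≤ α * i → 0 ≤ β → β ≤ 15 * i → |mp| ≤ β * i → 0 ≤ ω → 0 ≤ G x →
    2 * (∑ j, pd n j (Yf B g V w wt G ω (i / 2) (-ap + β / 4) j) x
        + PhiT B g V w wt (fun j => dwt (EuclideanSpace.single j 1)) G ω i β ap mp x)
      + 2 * (ω * G x) * (β / 2 * (qf B g x + ap * w x ^ 2) - C * ErrT i ‖x‖ ‖gv‖ (w x) α β)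
      ≤ ω * G x * (∑ j, pd n j (Pf B g j) x + wt x + V x * w x) ^ 2 := by
  obtain ⟨D, hD, hmat⟩ := mat_bounds n K hK
  refine ⟨40 * D ^ 2 + 1, by nlinarith, ?_⟩
  intro B g V w wt G ω i t α ap β mp x gv dB dg dV dw dwt hB hg hV hw hwt hG hsym hwg hhess hgv
    hx hBd hdB hVb hdVb ht hi hα hap0 hap hβ hβt hmp hω hG0
  have hi0 : 0 < i := by rw [hi]; positivity
  set P : Eu n := WithLp.toLp 2 (fun i => Pf B g i x) with hPdef
  set X : Eu n := WithLp.toLp 2 (fun i => Xf B i x) with hXdef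
  have hP : ∀ i, P i = Pf B g i x := fun i => rfl
  have hX : ∀ i, X i = Xf B i x := fun i => rfl
  have hdiv := div_flux B g V w wt G ω (i / 2) (-ap + β / 4) x dB dg dV dw dwt hB hg hV hw hwt hG
    hsym hwg hhess P X hP hX
  obtain ⟨m1, m2, m3, m4, m5, m6, m7⟩ := hmat (fun i j => B i j x) dB x gv P X (i / 2)
    (by positivity) hx hBd hdB (fun i => by rw [hP]; simp only [Pf, hgv]) (fun i => rfl)
  have hdVX : |dV X| ≤ 4 * D * α ^ 2 := by
    refine (hdVb X).trans ?_
    have h1 : D * ‖x‖ ≤ D * 4 := by gcongr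
    have h2 : α ^ 2 * ‖X‖ ≤ α ^ 2 * (D * 4) := by gcongr; exact m7.trans h1
    linarith
  simp only [hgv] at m1 m3
  have hq : ∑ i, ∑ j, B i j x * (g i x * g j x) = qf B g x := rfl
  have hF0 : F0f B (i / 2) x = (i / 2) ^ 2 * (∑ i, x i * x i - ∑ i, ∑ j, B i j x * (x i * x j)) := rfl
  rw [hq] at m1 m3
  rw [← hF0] at m6
  have hbb := bb_scalar (w := w x) hD (zero_le_one) ht hi hα hap0 hap hβ hβt (norm_nonneg x) hx
    (norm_nonneg gv) m1 m2 m3 m4 m5 m6 hVb hdVX (by rwa [one_mul])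
  have hdwtP : ∑ j, Pf B g j x * dwt (EuclideanSpace.single j 1) = dwt P := by
    rw [clm_apply_sum dwt P]
  have halg := alg_identity (ω * G x) (Kf B g w wt (i / 2) (-ap + β / 4) x)
    (∑ i, pd n i (Pf B g i) x) (i / 2) (bf B g x) (ef B g V w (i / 2) (-ap + β / 4) x)
    (∑ i, dXe (fun i j => B i j x) dB x i (EuclideanSpace.single i 1))
    (∑ i, ∑ j, B i j x * (x i * x j)) (∑ i, x i * x i) (dwt P)
    (∑ j, dXe (fun i j => B i j x) dB x j P * g j x) (w x) (dF0e (fun i j => B i j x) dB (i / 2) x P)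
    (kf B (i / 2) (-ap + β / 4) x) (qf B g x) (dV X) (dF0e (fun i j => B i j x) dB (i / 2) x X)
    (cf B V (i / 2) (-ap + β / 4) x) (∑ i, ∑ j, dB i j X * (g i x * g j x)) ap β mp (V x) (wt x)
    (F0f B (i / 2) x) (i / 2 * (∑ i, dXe (fun i j => B i j x) dB x i (EuclideanSpace.single i 1) - n))
    i n rfl rfl rfl rfl rfl rfl rfl
  rw [hdiv, PhiT, hdwtP, halg]
  have hωG : 0 ≤ ω * G x := mul_nonneg hω hG0
  have hlow := neg_le_of_abs_le hbb
  have hZ : ∑ j, pd n j (Pf B g j) x + wt x + V x * w x =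
      (∑ i, pd n i (Pf B g i) x - i / 2 * bf B g x + cf B V (i / 2) (-ap + β / 4) x * w x)
        + Kf B g w wt (i / 2) (-ap + β / 4) x := by
    simp only [cf, Kf]; ring
  rw [hZ, ErrT]
  refine fin_alg hωG hlow
end ptmain

section weights

lemma theta_nonneg {s : ℝ} (h0 : 0 < s) (h1 : s ≤ 1) : 0 ≤ thetaFn s := by
  have : 0 ≤ Real.log (1 / s) := Real.log_nonneg (by rw [le_div_iff₀ h0]; linarith)
  unfold thetaFn
  positivity

lemma theta_le {s : ℝ} (h0 : 0 < s) (h1 : s ≤ 1) : thetaFn s ≤ 15 * s ^ ((1:ℝ)/4) := by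
  have hl0 : 0 ≤ Real.log (1 / s) := Real.log_nonneg (by rw [le_div_iff₀ h0]; linarith)
  have hl : Real.log (1 / s) ≤ 6 * (1 / s) ^ ((1:ℝ)/6) := by
    have := Real.log_le_rpow_div (x := 1 / s) (by positivity) (by norm_num : (0:ℝ) < 1/6)
    linarith
  have h2 : Real.log (1 / s) ^ ((3:ℝ)/2) ≤ (6 * (1 / s) ^ ((1:ℝ)/6)) ^ ((3:ℝ)/2) :=
    Real.rpow_le_rpow hl0 hl (by norm_num)
  have h3 : (6 * (1 / s) ^ ((1:ℝ)/6)) ^ ((3:ℝ)/2) = (6:ℝ) ^ ((3:ℝ)/2) * s ^ (-(1:ℝ)/4) := by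
    rw [Real.mul_rpow (by norm_num) (by positivity), ← Real.rpow_mul (by positivity),
      one_div, Real.inv_rpow h0.le, ← Real.rpow_neg h0.le]
    norm_num
  have h4 : (6:ℝ) ^ ((3:ℝ)/2) ≤ 15 := by
    have : (15:ℝ) = (225:ℝ) ^ ((1:ℝ)/2) := by
      rw [show (225:ℝ) = 15 ^ (2:ℝ) by norm_num, ← Real.rpow_mul (by norm_num)]; norm_num
    rw [this, show (3:ℝ)/2 = 3 * (1/2) by norm_num, Real.rpow_mul (by norm_num)]
    exact Real.rpow_le_rpow (by positivity) (by norm_num) (by norm_num)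
  unfold thetaFn
  calc s ^ ((1:ℝ)/2) * Real.log (1 / s) ^ ((3:ℝ)/2) ≤ s ^ ((1:ℝ)/2) * (15 * s ^ (-(1:ℝ)/4)) := by
        rw [h3] at h2
        gcongr
        refine h2.trans ?_
        gcongr
    _ = 15 * (s ^ ((1:ℝ)/2) * s ^ (-(1:ℝ)/4)) := by ring
    _ = _ := by rw [← Real.rpow_add h0]; norm_num

lemma theta_le' {s : ℝ} (h0 : 0 < s) (h1 : s ≤ 1) : thetaFn s ≤ 15 := by
  refine (theta_le h0 h1).trans ?_
  have := Real.rpow_le_one h0.le h1 (by norm_num : (0:ℝ) ≤ 1/4)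
  linarith

lemma ell_ge {s : ℝ} (h0 : 0 < s) (h1 : s ≤ 1/2) : 1/2 ≤ Real.log (1/s) := by
  have h2 : Real.log 2 ≤ Real.log (1/s) := Real.log_le_log (by norm_num) (by
    rw [le_div_iff₀ h0]; linarith)
  have := Real.log_two_gt_d9
  linarith

lemma hasDeriv_beta {lam t : ℝ} (hl : 0 < lam) (ht : 0 < t) (h1 : lam * t < 1) :
    HasDerivAt (fun t => thetaFn (lam * t) / t)
      (-(thetaFn (lam * t) / t * (1 / t) * (1/2 + 3 / (2 * Real.log (1/(lam*t)))))) t := by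
  have hs : 0 < lam * t := by positivity
  have hpos : 0 < Real.log (1 / (lam*t)) := Real.log_pos (by rw [lt_div_iff₀ hs]; linarith)
  have d0 : HasDerivAt (fun t => lam * t) lam t := by simpa using (hasDerivAt_id t).const_mul lam
  have d1 : HasDerivAt (fun t => (lam * t) ^ ((1:ℝ)/2)) (lam * (1/2) * (lam * t) ^ ((1:ℝ)/2 - 1)) t :=
    d0.rpow_const (Or.inl hs.ne')
  have d2 : HasDerivAt (fun t => Real.log (1 / (lam * t))) (-(1 / t)) t := by
    have : HasDerivAt (fun t => - Real.log (lam * t)) (-(lam / (lam * t))) t := (d0.log hs.ne').neg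
    refine (this.congr_of_eventuallyEq (Eventually.of_forall fun u => ?_)).congr_deriv ?_
    · simp only [one_div, Real.log_inv]
    · field_simp
  have d3 := d2.rpow_const (p := (3:ℝ)/2) (Or.inl hpos.ne')
  have d4 := (d1.mul d3).div (hasDerivAt_id t) ht.ne'
  refine d4.congr_deriv ?_
  simp only [thetaFn, id, Pi.mul_apply]
  rw [Real.rpow_sub_one hs.ne', Real.rpow_sub_one hpos.ne']
  field_simp
  ring

lemma pos_of_deriv {f f' : ℝ → ℝ} {b : ℝ} (hd : ∀ t ∈ Ioo 0 b, HasDerivAt f (f' t) t)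
    (hn : ∀ t ∈ Ioo 0 b, 0 ≤ f' t) (hl : Tendsto f (nhdsWithin 0 (Ioi 0)) (nhds 0)) :
    ∀ t ∈ Ioo 0 b, 0 ≤ f t := by
  intro t ht
  have hmono : MonotoneOn f (Ioo 0 b) := by
    refine monotoneOn_of_deriv_nonneg (convex_Ioo 0 b)
      (fun x hx => (hd x hx).continuousAt.continuousWithinAt)
      (fun x hx => ?_) (fun x hx => ?_)
    · rw [interior_Ioo] at hx
      exact (hd x hx).differentiableAt.differentiableWithinAt
    · rw [interior_Ioo] at hx
      rw [(hd x hx).deriv]; exact hn x hx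
  refine le_of_tendsto hl ?_
  filter_upwards [Ioo_mem_nhdsGT ht.1] with u hu
  exact hmono ⟨hu.1, hu.2.trans ht.2⟩ ht hu.2.le

lemma sigma_facts {lam : ℝ} (hl : 0 < lam) {σ σ' : ℝ → ℝ} (h : SigmaODE lam σ σ') :
    ∃ p : ℝ → ℝ, ∀ t ∈ Ioo 0 (1/lam), 0 < σ t ∧ HasDerivAt σ (σ t / p t) t ∧
      HasDerivAt p (p t * (1 / t + thetaFn (lam * t) / t)) t ∧ t ≤ p t ∧ p t ≤ Real.exp 60 * t ∧
      Real.exp (-240) * t ≤ σ t ∧ σ t ≤ t := by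
  obtain ⟨h0, h0', hc, hd, hpos, hL⟩ := h
  have hlam : 0 < 1 / lam := by positivity
  set L : ℝ → ℝ := fun s => Real.log (σ s) - Real.log s - Real.log (σ' s) with hLdef
  have hnh : ∀ t ∈ Ioo 0 (1/lam), Icc 0 (1/lam) ∈ nhds t := fun t ht => Icc_mem_nhds ht.1 ht.2
  have hsub : ∀ t ∈ Ioo 0 (1/lam), t ∈ Ioc 0 (1/lam) := fun t ht => ⟨ht.1, ht.2.le⟩
  have hLd : ∀ t ∈ Ioo 0 (1/lam), HasDerivAt L (thetaFn (lam * t) / t) t := fun t ht =>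
    (hL t (hsub t ht)).hasDerivAt (hnh t ht)
  have hσd : ∀ t ∈ Ioo 0 (1/lam), HasDerivAt σ (σ' t) t := fun t ht =>
    (hd t ⟨ht.1.le, ht.2.le⟩).hasDerivAt (hnh t ht)
  have hst : ∀ t ∈ Ioo 0 (1/lam), 0 < lam * t ∧ lam * t < 1 := fun t ht => by
    refine ⟨mul_pos hl ht.1, ?_⟩
    have := ht.2
    rw [lt_div_iff₀ hl] at this
    linarith
  -- limits at zero
  have lim1 : Tendsto (fun t => Real.log (σ t) - Real.log t) (nhdsWithin 0 (Ioi 0)) (nhds 0) := by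
    have := (hd 0 ⟨le_rfl, hlam.le⟩)
    rw [h0', hasDerivWithinAt_iff_tendsto_slope] at this
    have h2 : Tendsto (slope σ 0) (nhdsWithin 0 (Ioi 0)) (nhds 1) := by
      refine this.mono_left ?_
      rw [← nhdsWithin_Ioo_eq_nhdsGT hlam]
      refine nhdsWithin_mono _ fun t ht => ⟨⟨ht.1.le, ht.2.le⟩, ?_⟩
      simp; exact ht.1.ne'
    have h3 := h2.log one_ne_zero
    rw [Real.log_one] at h3
    refine h3.congr' ?_
    filter_upwards [Ioo_mem_nhdsGT hlam] with t ht
    rw [slope_def_field, h0, sub_zero, sub_zero, Real.log_div (hpos t (hsub t ht)).1.ne' ht.1.ne']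
  have lim2 : Tendsto L (nhdsWithin 0 (Ioi 0)) (nhds 0) := by
    have h1 : Tendsto σ' (nhdsWithin 0 (Ioi 0)) (nhds 1) := by
      have := hc 0 ⟨le_rfl, hlam.le⟩
      rw [ContinuousWithinAt, h0'] at this
      refine this.mono_left ?_
      rw [← nhdsWithin_Ioo_eq_nhdsGT hlam]
      exact nhdsWithin_mono _ Ioo_subset_Icc_self
    have := lim1.sub (h1.log one_ne_zero)
    simpa using this
  have limq : Tendsto (fun t => (lam * t) ^ ((1:ℝ)/4)) (nhdsWithin 0 (Ioi 0)) (nhds 0) := by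
    have : Continuous (fun t : ℝ => (lam * t) ^ ((1:ℝ)/4)) :=
      (continuous_const.mul continuous_id).rpow_const (fun _ => Or.inr (by norm_num))
    have h1 := (this.tendsto 0).mono_left (nhdsWithin_le_nhds (s := Ioi 0))
    simpa using h1
  have hq : ∀ t ∈ Ioo 0 (1/lam), HasDerivAt (fun t => (lam * t) ^ ((1:ℝ)/4))
      (1 / 4 * ((lam * t) ^ ((1:ℝ)/4) / t)) t := by
    intro t ht
    have d0 : HasDerivAt (fun t => lam * t) lam t := by simpa using (hasDerivAt_id t).const_mul lam
    refine (d0.rpow_const (p := (1:ℝ)/4) (Or.inl (hst t ht).1.ne')).congr_deriv ?_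
    rw [Real.rpow_sub_one (hst t ht).1.ne']
    have := ht.1
    field_simp
  have hL0 : ∀ t ∈ Ioo 0 (1/lam), 0 ≤ L t := pos_of_deriv hLd (fun t ht =>
    div_nonneg (theta_nonneg (hst t ht).1 (hst t ht).2.le) ht.1.le) lim2
  have hL1 : ∀ t ∈ Ioo 0 (1/lam), 0 ≤ 60 * (lam * t) ^ ((1:ℝ)/4) - L t := by
    refine pos_of_deriv (fun t ht => ((hq t ht).const_mul 60).sub (hLd t ht)) (fun t ht => ?_) ?_
    · have := theta_le (hst t ht).1 (hst t ht).2.le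
      have h2 : thetaFn (lam * t) / t ≤ 15 * (lam * t) ^ ((1:ℝ)/4) / t :=
        div_le_div_of_nonneg_right this ht.1.le
      have h3 : 60 * (1 / 4 * ((lam * t) ^ ((1:ℝ)/4) / t)) = 15 * (lam * t) ^ ((1:ℝ)/4) / t := by ring
      linarith
    · simpa using (limq.const_mul 60).sub lim2
  have hs1 : ∀ t ∈ Ioo 0 (1/lam), (lam * t) ^ ((1:ℝ)/4) ≤ 1 := fun t ht =>
    Real.rpow_le_one (hst t ht).1.le (hst t ht).2.le (by norm_num)
  set p : ℝ → ℝ := fun t => t * Real.exp (L t) with hp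
  have hσp : ∀ t ∈ Ioo 0 (1/lam), σ' t = σ t / p t := by
    intro t ht
    have ht0 := ht.1
    obtain ⟨hs, hs'⟩ := hpos t (hsub t ht)
    have : Real.exp (L t) = σ t / t / σ' t := by
      rw [hLdef]
      simp only
      rw [Real.exp_sub, Real.exp_sub, Real.exp_log hs, Real.exp_log hs', Real.exp_log ht0]
    simp only [hp, this]
    field_simp
  have hlogd : ∀ t ∈ Ioo 0 (1/lam), HasDerivAt (fun t => Real.log (σ t) - Real.log t)
      (1 / p t - 1 / t) t := by
    intro t ht
    have hs := (hpos t (hsub t ht)).1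
    refine (((hσd t ht).log hs.ne').sub (Real.hasDerivAt_log ht.1.ne')).congr_deriv ?_
    rw [hσp t ht, one_div, one_div]
    congr 1
    field_simp
  have hpinv : ∀ t ∈ Ioo 0 (1/lam), 1 / p t = 1 / t * Real.exp (-L t) := by
    intro t ht
    simp only [hp]
    rw [Real.exp_neg, one_div, one_div, mul_inv]
  have hlow1 : ∀ t ∈ Ioo 0 (1/lam), 0 ≤ -(Real.log (σ t) - Real.log t) := by
    refine pos_of_deriv (fun t ht => (hlogd t ht).neg) (fun t ht => ?_) (by simpa using lim1.neg)
    rw [hpinv t ht]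
    have h1 : Real.exp (-L t) ≤ 1 := Real.exp_le_one_iff.2 (by linarith [hL0 t ht])
    have h2 : 0 < 1 / t := by have := ht.1; positivity
    nlinarith
  have hlow2 : ∀ t ∈ Ioo 0 (1/lam),
      0 ≤ 240 * (lam * t) ^ ((1:ℝ)/4) + (Real.log (σ t) - Real.log t) := by
    refine pos_of_deriv (fun t ht => ((hq t ht).const_mul 240).add (hlogd t ht)) (fun t ht => ?_)
      (by simpa using (limq.const_mul 240).add lim1)
    rw [hpinv t ht]
    have h1 : 1 - L t ≤ Real.exp (-L t) := by linarith [Real.add_one_le_exp (-L t)]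
    have h2 : 0 < 1 / t := by have := ht.1; positivity
    have h3 := hL1 t ht
    have h4 : 240 * (1 / 4 * ((lam * t) ^ ((1:ℝ)/4) / t)) = (1 / t) * (60 * (lam * t) ^ ((1:ℝ)/4)) := by
      ring
    rw [h4]
    nlinarith
  refine ⟨p, fun t ht => ?_⟩
  have ht0 := ht.1
  have hs := (hpos t (hsub t ht)).1
  refine ⟨hs, ?_, ?_, ?_, ?_, ?_, ?_⟩
  · rw [← hσp t ht]; exact hσd t ht
  · refine ((hasDerivAt_id t).mul (hLd t ht).exp).congr_deriv ?_
    simp only [hp, id]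
    field_simp
  · simp only [hp]
    have := Real.one_le_exp (hL0 t ht)
    nlinarith
  · simp only [hp]
    rw [mul_comm]
    gcongr
    have h1 := hL1 t ht
    have h2 := hs1 t ht
    linarith
  · have h1 := hlow2 t ht
    have h2 := hs1 t ht
    have h3 : -240 + Real.log t ≤ Real.log (σ t) := by linarith
    have := Real.exp_le_exp.2 h3
    rwa [Real.exp_add, Real.exp_log ht0, Real.exp_log hs] at this
  · have h1 := hlow1 t ht
    exact (Real.log_le_log_iff hs ht0).1 (by linarith)

end weights

section absorb

lemma u_facts {lam t α δ : ℝ} (hα : 0 < α) (hδ : 0 < δ) (hl : lam = α / δ ^ 2) (ht : 0 < t)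
    (hs : lam * t ≤ 1/2) : ∃ u : ℝ, 0 ≤ u ∧
      thetaFn (lam * t) / t = u * Real.log (1 / (lam * t)) ∧
      α * Real.log (1 / (lam * t)) = t * (δ * u) ^ 2 ∧ lam ≤ 2 * (thetaFn (lam * t) / t) := by
  have hlam : 0 < lam := by rw [hl]; positivity
  have hs0 : 0 < lam * t := by positivity
  have hℓ := ell_ge hs0 hs
  set ℓ := Real.log (1 / (lam * t)) with hℓd
  have hℓ0 : 0 < ℓ := by linarith
  have hβ : thetaFn (lam * t) / t = Real.sqrt (lam * t) * Real.sqrt ℓ / t * ℓ := by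
    rw [thetaFn, ← hℓd, show (3:ℝ)/2 = 1/2 + 1 by norm_num, Real.rpow_add hℓ0, Real.rpow_one,
      ← Real.sqrt_eq_rpow, ← Real.sqrt_eq_rpow]
    ring
  refine ⟨Real.sqrt (lam * t) * Real.sqrt ℓ / t, by positivity, hβ, ?_, ?_⟩
  · have e : t * (δ * (Real.sqrt (lam * t) * Real.sqrt ℓ / t)) ^ 2 =
        δ ^ 2 * (Real.sqrt (lam * t) ^ 2 * Real.sqrt ℓ ^ 2) / t := by
      field_simp
    rw [e, Real.sq_sqrt hs0.le, Real.sq_sqrt hℓ0.le, hl]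
    field_simp
  · rw [hβ]
    -- sqrt (lam t) ≥ sqrt 2 * lam t; sqrt ℓ * ℓ ≥ ...
    have h1 : Real.sqrt (lam * t) * Real.sqrt ℓ ≥ lam * t := by
      rw [← Real.sqrt_mul hs0.le]
      apply Real.le_sqrt_of_sq_le
      nlinarith
    have h2 : lam ≤ Real.sqrt (lam * t) * Real.sqrt ℓ / t := by
      rw [le_div_iff₀ ht]; exact h1
    nlinarith

lemma near_abs {i t α δ β ℓ u lam r γ w : ℝ} (ht : 0 < t) (hi : i = 1 / t) (hα : 1 ≤ α)
    (hδ : 0 < δ) (hδ1 : δ ≤ 1) (hl : lam = α / δ ^ 2) (hu : 0 ≤ u) (hℓ : 1/2 ≤ ℓ)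
    (hβ : β = u * ℓ) (hαℓ : α * ℓ = t * (δ * u) ^ 2) (hlb : lam ≤ 2 * β)
    (hr : 0 ≤ r) (hγ : 0 ≤ γ) (hnear : r ^ 2 ≤ 16 * α * t * ℓ) :
    ErrT i r γ w α β ≤ 100 * (δ + 1 / α) * (β * (γ ^ 2 + α * i * w ^ 2)) ∧
      r ^ 3 * i ≤ 64 * δ * α * (β * t) := by
  have hi0 : 0 < i := by rw [hi]; positivity
  have hit : i * t = 1 := by rw [hi]; field_simp
  set v := δ * u with hv
  have hv0 : 0 ≤ v := by positivity
  have hrt : r ≤ 4 * t * v := by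
    refine (pow_le_pow_iff_left₀ hr (by positivity) two_ne_zero).1 ?_
    calc r ^ 2 ≤ 16 * t * (α * ℓ) := by linarith
      _ = _ := by rw [hαℓ]; ring
  have hri : r * i ≤ 4 * v := by
    calc r * i ≤ (4 * t * v) * i := by gcongr
      _ = 4 * v * (i * t) := by ring
      _ = _ := by rw [hit, mul_one]
  have hri0 : 0 ≤ r * i := by positivity
  have hβ0 : 0 ≤ β := by rw [hβ]; positivity
  have hu2 : u ≤ 2 * β := by rw [hβ]; nlinarith
  have huv : u * v ^ 2 = β * (α * i) := by
    rw [hβ]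
    calc u * v ^ 2 = u * (i * (t * v ^ 2)) := by rw [← mul_assoc i, hit]; ring
      _ = _ := by rw [← hαℓ]; ring
  set bw := β * (α * i) * w ^ 2 with hbw
  have hbw0 : 0 ≤ bw := by positivity
  set bg := β * γ ^ 2 with hbg
  have hbg0 : 0 ≤ bg := by positivity
  have hvv : v ≤ 2 * δ * β := by rw [hv]; nlinarith
  have t1 : r * i * γ ^ 2 ≤ 8 * δ * bg := by
    calc r * i * γ ^ 2 ≤ (4 * (2 * δ * β)) * γ ^ 2 :=
          mul_le_mul_of_nonneg_right (by linarith) (by positivity)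
      _ = _ := by rw [hbg]; ring
  have t2 : r ^ 2 * i ^ 2 * (|w| * γ) ≤ 16 * δ * bg + 8 * δ * bw := by
    have h1 : r ^ 2 * i ^ 2 ≤ (4 * v) ^ 2 := by
      rw [← mul_pow]; exact pow_le_pow_left₀ hri0 hri 2
    have h2 : v * (|w| * γ) ≤ (γ ^ 2 + v ^ 2 * w ^ 2) / 2 := by
      have := sq_nonneg (γ - v * |w|)
      have h3 : |w| ^ 2 = w ^ 2 := sq_abs w
      nlinarith
    calc r ^ 2 * i ^ 2 * (|w| * γ) ≤ (4 * v) ^ 2 * (|w| * γ) := by gcongr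
      _ = 16 * v * (v * (|w| * γ)) := by ring
      _ ≤ 16 * v * ((γ ^ 2 + v ^ 2 * w ^ 2) / 2) := by gcongr
      _ = 8 * v * γ ^ 2 + 8 * δ * (u * v ^ 2) * w ^ 2 := by rw [hv]; ring
      _ ≤ 8 * (2 * δ * β) * γ ^ 2 + 8 * δ * (u * v ^ 2) * w ^ 2 := by gcongr
      _ = _ := by rw [huv, hbg, hbw]; ring
  have t30 : r ^ 3 * i ^ 3 ≤ 64 * δ * (β * (α * i)) := by
    calc r ^ 3 * i ^ 3 = (r * i) ^ 3 := by ring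
      _ ≤ (4 * v) ^ 3 := pow_le_pow_left₀ hri0 hri 3
      _ = 64 * δ * (u * v ^ 2) := by rw [hv]; ring
      _ = _ := by rw [huv]
  have t4 : α * r * i ^ 2 ≤ 8 * δ * (β * (α * i)) := by
    calc α * r * i ^ 2 = (r * i) * (α * i) := by ring
      _ ≤ (4 * (2 * δ * β)) * (α * i) := mul_le_mul_of_nonneg_right (by linarith) (by positivity)
      _ = _ := by ring
  have hαβ : α ≤ 2 * δ * β := by
    have h1 : α = δ ^ 2 * lam := by rw [hl]; field_simp
    have h2 : δ ^ 2 * lam ≤ δ ^ 2 * (2 * β) := by gcongr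
    nlinarith [mul_nonneg hδ.le hβ0]
  have t5 : α ^ 2 * i ≤ 2 * δ * (β * (α * i)) := by
    calc α ^ 2 * i = α * (α * i) := by ring
      _ ≤ (2 * δ * β) * (α * i) := by gcongr
      _ = _ := by ring
  have t6 : β * i = (1 / α) * (β * (α * i)) := by field_simp
  constructor
  · have hw : w ^ 2 * (r ^ 3 * i ^ 3 + α * r * i ^ 2 + α ^ 2 * i + β * i) ≤
        (74 * δ + 1 / α) * bw := by
      calc _ ≤ w ^ 2 * (64 * δ * (β * (α * i)) + 8 * δ * (β * (α * i)) + 2 * δ * (β * (α * i))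
            + (1 / α) * (β * (α * i))) := by rw [← t6]; gcongr
        _ = _ := by rw [hbw]; ring
    have hα0 : 0 < 1 / α := by positivity
    have e : 100 * (δ + 1 / α) * (β * (γ ^ 2 + α * i * w ^ 2)) = 100 * (δ * bg) + 100 * (1 / α * bg)
      + 100 * (δ * bw) + 100 * (1 / α * bw) := by rw [hbg, hbw]; ring
    rw [e, ErrT]
    have q1 : 0 ≤ δ * bg := by positivity
    have q2 : 0 ≤ 1 / α * bg := by positivity
    have q3 : 0 ≤ δ * bw := by positivity
    have q4 : 0 ≤ 1 / α * bw := by positivity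
    have hw2 : (74 * δ + 1 / α) * bw = 74 * (δ * bw) + 1 / α * bw := by ring
    rw [hw2] at hw
    linarith
  · have h := mul_le_mul_of_nonneg_right t30 (by positivity : 0 ≤ t ^ 2)
    have e1 : r ^ 3 * i ^ 3 * t ^ 2 = r ^ 3 * i * (i * t) ^ 2 := by ring
    have e2 : 64 * δ * (β * (α * i)) * t ^ 2 = 64 * δ * α * (β * t) * (i * t) := by ring
    rw [e1, e2, hit] at h
    linarith

lemma far_err {i t α β r γ w : ℝ} (ht : 0 < t) (ht1 : t ≤ 1) (hi : i = 1 / t) (hα : 1 ≤ α)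
    (hβ0 : 0 ≤ β) (hβ : β ≤ 15 * i) (hr : 0 ≤ r) (hr4 : r ≤ 4) (hγ : 0 ≤ γ) :
    ErrT i r γ w α β ≤ 100 * (α ^ 2 * i ^ 3) * (w ^ 2 + t * γ ^ 2) := by
  have hi1 : 1 ≤ i := by rw [hi, le_div_iff₀ ht]; linarith
  have hit : i * t = 1 := by rw [hi]; field_simp
  have hi0 : 0 < i := by linarith
  set J := α ^ 2 * i ^ 3 with hJ
  have hα2 : 1 ≤ α ^ 2 := by nlinarith
  have j1 : i ^ 3 ≤ J := by rw [hJ]; nlinarith [pow_pos hi0 3]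
  have j2 : i ^ 2 ≤ J := le_trans (by nlinarith [pow_pos hi0 2]) j1
  have j3 : α * i ^ 2 ≤ J := by
    have h1 : α ≤ α ^ 2 := by nlinarith
    have h2 : i ^ 2 ≤ i ^ 3 := by nlinarith [pow_pos hi0 2]
    calc α * i ^ 2 ≤ α ^ 2 * i ^ 3 := by gcongr
      _ = J := rfl
  have j4 : α ^ 2 * i ≤ J := by
    have h2 : i ≤ i ^ 3 := by nlinarith [pow_pos hi0 2]
    calc α ^ 2 * i ≤ α ^ 2 * i ^ 3 := by gcongr
      _ = J := rfl
  have hJ0 : 0 ≤ J := by positivity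
  have hg0 : 0 ≤ t * γ ^ 2 := by positivity
  have t1 : r * i * γ ^ 2 ≤ 4 * J * (t * γ ^ 2) := by
    calc r * i * γ ^ 2 ≤ 4 * i * γ ^ 2 := by gcongr
      _ = 4 * i * (i * t) * γ ^ 2 := by rw [hit]; ring
      _ = 4 * i ^ 2 * (t * γ ^ 2) := by ring
      _ ≤ _ := by gcongr
  have t2 : r ^ 2 * i ^ 2 * (|w| * γ) ≤ 8 * J * (w ^ 2 + t * γ ^ 2) := by
    have h1 : r ^ 2 ≤ 16 := by nlinarith
    have h2 : |w| * γ ≤ i / 2 * (w ^ 2 + t * γ ^ 2) := by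
      have h3 : t * (|w| * γ) ≤ (w ^ 2 + t * γ ^ 2) / 2 := by
        have := sq_nonneg (|w| - t * γ)
        have h4 : |w| ^ 2 = w ^ 2 := sq_abs w
        have h5 : t ^ 2 * γ ^ 2 ≤ t * γ ^ 2 := by
          have : t ^ 2 ≤ t := by nlinarith
          gcongr
        nlinarith
      have := mul_le_mul_of_nonneg_left h3 hi0.le
      rw [← mul_assoc, hit] at this
      linarith
    calc r ^ 2 * i ^ 2 * (|w| * γ) ≤ 16 * i ^ 2 * (i / 2 * (w ^ 2 + t * γ ^ 2)) := by gcongr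
      _ = 8 * i ^ 3 * (w ^ 2 + t * γ ^ 2) := by ring
      _ ≤ _ := by gcongr
  have t3 : r ^ 3 * i ^ 3 ≤ 64 * J := by
    have : r ^ 3 ≤ 4 ^ 3 := pow_le_pow_left₀ hr hr4 3
    calc r ^ 3 * i ^ 3 ≤ 4 ^ 3 * J := by gcongr
      _ = _ := by norm_num
  have t4 : α * r * i ^ 2 ≤ 4 * J := by
    calc α * r * i ^ 2 ≤ α * 4 * i ^ 2 := by gcongr
      _ ≤ _ := by linarith
  have t6 : β * i ≤ 15 * J := by
    calc β * i ≤ 15 * i * i := by gcongr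
      _ ≤ _ := by linarith
  have hw : w ^ 2 * (r ^ 3 * i ^ 3 + α * r * i ^ 2 + α ^ 2 * i + β * i) ≤ w ^ 2 * (84 * J) := by
    gcongr; linarith
  have q1 : 0 ≤ J * w ^ 2 := by positivity
  have q2 : 0 ≤ J * (t * γ ^ 2) := by positivity
  rw [ErrT]
  linarith

lemma far_gauss {n : ℕ} {C t i α lam p σ r : ℝ} (hC : 1 ≤ C) (ht : 0 < t) (hi : i = 1 / t)
    (hα : 1 ≤ α) (hαn : 2 + (n:ℝ) / 2 ≤ 2 * α) (hαl : α ≤ lam) (hs : lam * t ≤ 1)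
    (hp : p ≤ Real.exp 60 * t) (hσ : Real.exp (-240) * t ≤ σ)
    (hfar : 16 * α * t * Real.log (1 / (lam * t)) ≤ r ^ 2) :
    p * σ ^ (-(2 * α)) * (t ^ (-(n:ℝ)/2) * Real.exp (-r ^ 2 / (4 * t))) * (C * (α ^ 2 * i ^ 3)) ≤
      (C * Real.exp 300) ^ (2 * α) * lam ^ (2 * α + (4 + (n:ℝ) / 2)) := by
  have hlam : 0 < lam := by linarith
  have hs0 : 0 < lam * t := by positivity
  have h1 : σ ^ (-(2 * α)) ≤ Real.exp (480 * α) * t ^ (-(2 * α)) := by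
    calc σ ^ (-(2 * α)) ≤ (Real.exp (-240) * t) ^ (-(2 * α)) :=
          Real.rpow_le_rpow_of_nonpos (by positivity) hσ (by linarith)
      _ = _ := by
          rw [Real.mul_rpow (by positivity) ht.le, ← Real.exp_mul]
          ring_nf
  have h2 : Real.exp (-r ^ 2 / (4 * t)) ≤ (lam * t) ^ (4 * α) := by
    rw [Real.rpow_def_of_pos hs0, Real.exp_le_exp, div_le_iff₀ (by positivity)]
    have : Real.log (lam * t) = - Real.log (1 / (lam * t)) := by rw [one_div, Real.log_inv]; ring
    rw [this]
    nlinarith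
  have hσ0 : 0 < σ := lt_of_lt_of_le (by positivity) hσ
  have hi3 : i ^ 3 = t ^ (-(3:ℝ)) := by
    rw [hi, Real.rpow_neg ht.le]; norm_num
  calc p * σ ^ (-(2 * α)) * (t ^ (-(n:ℝ)/2) * Real.exp (-r ^ 2 / (4 * t))) * (C * (α ^ 2 * i ^ 3))
      ≤ (Real.exp 60 * t) * (Real.exp (480 * α) * t ^ (-(2 * α))) * (t ^ (-(n:ℝ)/2) *
        (lam * t) ^ (4 * α)) * (C * (lam ^ 2 * i ^ 3)) := by
          have : 0 ≤ i ^ 3 := by rw [hi]; positivity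
          gcongr
    _ = (C * Real.exp 60 * Real.exp (480 * α)) * ((lam ^ (2:ℝ) * lam ^ (4 * α)) *
        (t ^ (1:ℝ) * t ^ (-(2 * α)) * t ^ (-(n:ℝ)/2) * t ^ (4 * α) * t ^ (-(3:ℝ)))) := by
          rw [hi3, Real.mul_rpow hlam.le ht.le, Real.rpow_one, Real.rpow_two]; ring
    _ = (C * Real.exp 60 * Real.exp (480 * α)) * (lam ^ (2 * α + (4 + (n:ℝ) / 2)) *
        (lam * t) ^ (2 * α - (2 + (n:ℝ)/2))) := by
          rw [Real.mul_rpow hlam.le ht.le, ← mul_assoc (lam ^ (2 * α + (4 + (n:ℝ) / 2)))]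
          simp only [← Real.rpow_add hlam, ← Real.rpow_add ht]
          ring_nf
    _ ≤ (C * Real.exp 60 * Real.exp (480 * α)) * (lam ^ (2 * α + (4 + (n:ℝ) / 2)) * 1) := by
          gcongr
          exact Real.rpow_le_one hs0.le hs (by linarith)
    _ ≤ (C * Real.exp 300) ^ (2 * α) * lam ^ (2 * α + (4 + (n:ℝ) / 2)) := by
          rw [mul_one]
          gcongr
          rw [Real.mul_rpow (by positivity) (by positivity), ← Real.exp_mul, mul_assoc, ← Real.exp_add]
          gcongr
          · nth_rewrite 1 [← Real.rpow_one C]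
            exact Real.rpow_le_rpow_of_exponent_le hC (by linarith)
          · linarith

end absorb

section star

/-- parameters and weights at a given time -/
structure WtP (n : ℕ) (α δ lam t p σ : ℝ) : Prop where
  ht : 0 < t
  hα : 1 ≤ α
  hαn : 2 + (n:ℝ) / 2 ≤ 2 * α
  hδ : 0 < δ
  hδ1 : δ ≤ 1
  hl : lam = α / δ ^ 2
  hs : lam * t ≤ 1 / 2
  hp1 : t ≤ p
  hp2 : p ≤ Real.exp 60 * t
  hσ1 : Real.exp (-240) * t ≤ σ
  hσ2 : σ ≤ t

variable {n : ℕ} {α δ lam t p σ : ℝ}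

lemma WtP.lam_ge (h : WtP n α δ lam t p σ) : α ≤ lam := by
  have h1 := h.hα
  have h2 := h.hδ
  have h3 := h.hδ1
  rw [h.hl, le_div_iff₀ (by positivity)]
  have : δ ^ 2 ≤ 1 := by nlinarith
  nlinarith

lemma WtP.σpos (h : WtP n α δ lam t p σ) : 0 < σ := by
  have := h.ht
  exact lt_of_lt_of_le (by positivity) h.hσ1

lemma WtP.s_pos (h : WtP n α δ lam t p σ) : 0 < lam * t :=
  mul_pos (by linarith [h.lam_ge, h.hα]) h.ht

lemma WtP.t_le (h : WtP n α δ lam t p σ) : t ≤ 1 := by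
  have h1 := h.lam_ge
  have h2 := h.hα
  have h3 := h.ht
  have h4 := h.hs
  nlinarith

lemma WtP.ppos (h : WtP n α δ lam t p σ) : 0 < p := lt_of_lt_of_le h.ht h.hp1

lemma WtP.beta (h : WtP n α δ lam t p σ) : 0 ≤ thetaFn (lam * t) / t ∧
    thetaFn (lam * t) / t ≤ 15 * (1 / t) ∧ lam ≤ 2 * (thetaFn (lam * t) / t) := by
  have h1 := h.hα
  have hs := h.hs
  obtain ⟨u, hu, -, -, h3⟩ := u_facts (by linarith) h.hδ h.hl h.ht h.hs
  refine ⟨div_nonneg (theta_nonneg h.s_pos (by linarith)) h.ht.le, ?_, h3⟩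
  rw [mul_one_div]
  exact div_le_div_of_nonneg_right (theta_le' h.s_pos (by linarith)) h.ht.le

/-- the constant in front of the remainder -/
def Dcst (n : ℕ) (C α lam : ℝ) : ℝ :=
  (100 * C * Real.exp 300) ^ (2 * α) * lam ^ (2 * α + (4 + (n:ℝ) / 2))

lemma star_scalar (h : WtP n α δ lam t p σ) {C c1 r γ q w : ℝ} (hC : 1 ≤ C) (hc1 : 0 < c1)
    (hr : 0 ≤ r) (hr4 : r ≤ 4) (hγ : 0 ≤ γ) (hq : c1 * γ ^ 2 ≤ q) (hc160 : c1 ≤ Real.exp (-60))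
    (hsm : 100 * C * (δ + 1 / α) ≤ c1 / 4) :
    c1 / 8 * ((σ ^ (1 - 2 * α) * γ ^ 2 * (thetaFn (lam * t) / t)
        + α ^ 2 * (σ ^ (-(2 * α)) * w ^ 2)) * (t ^ (-(n:ℝ)/2) * Real.exp (-r ^ 2 / (4 * t))))
      - Dcst n C α lam * (w ^ 2 + t * γ ^ 2) ≤
    p * σ ^ (-(2 * α)) * (t ^ (-(n:ℝ)/2) * Real.exp (-r ^ 2 / (4 * t))) *
      (thetaFn (lam * t) / t / 2 * (q + α / p * w ^ 2)
        - C * ErrT (1 / t) r γ w α (thetaFn (lam * t) / t)) := by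
  obtain ⟨hβ0, hβ15, hlb⟩ := h.beta
  obtain ⟨u, hu, hu1, hu2, -⟩ := u_facts (by linarith [h.hα]) h.hδ h.hl h.ht h.hs
  have hℓ := ell_ge h.s_pos h.hs
  have hnear := @near_abs (1 / t) t α δ (thetaFn (lam * t) / t) _ u lam r γ w h.ht rfl h.hα h.hδ
    h.hδ1 h.hl hu hℓ hu1 hu2 hlb hr hγ
  have hfar := @far_err (1 / t) t α (thetaFn (lam * t) / t) r γ w h.ht h.t_le rfl h.hα hβ0 hβ15
    hr hr4 hγ
  have hg := @far_gauss n (100 * C) t (1 / t) α lam p σ r (by linarith) h.ht rfl h.hα h.hαn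
    h.lam_ge (by linarith [h.hs]) h.hp2 h.hσ1
  have ht := h.ht
  have hα := h.hα
  have hlam := h.lam_ge
  have hp := h.ppos
  have hσ := h.σpos
  set β := thetaFn (lam * t) / t with hβ
  set G := t ^ (-(n:ℝ)/2) * Real.exp (-r ^ 2 / (4 * t)) with hG
  have hG0 : 0 ≤ G := by positivity
  set s2 := σ ^ (-(2 * α)) with hs2
  have hs20 : 0 ≤ s2 := by positivity
  have hs1 : σ ^ (1 - 2 * α) = σ * s2 := by
    rw [hs2, sub_eq_add_neg, Real.rpow_add hσ, Real.rpow_one]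
  rw [hs1]
  set i := 1 / t with hi
  have hi0 : 0 < i := by positivity
  set M := β * (γ ^ 2 + α * i * w ^ 2) with hM
  have hM0 : 0 ≤ M := by positivity
  have hap : c1 * (α * i) ≤ α / p := by
    rw [le_div_iff₀ hp]
    have h1 : c1 * p ≤ t := by
      calc c1 * p ≤ Real.exp (-60) * (Real.exp 60 * t) := by
            have := h.hp2
            gcongr
        _ = t := by rw [← mul_assoc, ← Real.exp_add]; simp
    calc c1 * (α * i) * p = α * i * (c1 * p) := by ring
      _ ≤ α * i * t := by gcongr
      _ = α := by rw [hi]; field_simp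
  have hmain : c1 / 2 * M ≤ β / 2 * (q + α / p * w ^ 2) := by
    calc c1 / 2 * M = β / 2 * (c1 * γ ^ 2 + c1 * (α * i) * w ^ 2) := by rw [hM]; ring
      _ ≤ _ := by gcongr
  have hlow : (σ * s2 * γ ^ 2 * β + α ^ 2 * (s2 * w ^ 2)) ≤ 2 * (p * s2 * M) := by
    have e : 2 * (p * s2 * M) = s2 * γ ^ 2 * β * (2 * p) + s2 * w ^ 2 * (α * ((2 * β) * (p * i))) := by
      rw [hM]; ring
    have a1 : σ ≤ 2 * p := by linarith [h.hσ2, h.hp1]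
    have a2 : 1 ≤ p * i := by rw [hi, mul_one_div, le_div_iff₀ ht]; linarith [h.hp1]
    have a3 : α ≤ 2 * β * (p * i) := by nlinarith
    have a4 : α ^ 2 ≤ α * (2 * β * (p * i)) := by nlinarith
    rw [e]
    have b1 : s2 * γ ^ 2 * β * σ ≤ s2 * γ ^ 2 * β * (2 * p) := by gcongr
    have b2 : s2 * w ^ 2 * α ^ 2 ≤ s2 * w ^ 2 * (α * (2 * β * (p * i))) := by gcongr
    linarith
  have hlow2 : c1 / 8 * ((σ * s2 * γ ^ 2 * β + α ^ 2 * (s2 * w ^ 2)) * G) ≤ p * s2 * G * (c1 / 4 * M) := by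
    calc _ ≤ c1 / 8 * ((2 * (p * s2 * M)) * G) := by gcongr
      _ = _ := by ring
  have hD0 : 0 ≤ Dcst n C α lam := by
    have : 0 < lam := by linarith
    unfold Dcst; positivity
  have hpsG : 0 ≤ p * s2 * G := by positivity
  have hwg : 0 ≤ w ^ 2 + t * γ ^ 2 := by positivity
  rcases le_total (r ^ 2) (16 * α * t * Real.log (1 / (lam * t))) with hc | hc
  · have hE := (hnear hc).1
    have h1 : C * ErrT i r γ w α β ≤ c1 / 4 * M := by
      calc C * ErrT i r γ w α β ≤ C * (100 * (δ + 1 / α) * M) := by gcongr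
        _ = (100 * C * (δ + 1 / α)) * M := by ring
        _ ≤ _ := by gcongr
    have h2 : p * s2 * G * (c1 / 4 * M) ≤ p * s2 * G * (β / 2 * (q + α / p * w ^ 2) - C * ErrT i r γ w α β) := by
      apply mul_le_mul_of_nonneg_left _ hpsG
      linarith
    have := mul_nonneg hD0 hwg
    linarith
  · have hgg := hg hc
    have h1 : p * s2 * G * (C * ErrT i r γ w α β) ≤ Dcst n C α lam * (w ^ 2 + t * γ ^ 2) := by
      calc _ ≤ p * s2 * G * (C * (100 * (α ^ 2 * i ^ 3) * (w ^ 2 + t * γ ^ 2))) := by gcongr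
        _ = p * s2 * G * (100 * C * (α ^ 2 * i ^ 3)) * (w ^ 2 + t * γ ^ 2) := by ring
        _ ≤ _ := by gcongr; exact hgg
    have h2 : p * s2 * G * (c1 / 4 * M) ≤ p * s2 * G * (β / 2 * (q + α / p * w ^ 2)) := by
      apply mul_le_mul_of_nonneg_left _ hpsG
      have : 0 ≤ c1 * M := by positivity
      linarith
    rw [mul_sub]
    linarith

set_option maxHeartbeats 1000000 in
lemma bdry_scalar (h : WtP n α δ lam t p σ) {C c1 r γ q w F0 V : ℝ} (hC : 1 ≤ C) (hc1 : 0 < c1)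
    (hr : 0 ≤ r) (hr4 : r ≤ 4) (hq : c1 * γ ^ 2 ≤ q)
    (hF0 : |F0| ≤ C * (1 / t / 2) ^ 2 * r ^ 3) (hV : |V| ≤ α ^ 2) :
    p * σ ^ (-(2 * α)) * (t ^ (-(n:ℝ)/2) * Real.exp (-r ^ 2 / (4 * t))) *
      ((V - (F0 / 2 + (-(α / p) + thetaFn (lam * t) / t / 4))) * w ^ 2 - q) ≤
    σ ^ (-(2 * α)) * (-(c1 * t) * (γ ^ 2 * (t ^ (-(n:ℝ)/2) * Real.exp (-r ^ 2 / (4 * t))))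
      + 1000 * Real.exp 60 * C * α * (w ^ 2 * (t ^ (-(n:ℝ)/2) * Real.exp (-r ^ 2 / (4 * t)))))
      + Dcst n C α lam * w ^ 2 := by
  obtain ⟨hβ0, hβ15, hlb⟩ := h.beta
  obtain ⟨u, hu, hu1, hu2, -⟩ := u_facts (by linarith [h.hα]) h.hδ h.hl h.ht h.hs
  have hℓ := ell_ge h.s_pos h.hs
  have hnear := @near_abs (1 / t) t α δ (thetaFn (lam * t) / t) _ u lam r 0 w h.ht rfl h.hα h.hδ
    h.hδ1 h.hl hu hℓ hu1 hu2 hlb hr le_rfl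
  have hg := @far_gauss n (100 * C) t (1 / t) α lam p σ r (by linarith) h.ht rfl h.hα h.hαn
    h.lam_ge (by linarith [h.hs]) h.hp2 h.hσ1
  have ht := h.ht
  have ht1 := h.t_le
  have hα := h.hα
  have hδ1 := h.hδ1
  have hδ := h.hδ
  have hlam := h.lam_ge
  have hp := h.ppos
  have hp2 := h.hp2
  have hσ := h.σpos
  have htα : t * α ≤ 1 := by nlinarith [h.hs]
  set β := thetaFn (lam * t) / t with hβ
  set G := t ^ (-(n:ℝ)/2) * Real.exp (-r ^ 2 / (4 * t)) with hG
  have hG0 : 0 ≤ G := by positivity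
  set s2 := σ ^ (-(2 * α)) with hs2
  have hs20 : 0 ≤ s2 := by positivity
  set E := Real.exp 60 with hE
  have hE1 : 1 ≤ E := Real.one_le_exp (by norm_num)
  set i := 1 / t with hi
  have hi0 : 0 < i := by positivity
  have hit : i * t = 1 := by rw [hi]; field_simp
  have hD0 : 0 ≤ Dcst n C α lam := by
    have : 0 < lam := by linarith
    unfold Dcst; positivity
  -- split
  have c1' : p * s2 * G * (c1 * t * γ ^ 2 * i) ≤ p * s2 * G * q := by
    have : c1 * t * γ ^ 2 * i = c1 * γ ^ 2 * (i * t) := by ring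
    rw [this, hit, mul_one]
    gcongr
  have hpi : 1 ≤ p * i := by rw [hi, mul_one_div, le_div_iff₀ ht]; linarith [h.hp1]
  have c2' : s2 * (c1 * t * γ ^ 2 * G) ≤ p * s2 * G * q := by
    refine le_trans ?_ c1'
    have e : p * s2 * G * (c1 * t * γ ^ 2 * i) = s2 * (c1 * t * γ ^ 2 * G) * (p * i) := by ring
    rw [e]
    have : 0 ≤ s2 * (c1 * t * γ ^ 2 * G) := by positivity
    nlinarith
  have c3 : V - (F0 / 2 + (-(α / p) + β / 4)) ≤ α ^ 2 + |F0| / 2 + α / p := by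
    have := neg_abs_le F0
    have := le_abs_self V
    linarith
  have c4 : p * (α ^ 2 + α / p) ≤ 2 * E * α := by
    have e : p * (α ^ 2 + α / p) = p * α ^ 2 + α := by field_simp
    rw [e]
    have : p * α ^ 2 ≤ E * t * α ^ 2 := by gcongr
    have h2 : E * t * α ^ 2 = E * α * (t * α) := by ring
    have h3 : E * α * (t * α) ≤ E * α * 1 := by gcongr
    have h4 : α ≤ E * α := le_mul_of_one_le_left (by linarith) hE1
    linarith
  have c5 : |F0| ≤ C * i ^ 2 * r ^ 3 := by
    refine hF0.trans ?_
    have : 0 ≤ C * i ^ 2 * r ^ 3 := by positivity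
    nlinarith
  have key : s2 * G * (p * (|F0| / 2)) ≤ s2 * G * (960 * E * C * α) + Dcst n C α lam := by
    rcases le_total (r ^ 2) (16 * α * t * Real.log (1 / (lam * t))) with hc | hc
    · have hr3 := (hnear hc).2
      have h0 : β * t ≤ 15 := by
        calc β * t ≤ 15 * i * t := by gcongr
          _ = 15 := by rw [mul_assoc, hit, mul_one]
      have h1 : r ^ 3 * i ≤ 960 * α := by
        calc r ^ 3 * i ≤ 64 * δ * α * (β * t) := hr3
          _ ≤ 64 * 1 * α * 15 := by gcongr
          _ = _ := by ring
      have h2 : p * (|F0| / 2) ≤ 960 * E * C * α := by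
        calc p * (|F0| / 2) ≤ (E * t) * (C * i ^ 2 * r ^ 3) := by
              gcongr
              linarith [abs_nonneg F0]
          _ = E * C * (r ^ 3 * i) * (i * t) := by ring
          _ ≤ E * C * (960 * α) * 1 := by rw [hit]; gcongr
          _ = _ := by ring
      have := mul_le_mul_of_nonneg_left h2 (by positivity : 0 ≤ s2 * G)
      linarith
    · have hgg := hg hc
      have hD : p * s2 * G * (100 * C * (α ^ 2 * i ^ 3)) ≤ Dcst n C α lam := hgg
      have h1 : |F0| / 2 ≤ 100 * C * (α ^ 2 * i ^ 3) := by
        have hi1 : 1 ≤ i := by rw [hi, le_div_iff₀ ht]; linarith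
        have h3 : r ^ 3 ≤ 4 ^ 3 := pow_le_pow_left₀ hr hr4 3
        have h4 : i ^ 2 ≤ α ^ 2 * i ^ 3 := by
          have h5 : 1 ≤ α ^ 2 := by nlinarith
          have h6 : i ^ 2 ≤ i ^ 3 := by nlinarith [pow_pos hi0 2]
          nlinarith [pow_pos hi0 3]
        have h7 : C * i ^ 2 * r ^ 3 ≤ C * (α ^ 2 * i ^ 3) * 4 ^ 3 := by gcongr
        have : 0 ≤ C * (α ^ 2 * i ^ 3) := by positivity
        linarith
      have h2 : s2 * G * (p * (|F0| / 2)) ≤ s2 * G * (p * (100 * C * (α ^ 2 * i ^ 3))) := by gcongr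
      have h3 : 0 ≤ s2 * G * (960 * E * C * α) := by positivity
      linarith
  have c6 : s2 * G * (p * (α ^ 2 + |F0| / 2 + α / p)) ≤ s2 * G * (1000 * E * C * α) + Dcst n C α lam := by
    have e : p * (α ^ 2 + |F0| / 2 + α / p) = p * (α ^ 2 + α / p) + p * (|F0| / 2) := by ring
    rw [e, mul_add]
    have h1 : s2 * G * (p * (α ^ 2 + α / p)) ≤ s2 * G * (2 * E * α) := by gcongr
    have h2 : s2 * G * (2 * E * α) ≤ s2 * G * (2 * E * C * α) := by
      have hEC : 2 * E ≤ 2 * E * C := le_mul_of_one_le_right (by linarith) hC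
      have := mul_le_mul_of_nonneg_right hEC (by linarith : 0 ≤ α)
      exact mul_le_mul_of_nonneg_left this (by positivity)
    have h3 : 0 ≤ s2 * G * (E * C * α) := by positivity
    linarith
  have c7 : p * s2 * G * ((V - (F0 / 2 + (-(α / p) + β / 4))) * w ^ 2) ≤
      (s2 * G * (1000 * E * C * α) + Dcst n C α lam) * w ^ 2 := by
    calc _ ≤ p * s2 * G * ((α ^ 2 + |F0| / 2 + α / p) * w ^ 2) := by gcongr
      _ = s2 * G * (p * (α ^ 2 + |F0| / 2 + α / p)) * w ^ 2 := by ring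
      _ ≤ _ := by gcongr
  rw [mul_sub]
  linarith

end star

section timeder
variable {n : ℕ}

/-- spatial partial derivatives at time `t` -/
def gW (w : Eu n → ℝ → ℝ) (t : ℝ) (j : Fin n) (y : Eu n) : ℝ := pd n j (fun z => w z t) y
/-- time derivative -/
def tW (w : Eu n → ℝ → ℝ) (t : ℝ) (y : Eu n) : ℝ := deriv (fun s => w y s) t

lemma gW_eq {w : Eu n → ℝ → ℝ} (hw : ContDiff ℝ (⊤ : ℕ∞) (fun p : Eu n × ℝ => w p.1 p.2))
    (j : Fin n) (p : Eu n × ℝ) : gW w p.2 j p.1 =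
      fderiv ℝ (fun p : Eu n × ℝ => w p.1 p.2) p (EuclideanSpace.single j 1, 0) := by
  have h1 : HasFDerivAt (fun p : Eu n × ℝ => w p.1 p.2) _ (p.1, p.2) :=
    (hw.differentiable (by simp) (p.1, p.2)).hasFDerivAt
  have h2 : HasFDerivAt (fun z : Eu n => (z, p.2)) (ContinuousLinearMap.inl ℝ (Eu n) ℝ) p.1 :=
    hasFDerivAt_prodMk_left p.1 p.2
  have h3 := (h1.comp p.1 h2).fderiv
  have h4 : (fun p : Eu n × ℝ => w p.1 p.2) ∘ (fun z : Eu n => (z, p.2)) = fun z => w z p.2 := rfl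
  rw [h4] at h3
  unfold gW pd
  rw [h3]
  simp

lemma tW_eq {w : Eu n → ℝ → ℝ} (hw : ContDiff ℝ (⊤ : ℕ∞) (fun p : Eu n × ℝ => w p.1 p.2))
    (p : Eu n × ℝ) : tW w p.2 p.1 =
      fderiv ℝ (fun p : Eu n × ℝ => w p.1 p.2) p (0, 1) := by
  have h1 : HasFDerivAt (fun p : Eu n × ℝ => w p.1 p.2) _ (p.1, p.2) :=
    (hw.differentiable (by simp) (p.1, p.2)).hasFDerivAt
  have h2 : HasFDerivAt (fun s : ℝ => (p.1, s)) (ContinuousLinearMap.inr ℝ (Eu n) ℝ) p.2 :=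
    hasFDerivAt_prodMk_right p.1 p.2
  have h3 := (h1.comp p.2 h2).hasDerivAt.deriv
  have h4 : (fun p : Eu n × ℝ => w p.1 p.2) ∘ (fun s : ℝ => (p.1, s)) = fun s => w p.1 s := rfl
  rw [h4] at h3
  unfold tW
  rw [h3]
  simp

lemma gW_smooth {w : Eu n → ℝ → ℝ} (hw : ContDiff ℝ (⊤ : ℕ∞) (fun p : Eu n × ℝ => w p.1 p.2))
    (j : Fin n) : ContDiff ℝ (⊤ : ℕ∞) (fun p : Eu n × ℝ => gW w p.2 j p.1) := by
  have : (fun p : Eu n × ℝ => gW w p.2 j p.1) = fun p =>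
      fderiv ℝ (fun p : Eu n × ℝ => w p.1 p.2) p (EuclideanSpace.single j 1, 0) := by
    funext p; exact gW_eq hw j p
  rw [this]
  exact (hw.fderiv_right (m := (⊤ : ℕ∞)) (by simp)).clm_apply contDiff_const

lemma tW_smooth {w : Eu n → ℝ → ℝ} (hw : ContDiff ℝ (⊤ : ℕ∞) (fun p : Eu n × ℝ => w p.1 p.2)) :
    ContDiff ℝ (⊤ : ℕ∞) (fun p : Eu n × ℝ => tW w p.2 p.1) := by
  have : (fun p : Eu n × ℝ => tW w p.2 p.1) = fun p =>
      fderiv ℝ (fun p : Eu n × ℝ => w p.1 p.2) p (0, 1) := by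
    funext p; exact tW_eq hw p
  rw [this]
  exact (hw.fderiv_right (m := (⊤ : ℕ∞)) (by simp)).clm_apply contDiff_const

lemma sm_left {f : Eu n × ℝ → ℝ} (hf : ContDiff ℝ (⊤ : ℕ∞) f) (t : ℝ) :
    ContDiff ℝ (⊤ : ℕ∞) (fun y : Eu n => f (y, t)) := hf.comp (contDiff_id.prodMk contDiff_const)

lemma sm_right {f : Eu n × ℝ → ℝ} (hf : ContDiff ℝ (⊤ : ℕ∞) f) (x : Eu n) :
    ContDiff ℝ (⊤ : ℕ∞) (fun t : ℝ => f (x, t)) := hf.comp (contDiff_const.prodMk contDiff_id)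

/-- second derivative -/
lemma w_second {w : Eu n → ℝ → ℝ} (hw : ContDiff ℝ (⊤ : ℕ∞) (fun p : Eu n × ℝ => w p.1 p.2))
    (x : Eu n) (t : ℝ) :
    (∀ j k, fderiv ℝ (gW w t j) x (EuclideanSpace.single k 1)
      = fderiv ℝ (gW w t k) x (EuclideanSpace.single j 1)) ∧
    (∀ j, HasDerivAt (fun s => gW w s j x) (fderiv ℝ (tW w t) x (EuclideanSpace.single j 1)) t) := by
  set W := fun p : Eu n × ℝ => w p.1 p.2 with hW
  have hsym : ∀ u v, fderiv ℝ (fderiv ℝ W) (x, t) u v = fderiv ℝ (fderiv ℝ W) (x, t) v u := by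
    have : IsSymmSndFDerivAt ℝ W (x, t) :=
      hw.contDiffAt.isSymmSndFDerivAt (by simp only [minSmoothness_of_isRCLikeNormedField]; exact WithTop.coe_le_coe.2 (le_top : (2:ℕ∞) ≤ ⊤))
    exact fun u v => this u v
  have hd : HasFDerivAt (fderiv ℝ W) (fderiv ℝ (fderiv ℝ W) (x, t)) (x, t) :=
    ((hw.fderiv_right (m := (⊤ : ℕ∞)) (by simp)).differentiable (by simp) _).hasFDerivAt
  have hdir : ∀ v : Eu n × ℝ, HasFDerivAt (fun p => fderiv ℝ W p v)
      ((fderiv ℝ (fderiv ℝ W) (x, t)).flip v) (x, t) := by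
    intro v
    have := hd.clm_apply (hasFDerivAt_const v (x, t))
    refine this.congr_fderiv ?_
    ext <;> simp
  have h2 : HasFDerivAt (fun z : Eu n => (z, t)) (ContinuousLinearMap.inl ℝ (Eu n) ℝ) x :=
    hasFDerivAt_prodMk_left x t
  have h3 : HasFDerivAt (fun s : ℝ => (x, s)) (ContinuousLinearMap.inr ℝ (Eu n) ℝ) t :=
    hasFDerivAt_prodMk_right x t
  have hg : ∀ j, HasFDerivAt (gW w t j) _ x := fun j => by
    have := (hdir (EuclideanSpace.single j 1, 0)).comp x h2
    refine this.congr_of_eventuallyEq (Eventually.of_forall fun y => ?_)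
    exact gW_eq hw j (y, t)
  have ht : HasFDerivAt (tW w t) (((fderiv ℝ (fderiv ℝ W) (x, t)).flip (0, 1)).comp
      (ContinuousLinearMap.inl ℝ (Eu n) ℝ)) x := by
    have := (hdir (0, 1)).comp x h2
    refine this.congr_of_eventuallyEq (Eventually.of_forall fun y => ?_)
    exact tW_eq hw (y, t)
  refine ⟨fun j k => ?_, fun j => ?_⟩
  · rw [(hg j).fderiv, (hg k).fderiv]
    simpa using hsym _ _
  · rw [ht.fderiv]
    have := (hdir (EuclideanSpace.single j 1, 0)).comp t h3
    have h5 : HasFDerivAt (fun s => gW w s j x) (((fderiv ℝ (fderiv ℝ W) (x, t)).flip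
        (EuclideanSpace.single j 1, 0)).comp (ContinuousLinearMap.inr ℝ (Eu n) ℝ)) t := by
      refine this.congr_of_eventuallyEq (Eventually.of_forall fun s => ?_)
      exact gW_eq hw j (x, s)
    refine h5.hasDerivAt.congr_deriv ?_
    simpa using hsym _ _

lemma Gk_dv (x : Eu n) {t : ℝ} (ht : 0 < t) :
    HasDV (fun y => Gk n y t) (fun v => -(1 / t / 2 * Gk n x t * ∑ i, x i * v i)) x := by
  have h1 : HasFDerivAt (fun y : Eu n => ‖y‖ ^ 2) _ x := (hasStrictFDerivAt_norm_sq x).hasFDerivAt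
  have h2 : HasFDerivAt (fun y : Eu n => Gk n y t) _ x :=
    (((h1.neg.mul_const (1 / (4 * t))).exp).const_mul (t ^ (-(n:ℝ)/2))).congr_of_eventuallyEq
      (Eventually.of_forall fun y => by simp [Gk, div_eq_mul_inv])
  refine ⟨_, h2, fun v => ?_⟩
  have : inner ℝ x v = ∑ i, x i * v i := by
    simp [PiLp.inner_apply, mul_comm]
  simp [Gk, this]
  rw [show -(‖x‖ ^ 2 * (t⁻¹ * 4⁻¹)) = -‖x‖ ^ 2 / (4 * t) by field_simp]
  field_simp
  ring

lemma Gk_dt (x : Eu n) {t : ℝ} (ht : 0 < t) :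
    HasDerivAt (fun s => Gk n x s)
      (Gk n x t * ((1 / t / 2) ^ 2 * (∑ j, x j * x j) - n * (1 / t / 2))) t := by
  have h1 : HasDerivAt (fun s : ℝ => s ^ (-(n:ℝ)/2)) _ t :=
    Real.hasDerivAt_rpow_const (Or.inl ht.ne')
  have h2 : HasDerivAt (fun s : ℝ => -‖x‖ ^ 2 / (4 * s)) (‖x‖ ^ 2 / (4 * t ^ 2)) t := by
    have := ((hasDerivAt_inv ht.ne').const_mul (-‖x‖ ^ 2 / 4))
    refine (this.congr_of_eventuallyEq (Eventually.of_forall fun s => ?_)).congr_deriv ?_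
    · simp; field_simp
    · field_simp
  have h3 := h1.mul h2.exp
  refine h3.congr_deriv ?_
  have e : ∑ j, x j * x j = ‖x‖ ^ 2 := by
    rw [EuclideanSpace.norm_sq_eq]; simp [sq]
  rw [e]
  have e2 : t ^ (-(n:ℝ)/2 - 1) = t ^ (-(n:ℝ)/2) / t := by rw [Real.rpow_sub_one ht.ne']
  rw [e2]
  simp only [Gk]
  field_simp
  ring

lemma phi_deriv {B : Fin n → Fin n → Eu n → ℝ} (hB : ∀ i j y, B i j y = B j i y) {V : Eu n → ℝ}
    {w : Eu n → ℝ → ℝ} {σ p β : ℝ → ℝ} {α mp t : ℝ} {x : Eu n} {wt : Eu n → ℝ} {dgt : Fin n → ℝ}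
    (ht : 0 < t) (hσp : 0 < σ t) (hpp : 0 < p t)
    (hσ : HasDerivAt σ (σ t / p t) t) (hp : HasDerivAt p (p t * (1 / t + β t)) t)
    (hβ : HasDerivAt β (4 * mp) t) (hw : HasDerivAt (fun s => w x s) (wt x) t)
    (hg : ∀ j, HasDerivAt (fun s => gW w s j x) (dgt j) t) :
    HasDerivAt (fun s => (p s * σ s ^ (-(2 * α))) * Gk n x s *
        ef B (gW w s) V (fun y => w y s) (1 / s / 2) (-(α / p s) + β s / 4) x)
      (PhiT B (gW w t) V (fun y => w y t) wt dgt (fun y => Gk n y t) (p t * σ t ^ (-(2 * α)))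
        (1 / t) (β t) (α / p t) mp x) t := by
  have hω : HasDerivAt (fun s => p s * σ s ^ (-(2 * α)))
      ((p t * σ t ^ (-(2 * α))) * (1 / t + β t - 2 * (α / p t))) t := by
    have h1 := hσ.rpow_const (p := -(2 * α)) (Or.inl hσp.ne')
    refine (hp.mul h1).congr_deriv ?_
    rw [Real.rpow_sub_one hσp.ne']
    field_simp
    ring
  have hτ : HasDerivAt (fun s : ℝ => 1 / s / 2) (-(1 / t) ^ 2 / 2) t := by
    have := (hasDerivAt_inv ht.ne').div_const 2
    refine (this.congr_of_eventuallyEq (Eventually.of_forall fun s => ?_)).congr_deriv ?_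
    · simp
    · simp
  have hF : HasDerivAt (fun s : ℝ => F0f B (1 / s / 2) x) (-(2 * (1 / t)) * F0f B (1 / t / 2) x) t := by
    unfold F0f
    refine ((hτ.pow 2).mul_const _).congr_deriv ?_
    simp
    ring
  have hap : HasDerivAt (fun s : ℝ => α / p s) (-(α / p t * (1 / t + β t))) t := by
    have := (hp.inv hpp.ne').const_mul α
    refine (this.congr_of_eventuallyEq (Eventually.of_forall fun s => ?_)).congr_deriv ?_
    · simp [div_eq_mul_inv]
    · field_simp
  have hc : HasDerivAt (fun s : ℝ => cf B V (1 / s / 2) (-(α / p s) + β s / 4) x)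
      ((1 / t) * F0f B (1 / t / 2) x - α / p t * (1 / t + β t) - mp) t := by
    unfold cf kf
    refine (((hF.div_const 2).add (hap.neg.add (hβ.div_const 4))).const_sub (V x)).congr_deriv ?_
    ring
  have hq : HasDerivAt (fun s : ℝ => qf B (gW w s) x) (2 * ∑ j, Pf B (gW w t) j x * dgt j) t := by
    unfold qf
    have : HasDerivAt (fun s : ℝ => ∑ i, ∑ j, B i j x * (gW w s i x * gW w s j x))
      (∑ i, ∑ j, B i j x * (dgt i * gW w t j x + gW w t i x * dgt j)) t :=
      HasDerivAt.fun_sum fun i _ => HasDerivAt.fun_sum fun j _ => ((hg i).mul (hg j)).const_mul _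
    refine this.congr_deriv ?_
    simp only [mul_add, Finset.sum_add_distrib, Pf, Finset.sum_mul, two_mul]
    congr 1
    · refine Finset.sum_congr rfl fun i _ => Finset.sum_congr rfl fun j _ => by ring
    · rw [Finset.sum_comm]
      refine Finset.sum_congr rfl fun i _ => Finset.sum_congr rfl fun j _ => by
        rw [hB j i]; ring
  have he : HasDerivAt (fun s : ℝ => ef B (gW w s) V (fun y => w y s) (1 / s / 2)
      (-(α / p s) + β s / 4) x)
      (((1 / t) * F0f B (1 / t / 2) x - α / p t * (1 / t + β t) - mp) * w x t ^ 2
        + 2 * cf B V (1 / t / 2) (-(α / p t) + β t / 4) x * w x t * wt x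
        - 2 * ∑ j, Pf B (gW w t) j x * dgt j) t := by
    unfold ef
    refine ((hc.mul (hw.pow 2)).sub hq).congr_deriv ?_
    simp
    ring
  refine ((hω.mul (Gk_dt x ht)).mul he).congr_deriv ?_
  simp only [PhiT, Pi.mul_apply]
  ring

end timeder

section setup
open scoped NNReal Topology
variable {n : ℕ}

/-- the structural constant -/
def Cc (n : ℕ) (K : ℝ) (hK : 0 ≤ K) : ℝ :=
  Classical.choose (pt_main n K hK) + Classical.choose (mat_bounds n K hK)

/-- standing assumptions -/
structure Su (n : ℕ) (K : ℝ) (hK : 0 ≤ K) (c1 α δ lam : ℝ) (B : Fin n → Fin n → Eu n → ℝ)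
    (V : Eu n → ℝ) (w : Eu n → ℝ → ℝ) (σ p : ℝ → ℝ) : Prop where
  hBs : ∀ i j y, B i j y = B j i y
  hBl : ∀ i j x y, |B i j x - B i j y| ≤ K * ‖x - y‖
  hB0 : ∀ i j, B i j 0 = if i = j then 1 else 0
  hBe : ∀ (x ξ : Eu n), c1 * ‖ξ‖ ^ 2 ≤ ∑ i, ∑ j, B i j x * (ξ i * ξ j)
  hV : ContDiff ℝ 1 V
  hVb : ∀ p ∈ tsupport (fun p : Eu n × ℝ => w p.1 p.2), |V p.1| ≤ α ^ 2 ∧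
    ∀ v, |fderiv ℝ V p.1 v| ≤ α ^ 2 * ‖v‖
  hw : TestFn n (Metric.ball (0:Eu n) 4) (1 / (2 * lam)) w
  hα : 1 ≤ α
  hαn : 2 + (n:ℝ) / 2 ≤ 2 * α
  hδ : 0 < δ
  hδ1 : δ ≤ 1
  hl : lam = α / δ ^ 2
  hc1 : 0 < c1
  hc160 : c1 ≤ Real.exp (-60)
  hsm : 100 * Cc n K hK * (δ + 1 / α) ≤ c1 / 4
  hσ : ∀ t ∈ Ioo 0 (1 / lam), 0 < σ t ∧ HasDerivAt σ (σ t / p t) t ∧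
    HasDerivAt p (p t * (1 / t + thetaFn (lam * t) / t)) t ∧ t ≤ p t ∧ p t ≤ Real.exp 60 * t ∧
    Real.exp (-240) * t ≤ σ t ∧ σ t ≤ t

variable {K : ℝ} {hK : 0 ≤ K} {c1 α δ lam : ℝ} {B : Fin n → Fin n → Eu n → ℝ}
    {V : Eu n → ℝ} {w : Eu n → ℝ → ℝ} {σ p : ℝ → ℝ}

lemma Cc_ge (hK : 0 ≤ K) : 1 ≤ Cc n K hK := by
  have h1 := (Classical.choose_spec (pt_main n K hK)).1
  have h2 := (Classical.choose_spec (mat_bounds n K hK)).1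
  unfold Cc
  linarith

lemma Su.lam_pos (S : Su n K hK c1 α δ lam B V w σ p) : 0 < lam := by
  have := S.hα
  have := S.hδ
  rw [S.hl]; positivity

lemma Su.mem_Ioo (S : Su n K hK c1 α δ lam B V w σ p) {t : ℝ} (ht : 0 < t) (ht2 : t ≤ 1 / (2 * lam)) :
    t ∈ Ioo 0 (1 / lam) := by
  have := S.lam_pos
  refine ⟨ht, ht2.trans_lt ?_⟩
  apply one_div_lt_one_div_of_lt this
  linarith

lemma Su.wt (S : Su n K hK c1 α δ lam B V w σ p) {t : ℝ} (ht : 0 < t) (ht2 : t ≤ 1 / (2 * lam)) :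
    WtP n α δ lam t (p t) (σ t) := by
  have hl := S.lam_pos
  obtain ⟨h1, h2, h3, h4, h5, h6, h7⟩ := S.hσ t (S.mem_Ioo ht ht2)
  refine ⟨ht, S.hα, S.hαn, S.hδ, S.hδ1, S.hl, ?_, h4, h5, h6, h7⟩
  rw [le_div_iff₀ (by positivity)] at ht2
  linarith

lemma Su.van (S : Su n K hK c1 α δ lam B V w σ p) {x : Eu n} {t : ℝ}
    (h : (x, t) ∉ tsupport (fun p : Eu n × ℝ => w p.1 p.2)) :
    w x t = 0 ∧ (∀ j, gW w t j x = 0) ∧ tW w t x = 0 := by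
  have h0 : (fun p : Eu n × ℝ => w p.1 p.2) =ᶠ[𝓝 (x, t)] 0 := notMem_tsupport_iff_eventuallyEq.1 h
  have h1 : fderiv ℝ (fun p : Eu n × ℝ => w p.1 p.2) (x, t) = 0 := by
    rw [h0.fderiv_eq]; simp
  refine ⟨h0.self_of_nhds, fun j => ?_, ?_⟩
  · have := gW_eq S.hw.1 j (x, t)
    rw [h1] at this; simpa using this
  · have := tW_eq S.hw.1 (x, t)
    rw [h1] at this; simpa using this

lemma Su.van_ev (S : Su n K hK c1 α δ lam B V w σ p) {x : Eu n} {t : ℝ}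
    (h : (x, t) ∉ tsupport (fun p : Eu n × ℝ => w p.1 p.2)) :
    ∀ᶠ y in 𝓝 x, w y t = 0 ∧ (∀ j, gW w t j y = 0) ∧ tW w t y = 0 := by
  have ho : IsOpen (tsupport (fun p : Eu n × ℝ => w p.1 p.2))ᶜ := (isClosed_tsupport _).isOpen_compl
  have hc : Continuous (fun y : Eu n => (y, t)) := by fun_prop
  have := (ho.preimage hc).mem_nhds (show x ∈ _ from h)
  filter_upwards [this] with y hy
  exact S.van hy

lemma Su.notMem (S : Su n K hK c1 α δ lam B V w σ p) {x : Eu n} {t : ℝ} (h : 4 ≤ ‖x‖) :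
    (x, t) ∉ tsupport (fun p : Eu n × ℝ => w p.1 p.2) := by
  intro hx
  have := (S.hw.2.2 hx).1
  simp at this
  linarith

lemma Su.notMem_t (S : Su n K hK c1 α δ lam B V w σ p) {x : Eu n} {t : ℝ} (h : 1 / (2 * lam) ≤ t) :
    (x, t) ∉ tsupport (fun p : Eu n × ℝ => w p.1 p.2) := by
  intro hx
  have := (S.hw.2.2 hx).2.2
  simp only at this
  linarith

/-- flux at time t -/
def Yt (B : Fin n → Fin n → Eu n → ℝ) (V : Eu n → ℝ) (w : Eu n → ℝ → ℝ) (ω β ap t : ℝ) (j : Fin n) :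
    Eu n → ℝ :=
  Yf B (gW w t) V (fun y => w y t) (tW w t) (fun y => Gk n y t) ω (1 / t / 2) (-ap + β / 4) j

lemma LL_smooth {f : Eu n → ℝ} (hf : ContDiff ℝ (⊤ : ℕ∞) f) : LocallyLipschitz f :=
  (hf.of_le (by exact_mod_cast le_top : (1 : WithTop ℕ∞) ≤ ((⊤ : ℕ∞) : WithTop ℕ∞))).locallyLipschitz

lemma LL_pow2 {f : Eu n → ℝ} (hf : LocallyLipschitz f) : LocallyLipschitz (fun y => f y ^ 2) := by
  simp only [sq]; exact LL_mul hf hf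

lemma Su.B_LL (S : Su n K hK c1 α δ lam B V w σ p) (i j : Fin n) : LipschitzWith ⟨K, hK⟩ (B i j) := by
  refine LipschitzWith.of_dist_le_mul fun x y => ?_
  rw [Real.dist_eq, dist_eq_norm]
  exact S.hBl i j x y

lemma Gk_smooth_x (t : ℝ) : ContDiff ℝ (⊤ : ℕ∞) (fun y => Gk n y t) := by
  unfold Gk
  have : ContDiff ℝ (⊤ : ℕ∞) (fun y : Eu n => ‖y‖ ^ 2) := contDiff_norm_sq ℝ
  exact contDiff_const.mul ((this.neg.div_const _).exp)

lemma Su.Y_LL (S : Su n K hK c1 α δ lam B V w σ p) (ω β ap t : ℝ) (j : Fin n) :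
    LocallyLipschitz (Yt B V w ω β ap t j) := by
  have hB := fun i j => (S.B_LL i j).locallyLipschitz
  have hg : ∀ j, LocallyLipschitz (gW w t j) := fun j => LL_smooth (sm_left (gW_smooth S.hw.1 j) t)
  have ht : LocallyLipschitz (tW w t) := LL_smooth (sm_left (tW_smooth S.hw.1) t)
  have hw : LocallyLipschitz (fun y => w y t) := LL_smooth (sm_left S.hw.1 t)
  have hV : LocallyLipschitz V := S.hV.locallyLipschitz
  have hG : LocallyLipschitz (fun y => Gk n y t) := LL_smooth (Gk_smooth_x t)
  have hx : ∀ j : Fin n, LocallyLipschitz (fun y : Eu n => y j) := fun j =>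
    (EuclideanSpace.proj (𝕜 := ℝ) j : Eu n →L[ℝ] ℝ).lipschitz.locallyLipschitz
  have hX : ∀ i, LocallyLipschitz (Xf B i) := fun i => LL_sum _ fun j => LL_mul (hB i j) (hx j)
  have hP : ∀ i, LocallyLipschitz (Pf B (gW w t) i) := fun i => LL_sum _ fun j => LL_mul (hB i j) (hg j)
  have hb : LocallyLipschitz (bf B (gW w t)) := LL_sum _ fun j => LL_mul (hX j) (hg j)
  have hq : LocallyLipschitz (qf B (gW w t)) := LL_sum _ fun i => LL_sum _ fun j =>
    LL_mul (hB i j) (LL_mul (hg i) (hg j))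
  have hF : LocallyLipschitz (F0f B (1 / t / 2)) := LL_mul (LL_const _) (LL_sub
    (LL_sum _ fun i => LL_mul (hx i) (hx i))
    (LL_sum _ fun i => LL_sum _ fun j => LL_mul (hB i j) (LL_mul (hx i) (hx j))))
  have hk : LocallyLipschitz (kf B (1 / t / 2) (-ap + β / 4)) := by
    unfold kf
    simp only [div_eq_mul_inv]
    simp only [div_eq_mul_inv] at hF
    exact LL_add (LL_mul hF (LL_const _)) (LL_const _)
  have hc : LocallyLipschitz (cf B V (1 / t / 2) (-ap + β / 4)) := LL_sub hV hk
  have hKf : LocallyLipschitz (Kf B (gW w t) (fun y => w y t) (tW w t) (1 / t / 2) (-ap + β / 4)) :=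
    LL_add (LL_add ht (LL_mul (LL_const _) hb)) (LL_mul hk hw)
  have he : LocallyLipschitz (ef B (gW w t) V (fun y => w y t) (1 / t / 2) (-ap + β / 4)) :=
    LL_sub (LL_mul hc (LL_pow2 hw)) hq
  exact LL_mul (LL_const _) (LL_mul hG (LL_add (LL_mul (LL_const _) (LL_mul hKf (hP j)))
    (LL_mul (LL_const _) (LL_mul he (hX j)))))

lemma Yt_zero {ω β ap t : ℝ} {j : Fin n} {y : Eu n} (h : w y t = 0 ∧ (∀ j, gW w t j y = 0) ∧ tW w t y = 0) :
    Yt B V w ω β ap t j y = 0 := by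
  obtain ⟨h1, h2, h3⟩ := h
  simp [Yt, Yf, Kf, ef, Pf, qf, bf, h1, h2, h3]

lemma Su.Y_cs (S : Su n K hK c1 α δ lam B V w σ p) (ω β ap t : ℝ) (j : Fin n) :
    HasCompactSupport (Yt B V w ω β ap t j) := by
  refine HasCompactSupport.intro (isCompact_closedBall (0:Eu n) 4) fun x hx => ?_
  apply Yt_zero
  apply S.van
  apply S.notMem
  simp at hx
  exact hx.le

lemma grad_coord {f : Eu n → ℝ} (x : Eu n) (j : Fin n) : gradient f x j = pd n j f x := by
  have h : inner ℝ (gradient f x) (EuclideanSpace.single j (1:ℝ)) = pd n j f x := by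
    unfold gradient pd
    rw [InnerProductSpace.toDual_symm_apply]
  rw [← h, EuclideanSpace.inner_single_right]
  simp

lemma Su.Bx (S : Su n K hK c1 α δ lam B V w σ p) (x : Eu n) (i j : Fin n) :
    |B i j x - if i = j then 1 else 0| ≤ K * ‖x‖ := by
  have := S.hBl i j x 0
  rwa [S.hB0, sub_zero] at this

lemma Su.F0 (S : Su n K hK c1 α δ lam B V w σ p) (x : Eu n) (hx : ‖x‖ ≤ 4) {τ : ℝ} (hτ : 0 ≤ τ) :
    |F0f B τ x| ≤ Cc n K hK * τ ^ 2 * ‖x‖ ^ 3 := by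
  have h2 := (Classical.choose_spec (mat_bounds n K hK)).2
  have h1 := (Classical.choose_spec (pt_main n K hK)).1
  obtain ⟨-, -, -, -, -, h, -⟩ := h2 (fun i j => B i j x) (fun _ _ => 0) x 0 0 
    (WithLp.toLp 2 fun i => ∑ j, B i j x * x j) τ hτ hx (S.Bx x)
    (fun i j v => by simp; positivity) (fun i => by simp) (fun i => rfl)
  refine h.trans ?_
  unfold Cc
  gcongr
  linarith

lemma ErrT_nonneg {i r γ w α β : ℝ} (hi : 0 ≤ i) (hr : 0 ≤ r) (hγ : 0 ≤ γ) (hα : 0 ≤ α) (hβ : 0 ≤ β) :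
    0 ≤ ErrT i r γ w α β := by
  unfold ErrT; positivity

/-- the time derivative of the density -/
def PhT (B : Fin n → Fin n → Eu n → ℝ) (V : Eu n → ℝ) (w : Eu n → ℝ → ℝ) (σ p : ℝ → ℝ) (α lam : ℝ)
    (x : Eu n) (t : ℝ) : ℝ :=
  PhiT B (gW w t) V (fun y => w y t) (tW w t)
    (fun j => fderiv ℝ (tW w t) x (EuclideanSpace.single j 1)) (fun y => Gk n y t)
    (p t * σ t ^ (-(2 * α))) (1 / t) (thetaFn (lam * t) / t) (α / p t)
    (-(thetaFn (lam * t) / t * (1 / t) * (1 / 2 + 3 / (2 * Real.log (1 / (lam * t))))) / 4) x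

/-- the operator -/
def Zop (B : Fin n → Fin n → Eu n → ℝ) (V : Eu n → ℝ) (w : Eu n → ℝ → ℝ) (x : Eu n) (t : ℝ) : ℝ :=
  ∑ j, pd n j (Pf B (gW w t) j) x + tW w t x + V x * w x t

/-- left-hand density -/
def Ld (w : Eu n → ℝ → ℝ) (σ : ℝ → ℝ) (α lam : ℝ) (x : Eu n) (t : ℝ) : ℝ :=
  (σ t ^ (1 - 2 * α) * ‖gradient (fun y => w y t) x‖ ^ 2 * (thetaFn (lam * t) / t)
        + α ^ 2 * (σ t ^ (-(2 * α)) * w x t ^ 2)) * Gk n x t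

lemma Su.qf_ge (S : Su n K hK c1 α δ lam B V w σ p) (x : Eu n) (t : ℝ) :
    c1 * ‖gradient (fun y => w y t) x‖ ^ 2 ≤ qf B (gW w t) x := by
  have := S.hBe x (gradient (fun y => w y t) x)
  simp only [grad_coord] at this
  exact this

set_option maxHeartbeats 1000000 in
lemma Su.pt (S : Su n K hK c1 α δ lam B V w σ p) {t : ℝ} (ht : 0 < t) (ht2 : t ≤ 1 / (2 * lam)) :
    ∀ᵐ x : Eu n, 2 * ∑ j, pd n j (Yt B V w (p t * σ t ^ (-(2 * α))) (thetaFn (lam * t) / t) (α / p t) t j) x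
      ≤ p t * σ t ^ (-(2 * α)) * Gk n x t * Zop B V w x t ^ 2 - 2 * PhT B V w σ p α lam x t
        - c1 / 4 * Ld w σ α lam x t
        + 2 * Dcst n (Cc n K hK) α lam * (w x t ^ 2 + t * ‖gradient (fun y => w y t) x‖ ^ 2) := by
  have hae : ∀ᵐ x : Eu n, ∀ i j, DifferentiableAt ℝ (B i j) x := by
    rw [ae_all_iff]; intro i
    rw [ae_all_iff]; intro j
    exact (S.B_LL i j).ae_differentiableAt
  have W := S.wt ht ht2
  have hσ0 := W.σpos
  have hp0 := W.ppos
  have hα := S.hα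
  have hlam := S.lam_pos
  obtain ⟨hβ0, hβ15, -⟩ := W.beta
  have hω : 0 ≤ p t * σ t ^ (-(2 * α)) := by positivity
  have hG : ∀ x, 0 ≤ Gk n x t := fun x => by unfold Gk; positivity
  have hC1 := Cc_ge (n := n) hK
  have hD0 : 0 ≤ Dcst n (Cc n K hK) α lam := by
    unfold Dcst; positivity
  filter_upwards [hae] with x hx
  set γ := ‖gradient (fun y => w y t) x‖ with hγ
  by_cases hsup : (x, t) ∈ tsupport (fun p : Eu n × ℝ => w p.1 p.2)
  · have hx4 : ‖x‖ ≤ 4 := by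
      have := (S.hw.2.2 hsup).1
      simp at this
      exact this.le
    obtain ⟨hVb, hdV⟩ := S.hVb _ hsup
    have hstar := star_scalar W (C := Cc n K hK) (c1 := c1) (r := ‖x‖) (γ := γ) (q := qf B (gW w t) x)
      (w := w x t) hC1 S.hc1 (norm_nonneg _) hx4 (norm_nonneg _) (S.qf_ge x t) S.hc160 S.hsm
    obtain ⟨hsec, -⟩ := w_second S.hw.1 x t
    have hell := ell_ge W.s_pos W.hs
    have hpt := (Classical.choose_spec (pt_main n K hK)).2 B (gW w t) V (fun y => w y t) (tW w t)
      (fun y => Gk n y t) (p t * σ t ^ (-(2 * α))) (1 / t) t α (α / p t) (thetaFn (lam * t) / t)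
      (-(thetaFn (lam * t) / t * (1 / t) * (1 / 2 + 3 / (2 * Real.log (1 / (lam * t))))) / 4) x
      (gradient (fun y => w y t) x) (fun i j => fderiv ℝ (B i j) x) (fun j => fderiv ℝ (gW w t j) x)
      (fderiv ℝ V x) (fderiv ℝ (fun y => w y t) x) (fderiv ℝ (tW w t) x)
      (fun i j => (hx i j).hasFDerivAt)
      (fun j => ((sm_left (gW_smooth S.hw.1 j) t).differentiable (by simp) x).hasFDerivAt)
      ((S.hV.differentiable (by simp) x).hasFDerivAt)
      (((sm_left S.hw.1 t).differentiable (by simp) x).hasFDerivAt)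
      (((sm_left (tW_smooth S.hw.1) t).differentiable (by simp) x).hasFDerivAt)
      (Gk_dv x ht) S.hBs (fun j => rfl) hsec (fun j => grad_coord x j) hx4 (S.Bx x)
      (fun i j v => by
        have h1 := (fderiv ℝ (B i j) x).le_opNorm v
        have h2 : ‖fderiv ℝ (B i j) x‖ ≤ K := norm_fderiv_le_of_lipschitz ℝ (S.B_LL i j)
        exact h1.trans (mul_le_mul_of_nonneg_right h2 (norm_nonneg _)))
      hVb hdV ht rfl (by linarith) (by positivity)
      (by rw [mul_one_div]; exact div_le_div_of_nonneg_left (by linarith) ht W.hp1)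
      hβ0 hβ15
      (by
        have h3 : 3 / (2 * Real.log (1 / (lam * t))) ≤ 3 := by
          rw [div_le_iff₀ (by linarith)]; linarith
        have h4 : 0 ≤ 3 / (2 * Real.log (1 / (lam * t))) := by positivity
        have h5 : 0 ≤ thetaFn (lam * t) / t * (1 / t) := by positivity
        rw [abs_div, abs_neg, abs_of_nonneg (by positivity), abs_of_nonneg (by norm_num)]
        rw [div_le_iff₀ (by norm_num)]
        refine mul_le_mul_of_nonneg_left ?_ h5
        linarith)
      hω (hG x)
    have hCle : Classical.choose (pt_main n K hK) ≤ Cc n K hK := by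
      have := (Classical.choose_spec (mat_bounds n K hK)).1
      unfold Cc; linarith
    have hE0 : 0 ≤ ErrT (1 / t) ‖x‖ γ (w x t) α (thetaFn (lam * t) / t) :=
      ErrT_nonneg (by positivity) (norm_nonneg _) (norm_nonneg _) (by linarith) hβ0
    have hE1 := mul_le_mul_of_nonneg_left (mul_le_mul_of_nonneg_right hCle hE0)
      (mul_nonneg hω (hG x))
    have hgk : Gk n x t = t ^ (-(n:ℝ)/2) * Real.exp (-‖x‖ ^ 2 / (4 * t)) := rfl
    rw [← hgk] at hstar
    simp only [PhT, Yt, Zop, Ld]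
    linarith
  · have hv := S.van hsup
    have hY : ∀ j, pd n j (Yt B V w (p t * σ t ^ (-(2 * α))) (thetaFn (lam * t) / t) (α / p t) t j) x = 0 := by
      intro j
      have : Yt B V w (p t * σ t ^ (-(2 * α))) (thetaFn (lam * t) / t) (α / p t) t j =ᶠ[𝓝 x] 0 := by
        filter_upwards [S.van_ev hsup] with y hy
        exact Yt_zero hy
      unfold pd
      rw [this.fderiv_eq]
      simp
    obtain ⟨h1, h2, h3⟩ := hv
    have hγ0 : γ = 0 := by
      rw [hγ, norm_eq_zero]
      ext j
      rw [grad_coord]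
      exact h2 j
    simp only [hY, PhT, PhiT, Ld, ef, qf, Pf, h1, h2, ← hγ, hγ0]
    simp
    have := hG x
    positivity

end setup

section integ
open scoped NNReal Topology
variable {n : ℕ}

lemma mu_eq (a T : ℝ) : (volume : Measure (Eu n × ℝ)).restrict (univ ×ˢ Ioo a T) =
    (volume : Measure (Eu n)).prod ((volume : Measure ℝ).restrict (Ioo a T)) := by
  rw [Measure.volume_eq_prod, ← Measure.prod_restrict, Measure.restrict_univ]

lemma int_cont {f : Eu n × ℝ → ℝ} {a T : ℝ} (hf : ContinuousOn f (univ ×ˢ Icc a T))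
    (hz : ∀ x t, 4 ≤ ‖x‖ → f (x, t) = 0) : IntegrableOn f (univ ×ˢ Ioo a T) := by
  have h1 : IntegrableOn f (Metric.closedBall (0:Eu n) 4 ×ˢ Icc a T) :=
    (hf.mono (prod_mono (subset_univ _) le_rfl)).integrableOn_compact
      ((isCompact_closedBall _ _).prod isCompact_Icc)
  have h2 : IntegrableOn f (univ ×ˢ Icc a T) := by
    refine h1.of_forall_sdiff_eq_zero (MeasurableSet.univ.prod measurableSet_Icc) ?_
    rintro ⟨x, t⟩ ⟨⟨-, h3⟩, h4⟩
    apply hz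
    by_contra h5
    push Not at h5
    exact h4 ⟨by simpa using h5.le, h3⟩
  exact h2.mono_set (prod_mono le_rfl Ioo_subset_Icc_self)

lemma int_bdd {f Z : Eu n × ℝ → ℝ} {a T M : ℝ} (hf : ContinuousOn f (univ ×ˢ Icc a T))
    (hZ : Measurable Z) (hM : ∀ q, |Z q| ≤ M)
    (hz : ∀ x t, 4 ≤ ‖x‖ → Z (x, t) = 0) : IntegrableOn (fun q => Z q * f q) (univ ×ˢ Ioo a T) := by
  have h1 : IntegrableOn f (Metric.closedBall (0:Eu n) 4 ×ˢ Icc a T) :=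
    (hf.mono (prod_mono (subset_univ _) le_rfl)).integrableOn_compact
      ((isCompact_closedBall _ _).prod isCompact_Icc)
  have h1' : IntegrableOn (fun q => Z q * f q) (Metric.closedBall (0:Eu n) 4 ×ˢ Icc a T) :=
    Integrable.bdd_mul (c := M) h1 hZ.aestronglyMeasurable (ae_of_all _ hM)
  have h2 : IntegrableOn (fun q => Z q * f q) (univ ×ˢ Icc a T) := by
    refine h1'.of_forall_sdiff_eq_zero (MeasurableSet.univ.prod measurableSet_Icc) ?_
    rintro ⟨x, t⟩ ⟨⟨-, h3⟩, h4⟩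
    rw [hz, zero_mul]
    by_contra h5
    push Not at h5
    exact h4 ⟨by simpa using h5.le, h3⟩
  exact h2.mono_set (prod_mono le_rfl Ioo_subset_Icc_self)

lemma int_slice {f : Eu n → ℝ} (hf : Continuous f) (hz : ∀ x, 4 ≤ ‖x‖ → f x = 0) : Integrable f := by
  refine hf.integrable_of_hasCompactSupport ?_
  refine HasCompactSupport.intro (isCompact_closedBall (0:Eu n) 4) fun x hx => hz x ?_
  simp at hx
  exact hx.le

lemma cont_aux {s : Set (Eu n × ℝ)} {i β ap mp ω G w wt V : Eu n × ℝ → ℝ} {g d : Fin n → Eu n × ℝ → ℝ}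
    {B : Fin n → Fin n → Eu n → ℝ} (hi : ContinuousOn i s) (hβ : ContinuousOn β s)
    (hap : ContinuousOn ap s) (hmp : ContinuousOn mp s) (hω : ContinuousOn ω s) (hG : ContinuousOn G s)
    (hw : Continuous w) (hwt : Continuous wt) (hV : Continuous V) (hg : ∀ j, Continuous (g j))
    (hd : ∀ j, Continuous (d j)) (hB : ∀ i j, Continuous (B i j)) :
    ContinuousOn (fun q => ω q * G q * ((i q + β q - 2 * ap q + ((i q / 2) ^ 2 * (∑ j, q.1 j * q.1 j)
        - n * (i q / 2))) * ((V q - ((i q / 2) ^ 2 * (∑ i, q.1 i * q.1 i - ∑ k, ∑ j, B k j q.1 *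
          (q.1 k * q.1 j)) / 2 + (-ap q + β q / 4))) * w q ^ 2 - ∑ k, ∑ j, B k j q.1 * (g k q * g j q))
      + (i q * ((i q / 2) ^ 2 * (∑ i, q.1 i * q.1 i - ∑ k, ∑ j, B k j q.1 * (q.1 k * q.1 j)))
        - ap q * (i q + β q) - mp q) * w q ^ 2
      + 2 * (V q - ((i q / 2) ^ 2 * (∑ i, q.1 i * q.1 i - ∑ k, ∑ j, B k j q.1 *
          (q.1 k * q.1 j)) / 2 + (-ap q + β q / 4))) * w q * wt q
      - 2 * ∑ k, (∑ j, B k j q.1 * g j q) * d k q)) s := by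
  have hw' := hw.continuousOn (s := s)
  have hwt' := hwt.continuousOn (s := s)
  have hV' := hV.continuousOn (s := s)
  have hxx : Continuous (fun q : Eu n × ℝ => ∑ i, q.1 i * q.1 i - ∑ k, ∑ j, B k j q.1 *
          (q.1 k * q.1 j)) := by fun_prop
  have hxx2 : Continuous (fun q : Eu n × ℝ => ∑ i, q.1 i * q.1 i) := by fun_prop
  have hq : Continuous (fun q : Eu n × ℝ => ∑ k, ∑ j, B k j q.1 * (g k q * g j q)) := by fun_prop
  have hP : Continuous (fun q : Eu n × ℝ => ∑ k, (∑ j, B k j q.1 * g j q) * d k q) := by fun_prop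
  have hc : ContinuousOn (fun q : Eu n × ℝ => (V q - ((i q / 2) ^ 2 * (∑ i, q.1 i * q.1 i -
      ∑ k, ∑ j, B k j q.1 * (q.1 k * q.1 j)) / 2 + (-ap q + β q / 4)))) s :=
    hV'.sub (((((hi.div_const 2).pow 2).mul hxx.continuousOn).div_const 2).add
      (hap.neg.add (hβ.div_const 4)))
  refine (hω.mul hG).mul (((ContinuousOn.add (ContinuousOn.mul ?_ ?_) ?_).add ?_).sub ?_)
  · exact ((hi.add hβ).sub (continuousOn_const.mul hap)).add
      ((((hi.div_const 2).pow 2).mul hxx2.continuousOn).sub (continuousOn_const.mul (hi.div_const 2)))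
  · exact (hc.mul (hw'.pow 2)).sub hq.continuousOn
  · exact (((hi.mul (((hi.div_const 2).pow 2).mul hxx.continuousOn)).sub (hap.mul (hi.add hβ))).sub
      hmp).mul (hw'.pow 2)
  · exact ((continuousOn_const.mul hc).mul hw').mul hwt'
  · exact continuousOn_const.mul hP.continuousOn

variable {K : ℝ} {hK : 0 ≤ K} {c1 α δ lam : ℝ} {B : Fin n → Fin n → Eu n → ℝ}
    {V : Eu n → ℝ} {w : Eu n → ℝ → ℝ} {σ p : ℝ → ℝ} {a : ℝ}

lemma snd_cont {f : ℝ → ℝ} {a T : ℝ} (hf : ContinuousOn f (Icc a T)) :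
    ContinuousOn (fun q : Eu n × ℝ => f q.2) (univ ×ˢ Icc a T) :=
  hf.comp continuousOn_snd fun _ hq => hq.2

lemma Gk_cont {T : ℝ} (ha : 0 < a) : ContinuousOn (fun q : Eu n × ℝ => Gk n q.1 q.2) (univ ×ˢ Icc a T) := by
  have h0 : ∀ q ∈ (univ : Set (Eu n)) ×ˢ Icc a T, q.2 ≠ 0 := fun q hq => (ha.trans_le hq.2.1).ne'
  unfold Gk
  refine ContinuousOn.mul ?_ (ContinuousOn.rexp ?_)
  · exact continuousOn_snd.rpow_const fun q hq => Or.inl (h0 q hq)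
  · refine ContinuousOn.div (by fun_prop) (by fun_prop) fun q hq => ?_
    have := h0 q hq
    positivity

lemma Su.conts (S : Su n K hK c1 α δ lam B V w σ p) (ha : 0 < a) :
    ContinuousOn σ (Icc a (1 / (2 * lam))) ∧ ContinuousOn p (Icc a (1 / (2 * lam))) ∧
    ContinuousOn (fun t => thetaFn (lam * t) / t) (Icc a (1 / (2 * lam))) ∧
    ContinuousOn (fun t => Real.log (1 / (lam * t))) (Icc a (1 / (2 * lam))) := by
  have hl := S.lam_pos
  refine ⟨fun t ht => ?_, fun t ht => ?_, fun t ht => ?_, fun t ht => ?_⟩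
  · exact (S.hσ t (S.mem_Ioo (ha.trans_le ht.1) ht.2)).2.1.continuousAt.continuousWithinAt
  · exact (S.hσ t (S.mem_Ioo (ha.trans_le ht.1) ht.2)).2.2.1.continuousAt.continuousWithinAt
  · have ht0 := ha.trans_le ht.1
    have := (S.wt ht0 ht.2).hs
    exact (hasDeriv_beta hl ht0 (by linarith)).continuousAt.continuousWithinAt
  · have ht0 := ha.trans_le ht.1
    have h1 : ContinuousAt (fun t => 1 / (lam * t)) t := by
      refine ContinuousAt.div (by fun_prop) (by fun_prop) (by positivity)
    exact (h1.log (by positivity)).continuousWithinAt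

lemma Su.w_cont (S : Su n K hK c1 α δ lam B V w σ p) :
    Continuous (fun q : Eu n × ℝ => w q.1 q.2) := S.hw.1.continuous

lemma grad_sq (w : Eu n → ℝ → ℝ) (x : Eu n) (t : ℝ) :
    ‖gradient (fun y => w y t) x‖ ^ 2 = ∑ j, gW w t j x ^ 2 := by
  rw [EuclideanSpace.norm_sq_eq]
  simp only [grad_coord, Real.norm_eq_abs, sq_abs]
  rfl

lemma Su.g_cont (S : Su n K hK c1 α δ lam B V w σ p) :
    Continuous (fun q : Eu n × ℝ => ‖gradient (fun y => w y q.2) q.1‖ ^ 2) := by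
  simp only [grad_sq]
  exact continuous_finsetSum _ fun j _ => (gW_smooth S.hw.1 j).continuous.pow 2

lemma Su.grad_zero (S : Su n K hK c1 α δ lam B V w σ p) {x : Eu n} {t : ℝ}
    (h : (x, t) ∉ tsupport (fun p : Eu n × ℝ => w p.1 p.2)) :
    ‖gradient (fun y => w y t) x‖ ^ 2 = 0 := by
  rw [grad_sq]
  simp [(S.van h).2.1]

lemma Su.PhT_cont (S : Su n K hK c1 α δ lam B V w σ p) (ha : 0 < a) :
    ContinuousOn (fun q : Eu n × ℝ => PhT B V w σ p α lam q.1 q.2) (univ ×ˢ Icc a (1 / (2 * lam))) := by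
  obtain ⟨h1, h2, h3, h4⟩ := S.conts ha
  have hW : ∀ t ∈ Icc a (1 / (2 * lam)), WtP n α δ lam t (p t) (σ t) :=
    fun t ht => S.wt (ha.trans_le ht.1) ht.2
  have hi : ContinuousOn (fun t : ℝ => 1 / t) (Icc a (1 / (2 * lam))) :=
    continuousOn_const.div continuousOn_id fun t ht => (ha.trans_le ht.1).ne'
  have hap : ContinuousOn (fun t : ℝ => α / p t) (Icc a (1 / (2 * lam))) :=
    continuousOn_const.div h2 fun t ht => (hW t ht).ppos.ne'
  have hω : ContinuousOn (fun t : ℝ => p t * σ t ^ (-(2 * α))) (Icc a (1 / (2 * lam))) :=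
    h2.mul (h1.rpow_const fun t ht => Or.inl (hW t ht).σpos.ne')
  have hmp : ContinuousOn (fun t : ℝ => -(thetaFn (lam * t) / t * (1 / t) *
      (1 / 2 + 3 / (2 * Real.log (1 / (lam * t))))) / 4) (Icc a (1 / (2 * lam))) := by
    refine (((h3.mul hi).mul (continuousOn_const.add (continuousOn_const.div
      (continuousOn_const.mul h4) fun t ht => ?_))).neg).div_const 4
    have := ell_ge (hW t ht).s_pos (hW t ht).hs
    exact (by linarith : (0:ℝ) < 2 * Real.log (1 / (lam * t))).ne'
  exact cont_aux (snd_cont hi) (snd_cont h3) (snd_cont hap) (snd_cont hmp) (snd_cont hω) (Gk_cont ha)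
    S.w_cont (tW_smooth S.hw.1).continuous (S.hV.continuous.comp continuous_fst)
    (fun j => (gW_smooth S.hw.1 j).continuous)
    (d := fun j q => fderiv ℝ (tW w q.2) q.1 (EuclideanSpace.single j 1))
    (fun j => (gW_smooth (w := fun x t => tW w t x) (tW_smooth S.hw.1) j).continuous)
    (fun i j => (S.B_LL i j).continuous)

lemma Su.PhT_zero (S : Su n K hK c1 α δ lam B V w σ p) {x : Eu n} {t : ℝ}
    (h : (x, t) ∉ tsupport (fun p : Eu n × ℝ => w p.1 p.2)) : PhT B V w σ p α lam x t = 0 := by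
  obtain ⟨h1, h2, h3⟩ := S.van h
  simp [PhT, PhiT, ef, qf, Pf, h1, h2]

lemma LL_sum' {E : Type*} [PseudoEMetricSpace E] {ι : Type*} (s : Finset ι) {f : ι → E → ℝ}
    (hf : ∀ i, LocallyLipschitz (f i)) : LocallyLipschitz (fun x => ∑ i ∈ s, f i x) := by
  classical
  induction s using Finset.induction_on with
  | empty => simpa using LocallyLipschitz.const (0:ℝ)
  | insert a s ha ih =>
    simp only [Finset.sum_insert ha]
    have h : LocallyLipschitz (fun p : ℝ × ℝ => p.1 + p.2) :=
      ContDiff.locallyLipschitz (𝕂 := ℝ) (contDiff_fst.add contDiff_snd)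
    exact h.comp ((hf a).prodMk ih)

lemma Su.Z_meas (S : Su n K hK c1 α δ lam B V w σ p) (j : Fin n) :
    Measurable (fun q : Eu n × ℝ => pd n j (Pf B (gW w q.2) j) q.1) := by
  have hB := fun i j => (S.B_LL i j).continuous
  have hgc := fun j => (gW_smooth S.hw.1 j).continuous
  have hc : Continuous (Function.uncurry fun (t : ℝ) (x : Eu n) => Pf B (gW w t) j x) := by
    change Continuous (fun q : ℝ × Eu n => ∑ k, B j k q.2 * gW w q.1 k q.2)
    refine continuous_finsetSum _ fun k _ => ?_
    exact ((hB j k).comp continuous_snd).mul ((hgc k).comp continuous_swap)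
  have h : Measurable (fun q : ℝ × Eu n => pd n j (Pf B (gW w q.1) j) q.2) :=
    measurable_fderiv_apply_const_with_param ℝ hc (EuclideanSpace.single j 1)
  exact h.comp measurable_swap

lemma Su.Z_lip (S : Su n K hK c1 α δ lam B V w σ p) (j : Fin n) :
    ∃ M : ℝ≥0, ∀ q : Eu n × ℝ, |pd n j (Pf B (gW w q.2) j) q.1| ≤ M := by
  have hLL : LocallyLipschitz (fun q : Eu n × ℝ => Pf B (gW w q.2) j q.1) := by
    refine LL_sum' _ fun k => LL_mul ?_ ?_
    · exact (S.B_LL j k).locallyLipschitz.comp LipschitzWith.prod_fst.locallyLipschitz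
    · exact ((gW_smooth S.hw.1 k).of_le
        (by exact_mod_cast le_top : (1 : WithTop ℕ∞) ≤ ((⊤ : ℕ∞) : WithTop ℕ∞))).locallyLipschitz
  have hcs : HasCompactSupport (fun q : Eu n × ℝ => Pf B (gW w q.2) j q.1) := by
    refine HasCompactSupport.intro S.hw.2.1 fun q hq => ?_
    simp [Pf, (S.van (x := q.1) (t := q.2) hq).2.1]
  obtain ⟨C, hC⟩ := lipschitz_of_LL hLL hcs
  refine ⟨C, fun q => ?_⟩
  have hl : LipschitzWith C (Pf B (gW w q.2) j) := by
    refine LipschitzWith.of_dist_le_mul fun x y => ?_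
    have := hC.dist_le_mul (x, q.2) (y, q.2)
    rwa [Prod.dist_eq, dist_self, max_eq_left dist_nonneg] at this
  have h2 := norm_fderiv_le_of_lipschitz ℝ hl (x₀ := q.1)
  have h3 := (fderiv ℝ (Pf B (gW w q.2) j) q.1).le_opNorm (EuclideanSpace.single j 1)
  rw [norm_single_one, mul_one] at h3
  exact h3.trans h2

lemma Su.Z_facts (S : Su n K hK c1 α δ lam B V w σ p) :
    Measurable (fun q : Eu n × ℝ => Zop B V w q.1 q.2) ∧
    (∃ M, ∀ q : Eu n × ℝ, |Zop B V w q.1 q.2| ≤ M) ∧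
    ∀ x t, (x, t) ∉ tsupport (fun p : Eu n × ℝ => w p.1 p.2) → Zop B V w x t = 0 := by
  have hB := fun i j => (S.B_LL i j).continuous
  have hgc := fun j => (gW_smooth S.hw.1 j).continuous
  have hVc := S.hV.continuous
  have hwc := S.w_cont
  have htc := (tW_smooth S.hw.1).continuous
  refine ⟨?_, ?_, ?_⟩
  · unfold Zop
    refine Measurable.add (Measurable.add ?_ htc.measurable) ?_
    · exact Finset.measurable_sum _ fun j _ => S.Z_meas j
    · exact ((hVc.comp continuous_fst).mul hwc).measurable
  · have h1 := S.Z_lip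
    choose M hM using h1
    have hcs : HasCompactSupport (fun q : Eu n × ℝ => tW w q.2 q.1 + V q.1 * w q.1 q.2) := by
      refine HasCompactSupport.intro S.hw.2.1 fun q hq => ?_
      obtain ⟨h1, h2, h3⟩ := S.van (x := q.1) (t := q.2) hq
      simp [h1, h3]
    obtain ⟨M2, hM2⟩ := (htc.add ((hVc.comp continuous_fst).mul hwc)).bounded_above_of_compact_support hcs
    refine ⟨∑ j, (M j : ℝ) + M2, fun q => ?_⟩
    have h4 := hM2 q
    rw [Real.norm_eq_abs] at h4
    have h5 : |∑ j, pd n j (Pf B (gW w q.2) j) q.1| ≤ ∑ j, (M j : ℝ) :=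
      (Finset.abs_sum_le_sum_abs _ _).trans (Finset.sum_le_sum fun j _ => hM j q)
    unfold Zop
    rw [add_assoc]
    exact (abs_add_le _ _).trans (add_le_add h5 h4)
  · intro x t h
    obtain ⟨h1, h2, h3⟩ := S.van h
    have : ∀ j, pd n j (Pf B (gW w t) j) x = 0 := by
      intro j
      have h0 : Pf B (gW w t) j =ᶠ[𝓝 x] 0 := by
        filter_upwards [S.van_ev h] with y hy
        simp [Pf, hy.2.1]
      unfold pd
      rw [h0.fderiv_eq]
      simp
    simp [Zop, this, h1, h3]

end integ

section final
open scoped NNReal Topology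
variable {n : ℕ}
variable {K : ℝ} {hK : 0 ≤ K} {c1 α δ lam : ℝ} {B : Fin n → Fin n → Eu n → ℝ}
    {V : Eu n → ℝ} {w : Eu n → ℝ → ℝ} {σ p : ℝ → ℝ} {a : ℝ}

/-- energy density -/
def Phi (B : Fin n → Fin n → Eu n → ℝ) (V : Eu n → ℝ) (w : Eu n → ℝ → ℝ) (σ p : ℝ → ℝ) (α lam : ℝ)
    (x : Eu n) (t : ℝ) : ℝ :=
  (p t * σ t ^ (-(2 * α))) * Gk n x t *
        ef B (gW w t) V (fun y => w y t) (1 / t / 2) (-(α / p t) + thetaFn (lam * t) / t / 4) x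

lemma Su.Phi_int (S : Su n K hK c1 α δ lam B V w σ p) (ha : 0 < a) (haT : a ≤ 1 / (2 * lam)) (x : Eu n) :
    ∫ t in Ioo a (1 / (2 * lam)), PhT B V w σ p α lam x t = - Phi B V w σ p α lam x a := by
  have hl := S.lam_pos
  have hd : ∀ t ∈ uIcc a (1 / (2 * lam)), HasDerivAt (fun t => Phi B V w σ p α lam x t)
      (PhT B V w σ p α lam x t) t := by
    intro t ht
    rw [uIcc_of_le haT] at ht
    have ht0 := ha.trans_le ht.1
    have W := S.wt ht0 ht.2
    obtain ⟨h1, h2, h3, -⟩ := S.hσ t (S.mem_Ioo ht0 ht.2)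
    have hb := hasDeriv_beta hl ht0 (by linarith [W.hs])
    refine phi_deriv (β := fun t => thetaFn (lam * t) / t) S.hBs ht0 h1 W.ppos h2 h3
      (hb.congr_deriv (by ring)) ?_ (w_second S.hw.1 x t).2
    exact ((sm_right S.hw.1 x).differentiable (by simp) t).hasDerivAt
  have hc : ContinuousOn (fun t => PhT B V w σ p α lam x t) (uIcc a (1 / (2 * lam))) := by
    rw [uIcc_of_le haT]
    exact (S.PhT_cont ha).comp (f := fun t : ℝ => (x, t)) (by fun_prop) fun t ht => ⟨mem_univ _, ht⟩
  have h := intervalIntegral.integral_eq_sub_of_hasDerivAt hd hc.intervalIntegrable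
  rw [intervalIntegral.integral_of_le haT, integral_Ioc_eq_integral_Ioo] at h
  rw [h]
  obtain ⟨h1, h2, -⟩ := S.van (S.notMem_t (x := x) (t := 1 / (2 * lam)) le_rfl)
  have h0 : Phi B V w σ p α lam x (1 / (2 * lam)) = 0 := by
    unfold Phi ef qf
    simp only [h1, h2]
    simp
  rw [h0, zero_sub]

lemma Su.omega_le (S : Su n K hK c1 α δ lam B V w σ p) {t : ℝ} (ht : 0 < t) (ht2 : t ≤ 1 / (2 * lam)) :
    p t * σ t ^ (-(2 * α)) ≤ Real.exp 300 * σ t ^ (1 - 2 * α) := by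
  have W := S.wt ht ht2
  have hσ := W.σpos
  have h1 : σ t ^ (1 - 2 * α) = σ t * σ t ^ (-(2 * α)) := by
    rw [sub_eq_add_neg, Real.rpow_add hσ, Real.rpow_one]
  rw [h1, ← mul_assoc]
  gcongr
  calc p t ≤ Real.exp 60 * t := W.hp2
    _ = Real.exp 300 * (Real.exp (-240) * t) := by
      rw [← mul_assoc, ← Real.exp_add]; norm_num
    _ ≤ _ := by gcongr; exact W.hσ1

/-- right-hand density -/
def Rd (B : Fin n → Fin n → Eu n → ℝ) (V : Eu n → ℝ) (w : Eu n → ℝ → ℝ) (σ : ℝ → ℝ) (α : ℝ)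
    (q : Eu n × ℝ) : ℝ := σ q.2 ^ (1 - 2 * α) * Zop B V w q.1 q.2 ^ 2 * Gk n q.1 q.2

/-- remainder density -/
def Ed (w : Eu n → ℝ → ℝ) (q : Eu n × ℝ) : ℝ :=
  w q.1 q.2 ^ 2 + q.2 * ‖gradient (fun z => w z q.2) q.1‖ ^ 2

lemma Su.Ed_cont (S : Su n K hK c1 α δ lam B V w σ p) : Continuous (Ed w) :=
  (S.w_cont.pow 2).add (continuous_snd.mul S.g_cont)

lemma Su.Ed_zero (S : Su n K hK c1 α δ lam B V w σ p) {x : Eu n} {t : ℝ}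
    (h : (x, t) ∉ tsupport (fun p : Eu n × ℝ => w p.1 p.2)) : Ed w (x, t) = 0 := by
  simp [Ed, (S.van h).1, S.grad_zero h]

lemma Su.bdd (S : Su n K hK c1 α δ lam B V w σ p) :
    BddAbove {y | ∃ t : ℝ, a ≤ t ∧ y = ∫ x : Eu n, Ed w (x, t)} := by
  have hcs : HasCompactSupport (Ed w) :=
    HasCompactSupport.intro S.hw.2.1 fun q hq => S.Ed_zero (x := q.1) (t := q.2) hq
  obtain ⟨M, hM⟩ := S.Ed_cont.bounded_above_of_compact_support hcs
  refine ⟨M * volume.real (Metric.closedBall (0:Eu n) 4), ?_⟩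
  rintro y ⟨t, -, rfl⟩
  have h1 : ∫ x in Metric.closedBall (0:Eu n) 4, Ed w (x, t) = ∫ x : Eu n, Ed w (x, t) := by
    refine setIntegral_eq_integral_of_forall_compl_eq_zero fun x hx => ?_
    apply S.Ed_zero
    apply S.notMem
    simp at hx
    exact hx.le
  rw [← h1]
  refine (le_abs_self _).trans ?_
  exact norm_setIntegral_le_of_norm_le_const (isCompact_closedBall _ _).measure_lt_top
    fun x _ => hM _

set_option maxHeartbeats 1000000 in
lemma Su.ints (S : Su n K hK c1 α δ lam B V w σ p) (ha : 0 < a) :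
    IntegrableOn (fun q : Eu n × ℝ => σ q.2 ^ (-(2*α)) * (w q.1 q.2) ^ 2 * Gk n q.1 q.2)
      (univ ×ˢ Ioo a (1 / (2 * lam))) ∧
    IntegrableOn (fun q : Eu n × ℝ => σ q.2 ^ (1 - 2*α) * ‖gradient (fun y => w y q.2) q.1‖ ^ 2
                  * (thetaFn (lam * q.2) / q.2) * Gk n q.1 q.2) (univ ×ˢ Ioo a (1 / (2 * lam))) ∧
    IntegrableOn (Rd B V w σ α) (univ ×ˢ Ioo a (1 / (2 * lam))) ∧
    IntegrableOn (fun q : Eu n × ℝ => PhT B V w σ p α lam q.1 q.2) (univ ×ˢ Ioo a (1 / (2 * lam))) ∧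
    IntegrableOn (Ed w) (univ ×ˢ Ioo a (1 / (2 * lam))) := by
  obtain ⟨h1, h2, h3, h4⟩ := S.conts ha
  have hG := Gk_cont (n := n) (T := 1 / (2 * lam)) ha
  have hW : ∀ t ∈ Icc a (1 / (2 * lam)), WtP n α δ lam t (p t) (σ t) :=
    fun t ht => S.wt (ha.trans_le ht.1) ht.2
  have hs : ∀ r : ℝ, ContinuousOn (fun q : Eu n × ℝ => σ q.2 ^ r) (univ ×ˢ Icc a (1 / (2 * lam))) :=
    fun r => snd_cont (f := fun t => σ t ^ r) (h1.rpow_const fun t ht => Or.inl (hW t ht).σpos.ne')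
  refine ⟨?_, ?_, ?_, ?_, ?_⟩
  · refine int_cont (((hs _).mul (S.w_cont.pow 2).continuousOn).mul hG) fun x t hx => ?_
    simp [(S.van (S.notMem hx)).1]
  · refine int_cont ((((hs _).mul S.g_cont.continuousOn).mul (snd_cont h3)).mul hG) fun x t hx => ?_
    simp only [S.grad_zero (S.notMem hx)]
    simp
  · obtain ⟨z1, ⟨M, hM⟩, z3⟩ := S.Z_facts
    have := int_bdd (Z := fun q => Zop B V w q.1 q.2 ^ 2) (M := M ^ 2) ((hs (1 - 2 * α)).mul hG)
      (z1.pow_const 2) (fun q => by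
        rw [abs_pow]
        exact pow_le_pow_left₀ (abs_nonneg _) (hM q) 2)
      (fun x t hx => by simp [z3 x t (S.notMem hx)])
    refine this.congr_fun (fun q _ => ?_) (MeasurableSet.univ.prod measurableSet_Ioo)
    simp only [Rd, Pi.mul_apply]
    ring
  · exact int_cont (S.PhT_cont ha) fun x t hx => S.PhT_zero (S.notMem hx)
  · exact int_cont S.Ed_cont.continuousOn fun x t hx => S.Ed_zero (S.notMem hx)

lemma Su.slice (S : Su n K hK c1 α δ lam B V w σ p) {t : ℝ} (ht : 0 < t) (ht2 : t ≤ 1 / (2 * lam)) :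
    0 ≤ ∫ x : Eu n, (Real.exp 300 * Rd B V w σ α (x, t) - 2 * PhT B V w σ p α lam x t
      - c1 / 4 * Ld w σ α lam x t + 2 * Dcst n (Cc n K hK) α lam * Ed w (x, t)) := by
  set H := fun x : Eu n => (Real.exp 300 * Rd B V w σ α (x, t) - 2 * PhT B V w σ p α lam x t
      - c1 / 4 * Ld w σ α lam x t + 2 * Dcst n (Cc n K hK) α lam * Ed w (x, t)) with hH
  by_cases hi : Integrable H
  · have hY := fun j => int_pd_zero (S.Y_LL (p t * σ t ^ (-(2 * α))) (thetaFn (lam * t) / t) (α / p t) t j)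
      (S.Y_cs (p t * σ t ^ (-(2 * α))) (thetaFn (lam * t) / t) (α / p t) t j) j
    have h0 : ∫ x, 2 * ∑ j, pd n j (Yt B V w (p t * σ t ^ (-(2 * α))) (thetaFn (lam * t) / t) (α / p t) t j) x
        = 0 := by
      rw [integral_const_mul, integral_finsetSum _ fun j _ => (hY j).1]
      simp [fun j => (hY j).2]
    rw [← h0]
    refine integral_mono_ae ((integrable_finsetSum _ fun j _ => (hY j).1).const_mul 2) hi ?_
    filter_upwards [S.pt ht ht2] with x hx
    refine hx.trans ?_
    have hG : 0 ≤ Gk n x t := by unfold Gk; positivity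
    have := mul_le_mul_of_nonneg_right (S.omega_le ht ht2) (mul_nonneg hG (sq_nonneg (Zop B V w x t)))
    simp only [hH, Rd, Ed]
    linarith
  · rw [integral_undef hi]

set_option maxHeartbeats 1000000 in
lemma Su.main (S : Su n K hK c1 α δ lam B V w σ p) (ha : 0 < a) (ha4 : a ≤ 1 / (4 * lam)) :
    c1 / 4 * (α ^ 2 * (∫ q in (univ : Set (Eu n)) ×ˢ Ioo a (1/(2*lam)),
                σ q.2 ^ (-(2*α)) * (w q.1 q.2) ^ 2 * Gk n q.1 q.2)
            + (∫ q in (univ : Set (Eu n)) ×ˢ Ioo a (1/(2*lam)),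
                σ q.2 ^ (1 - 2*α) * ‖gradient (fun y => w y q.2) q.1‖ ^ 2
                  * (thetaFn (lam * q.2) / q.2) * Gk n q.1 q.2)) ≤
      Real.exp 300 * (∫ q in (univ : Set (Eu n)) ×ˢ Ioo a (1/(2*lam)), Rd B V w σ α q)
      + 4 * Dcst n (Cc n K hK) α lam * sSup {y | ∃ t : ℝ, a ≤ t ∧ y = ∫ x : Eu n, Ed w (x, t)}
      + 2 * (σ a ^ (-(2*α)) * (-(c1 * a) * (∫ x : Eu n, ‖gradient (fun z => w z a) x‖ ^ 2 * Gk n x a)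
                  + 1000 * Real.exp 60 * Cc n K hK * α * (∫ x : Eu n, (w x a) ^ 2 * Gk n x a))) := by
  have hl := S.lam_pos
  have hl1 : 1 ≤ lam := by
    have haT : a ≤ 1 / (2 * lam) := ha4.trans (one_div_le_one_div_of_le (by positivity) (by linarith))
    have := (S.wt ha haT).lam_ge
    linarith [S.hα]
  have haT : a ≤ 1 / (2 * lam) := ha4.trans (one_div_le_one_div_of_le (by positivity) (by linarith))
  have hT1 : 1 / (2 * lam) ≤ 1 := by rw [div_le_one (by positivity)]; linarith
  set T := 1 / (2 * lam) with hT
  obtain ⟨i1, i2, i3, i4, i5⟩ := S.ints ha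
  rw [← hT] at i1 i2 i3 i4 i5
  have hC1 := Cc_ge (n := n) hK
  have hD0 : 0 ≤ Dcst n (Cc n K hK) α lam := by
    unfold Dcst; positivity
  set D := Dcst n (Cc n K hK) α lam with hD
  set S0 := sSup {y | ∃ t : ℝ, a ≤ t ∧ y = ∫ x : Eu n, Ed w (x, t)} with hS0
  have hsup : ∀ t, a ≤ t → ∫ x : Eu n, Ed w (x, t) ≤ S0 := fun t ht => le_csSup S.bdd ⟨t, ht, rfl⟩
  have hEd0 : ∀ x t, a ≤ t → 0 ≤ Ed w (x, t) := by
    intro x t ht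
    have : 0 ≤ t := ha.le.trans ht
    unfold Ed; positivity
  have hS00 : 0 ≤ S0 := le_trans (integral_nonneg fun x => hEd0 x a le_rfl) (hsup a le_rfl)
  -- full inequality
  have hLd : IntegrableOn (fun q : Eu n × ℝ => Ld w σ α lam q.1 q.2) (univ ×ˢ Ioo a T) := by
    refine (i2.add (i1.const_mul (α ^ 2))).congr_fun (fun q _ => ?_)
      (MeasurableSet.univ.prod measurableSet_Ioo)
    simp only [Ld, Pi.add_apply]; ring
  have hLdi : ∫ q in (univ : Set (Eu n)) ×ˢ Ioo a T, Ld w σ α lam q.1 q.2 =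
      α ^ 2 * (∫ q in (univ : Set (Eu n)) ×ˢ Ioo a T,
                σ q.2 ^ (-(2*α)) * (w q.1 q.2) ^ 2 * Gk n q.1 q.2)
            + (∫ q in (univ : Set (Eu n)) ×ˢ Ioo a T,
                σ q.2 ^ (1 - 2*α) * ‖gradient (fun y => w y q.2) q.1‖ ^ 2
                  * (thetaFn (lam * q.2) / q.2) * Gk n q.1 q.2) := by
    rw [← integral_const_mul, ← integral_add (i1.const_mul _) i2]
    refine integral_congr_ae (ae_of_all _ fun q => ?_)
    simp only [Ld]; ring
  have hmain : 0 ≤ ∫ q in (univ : Set (Eu n)) ×ˢ Ioo a T, (Real.exp 300 * Rd B V w σ α q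
      - 2 * PhT B V w σ p α lam q.1 q.2
      - c1 / 4 * Ld w σ α lam q.1 q.2 + 2 * D * Ed w q) := by
    have hIg : IntegrableOn (fun q : Eu n × ℝ => (Real.exp 300 * Rd B V w σ α q
      - 2 * PhT B V w σ p α lam q.1 q.2
      - c1 / 4 * Ld w σ α lam q.1 q.2 + 2 * D * Ed w q)) (univ ×ˢ Ioo a T) :=
      (((i3.const_mul _).sub (i4.const_mul _)).sub (hLd.const_mul _)).add (i5.const_mul _)
    unfold IntegrableOn at hIg
    rw [mu_eq] at hIg ⊢
    rw [integral_prod_symm _ hIg]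
    refine setIntegral_nonneg measurableSet_Ioo fun t ht => ?_
    exact S.slice (ha.trans ht.1) ht.2.le
  have hexp : ∫ q in (univ : Set (Eu n)) ×ˢ Ioo a T, (Real.exp 300 * Rd B V w σ α q
      - 2 * PhT B V w σ p α lam q.1 q.2
      - c1 / 4 * Ld w σ α lam q.1 q.2 + 2 * D * Ed w q) =
      Real.exp 300 * (∫ q in (univ : Set (Eu n)) ×ˢ Ioo a T, Rd B V w σ α q)
      - 2 * (∫ q in (univ : Set (Eu n)) ×ˢ Ioo a T, PhT B V w σ p α lam q.1 q.2)
      - c1 / 4 * (∫ q in (univ : Set (Eu n)) ×ˢ Ioo a T, Ld w σ α lam q.1 q.2)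
      + 2 * D * (∫ q in (univ : Set (Eu n)) ×ˢ Ioo a T, Ed w q) := by
    have k1 : IntegrableOn (fun q : Eu n × ℝ => Real.exp 300 * Rd B V w σ α q
      - 2 * PhT B V w σ p α lam q.1 q.2) (univ ×ˢ Ioo a T) := (i3.const_mul _).sub (i4.const_mul _)
    have k2 : IntegrableOn (fun q : Eu n × ℝ => Real.exp 300 * Rd B V w σ α q
      - 2 * PhT B V w σ p α lam q.1 q.2 - c1 / 4 * Ld w σ α lam q.1 q.2) (univ ×ˢ Ioo a T) :=
      k1.sub (hLd.const_mul _)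
    rw [integral_add k2 (i5.const_mul _), integral_sub k1 (hLd.const_mul _),
      integral_sub (i3.const_mul _) (i4.const_mul _)]
    simp only [integral_const_mul]
  have hEd : ∫ q in (univ : Set (Eu n)) ×ˢ Ioo a T, Ed w q ≤ S0 := by
    have hIg := i5
    unfold IntegrableOn at hIg
    rw [mu_eq] at hIg ⊢
    rw [integral_prod_symm _ hIg]
    calc ∫ t in Ioo a T, ∫ x : Eu n, Ed w (x, t) ≤ ∫ t in Ioo a T, S0 := by
          refine setIntegral_mono_on hIg.integral_prod_right ?_ measurableSet_Ioo
            fun t ht => hsup t ht.1.le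
          exact integrableOn_const (by simp)
      _ = (T - a) * S0 := by simp [haT]
      _ ≤ S0 := by nlinarith
  have hPh : ∫ q in (univ : Set (Eu n)) ×ˢ Ioo a T, PhT B V w σ p α lam q.1 q.2 =
      - ∫ x : Eu n, Phi B V w σ p α lam x a := by
    have hIg := i4
    unfold IntegrableOn at hIg
    rw [mu_eq] at hIg ⊢
    rw [integral_prod _ hIg, ← integral_neg]
    refine integral_congr_ae (ae_of_all _ fun x => ?_)
    exact S.Phi_int ha haT x
  have hPhint : Integrable (fun x : Eu n => Phi B V w σ p α lam x a) := by
    have hIg := i4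
    unfold IntegrableOn at hIg
    rw [mu_eq] at hIg
    have h1 := hIg.integral_prod_left
    have h2 : (fun x : Eu n => ∫ t in Ioo a T, PhT B V w σ p α lam x t) =
      fun x => - Phi B V w σ p α lam x a := by
      funext x; exact S.Phi_int ha haT x
    rw [h2] at h1
    simpa using h1.neg
  -- boundary
  have W := S.wt ha haT
  have hGc : Continuous (fun x => Gk n x a) := (Gk_smooth_x a).continuous
  have hwc : Continuous (fun x => w x a) := (sm_left S.hw.1 a).continuous
  have hgc : Continuous (fun x => ‖gradient (fun z => w z a) x‖ ^ 2) :=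
    S.g_cont.comp (f := fun x : Eu n => (x, a)) (by fun_prop)
  have j1 : Integrable (fun x : Eu n => ‖gradient (fun z => w z a) x‖ ^ 2 * Gk n x a) :=
    int_slice (hgc.mul hGc) fun x hx => by simp only [S.grad_zero (S.notMem hx), zero_mul]
  have j2 : Integrable (fun x : Eu n => w x a ^ 2 * Gk n x a) :=
    int_slice ((hwc.pow 2).mul hGc) fun x hx => by simp [(S.van (S.notMem hx)).1]
  have j3 : Integrable (fun x : Eu n => w x a ^ 2) :=
    int_slice (hwc.pow 2) fun x hx => by simp [(S.van (S.notMem hx)).1]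
  have j4 : Integrable (fun x : Eu n => Ed w (x, a)) :=
    int_slice (S.Ed_cont.comp (f := fun x : Eu n => (x, a)) (by fun_prop)) fun x hx =>
      S.Ed_zero (S.notMem hx)
  have hb : ∫ x : Eu n, Phi B V w σ p α lam x a ≤
      σ a ^ (-(2*α)) * (-(c1 * a) * (∫ x : Eu n, ‖gradient (fun z => w z a) x‖ ^ 2 * Gk n x a)
                  + 1000 * Real.exp 60 * Cc n K hK * α * (∫ x : Eu n, (w x a) ^ 2 * Gk n x a))
      + D * ∫ x : Eu n, w x a ^ 2 := by
    have k : Integrable (fun x : Eu n => -(c1 * a) * (‖gradient (fun z => w z a) x‖ ^ 2 * Gk n x a)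
        + 1000 * Real.exp 60 * Cc n K hK * α * (w x a ^ 2 * Gk n x a)) :=
      (j1.const_mul _).add (j2.const_mul _)
    rw [← integral_const_mul, ← integral_const_mul, ← integral_add (j1.const_mul _) (j2.const_mul _),
      ← integral_const_mul, ← integral_const_mul, ← integral_add (k.const_mul _) (j3.const_mul _)]
    refine integral_mono hPhint ((k.const_mul _).add (j3.const_mul _)) fun x => ?_
    by_cases hx : (x, a) ∈ tsupport (fun p : Eu n × ℝ => w p.1 p.2)
    · have hx4 : ‖x‖ ≤ 4 := by
        have := (S.hw.2.2 hx).1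
        simp at this
        exact this.le
      exact bdry_scalar W hC1 S.hc1 (norm_nonneg _) hx4 (S.qf_ge x a)
        (S.F0 x hx4 (by positivity)) (S.hVb _ hx).1
    · obtain ⟨h1, h2, -⟩ := S.van hx
      have h0 : Phi B V w σ p α lam x a = 0 := by
        unfold Phi ef qf
        simp only [h1, h2]
        simp
      simp only [h0, S.grad_zero hx, h1]
      simp
  have hw2 : ∫ x : Eu n, w x a ^ 2 ≤ S0 := by
    refine le_trans (integral_mono j3 j4 fun x => ?_) (hsup a le_rfl)
    simp only [Ed]
    have : 0 ≤ a * ‖gradient (fun z => w z a) x‖ ^ 2 := by positivity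
    linarith
  rw [hexp, hPh, hLdi] at hmain
  have f1 := mul_le_mul_of_nonneg_left hEd hD0
  have f2 := mul_le_mul_of_nonneg_left hw2 hD0
  linarith

end final

section last
open scoped NNReal Topology
variable {n : ℕ}

lemma exists_cutV (V0 : Eu n → ℝ) (hV : ContDiffOn ℝ 1 V0 (Metric.ball (0:Eu n) 4)) (s : Set (Eu n))
    (hs : IsCompact s) (hs4 : s ⊆ Metric.ball (0:Eu n) 4) :
    ∃ V : Eu n → ℝ, ContDiff ℝ 1 V ∧ ∀ x ∈ s, V x = V0 x ∧ fderiv ℝ V x = fderiv ℝ V0 x := by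
  obtain ⟨r, ⟨hr0, hr4⟩, hsr⟩ := exists_pos_lt_subset_ball (by norm_num : (0:ℝ) < 4) hs.isClosed hs4
  let χ : ContDiffBump (0 : Eu n) := ⟨r, (r + 4) / 2, hr0, by linarith⟩
  refine ⟨fun x => χ x * V0 x, ?_, ?_⟩
  · rw [contDiff_iff_contDiffAt]
    intro x
    by_cases hx : x ∈ Metric.ball (0:Eu n) 4
    · exact χ.contDiffAt.mul (hV.contDiffAt (Metric.isOpen_ball.mem_nhds hx))
    · have hx' : x ∉ tsupport χ := by
        rw [χ.tsupport_eq]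
        intro h
        apply hx
        rw [Metric.mem_closedBall] at h
        rw [Metric.mem_ball]
        have : χ.rOut = (r + 4) / 2 := rfl
        linarith
      have h0 : (fun x => χ x * V0 x) =ᶠ[𝓝 x] fun _ => 0 := by
        filter_upwards [notMem_tsupport_iff_eventuallyEq.1 hx'] with y hy
        simp [hy]
      exact contDiffAt_const.congr_of_eventuallyEq h0
  · intro x hx
    have he : (fun x => χ x * V0 x) =ᶠ[𝓝 x] V0 := by
      filter_upwards [Metric.isOpen_ball.mem_nhds (hsr hx)] with y hy
      have : χ y = 1 := χ.one_of_mem_closedBall (Metric.ball_subset_closedBall hy)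
      simp [this]
    exact ⟨he.eq_of_nhds, he.fderiv_eq⟩

lemma V0_bounds (V0 : Eu n → ℝ)
    (hb : ∃ C, ∀ x ∈ Metric.ball (0:Eu n) 4, |V0 x| + ‖gradient V0 x‖ ≤ C) {N α : ℝ} (hN : 1 ≤ N)
    (hα : N * (1 + (V0sup n V0 + V0gradSup n V0) ^ ((1:ℝ)/2)) ≤ α) :
    N ≤ α ∧ ∀ x ∈ Metric.ball (0:Eu n) 4, |V0 x| ≤ α ^ 2 ∧ ‖gradient V0 x‖ ≤ α ^ 2 := by
  obtain ⟨C, hC⟩ := hb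
  have h1 : ∀ x ∈ Metric.ball (0:Eu n) 4, |V0 x| ≤ V0sup n V0 := by
    intro x hx
    refine le_csSup ⟨C, ?_⟩ ⟨x, hx, rfl⟩
    rintro y ⟨z, hz, rfl⟩
    linarith [hC z hz, norm_nonneg (gradient V0 z)]
  have h2 : ∀ x ∈ Metric.ball (0:Eu n) 4, ‖gradient V0 x‖ ≤ V0gradSup n V0 := by
    intro x hx
    refine le_csSup ⟨C, ?_⟩ ⟨x, hx, rfl⟩
    rintro y ⟨z, hz, rfl⟩
    linarith [hC z hz, abs_nonneg (V0 z)]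
  have h0 : (0:Eu n) ∈ Metric.ball (0:Eu n) 4 := by simp
  have h3 := (abs_nonneg _).trans (h1 0 h0)
  have h4 := (norm_nonneg _).trans (h2 0 h0)
  set M := V0sup n V0 + V0gradSup n V0 with hM
  rw [← Real.sqrt_eq_rpow] at hα
  have h5 := Real.sqrt_nonneg M
  have h6 : Real.sqrt M ≤ α := by nlinarith
  have h7 : M ≤ α ^ 2 := by
    have := Real.sq_sqrt (by linarith : 0 ≤ M)
    nlinarith
  refine ⟨by nlinarith, fun x hx => ⟨?_, ?_⟩⟩
  · linarith [h1 x hx]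
  · linarith [h2 x hx]

lemma fderiv_le_grad (f : Eu n → ℝ) (x v : Eu n) : |fderiv ℝ f x v| ≤ ‖gradient f x‖ * ‖v‖ := by
  have h : fderiv ℝ f x v = inner ℝ (gradient f x) v := by
    simp [gradient]
  rw [h]
  exact abs_real_inner_le_norm _ _

lemma Dcst_le {C c1 α lam N : ℝ} (hC : 1 ≤ C) (hc1 : 0 < c1) (hc : c1 ≤ 1) (hα : 1 ≤ α) (hl : 1 ≤ lam)
    (hN1 : 1600 * C * Real.exp 300 / c1 ≤ N) (hN2 : 4 + (n:ℝ) / 2 ≤ N) :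
    16 / c1 * Dcst n C α lam ≤ N ^ (2 * α) * lam ^ (2 * α + N) := by
  unfold Dcst
  rw [← mul_assoc]
  have h16 : 1 ≤ 16 / c1 := by rw [le_div_iff₀ hc1]; linarith
  have hN0 : 0 < N := lt_of_lt_of_le (by positivity) hN1
  have hk := Real.exp_pos 300
  gcongr
  · calc 16 / c1 * (100 * C * Real.exp 300) ^ (2 * α)
        ≤ (16 / c1) ^ (2 * α) * (100 * C * Real.exp 300) ^ (2 * α) := by
          gcongr
          exact Real.self_le_rpow_of_one_le h16 (by linarith)
      _ = (1600 * C * Real.exp 300 / c1) ^ (2 * α) := by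
          rw [← Real.mul_rpow (by positivity) (by positivity)]
          congr 1; ring
      _ ≤ _ := by gcongr

lemma fin_arith {c1 C a α N L I3 S0 g0 w0 s e3 e6 D D' : ℝ} (hc1 : 0 < c1) (hC : 1 ≤ C) (ha : 0 ≤ a)
    (hα : 1 ≤ α) (hN4 : 4 ≤ N) (hNc : 8000 * C * e3 ≤ N * c1) (h63 : e6 ≤ e3) (he3 : 1 ≤ e3)
    (hm : c1 / 4 * L ≤ e3 * I3 + 4 * D * S0 + 2 * (s * (-(c1 * a) * g0 + 1000 * e6 * C * α * w0)))
    (hI : 0 ≤ I3) (hS : 0 ≤ S0) (hg : 0 ≤ g0) (hw : 0 ≤ w0) (hs : 0 ≤ s) (hD : 16 / c1 * D ≤ D') :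
    L ≤ N * I3 + D' * S0 + s * (-(a / N) * g0 + N * α * w0) := by
  have hN0 : 0 < N := by linarith
  have f1 : e3 * I3 ≤ c1 / 4 * (N * I3) := by
    have : e3 ≤ c1 / 4 * N := by nlinarith
    nlinarith
  have f2 : 4 * D * S0 ≤ c1 / 4 * (D' * S0) := by
    have : 4 * D ≤ c1 / 4 * D' := by
      have h := mul_le_mul_of_nonneg_left hD (by positivity : 0 ≤ c1 / 4)
      have h2 : c1 / 4 * (16 / c1 * D) = 4 * D := by field_simp; norm_num
      linarith
    nlinarith
  have f3 : 2 * (-(c1 * a) * g0 + 1000 * e6 * C * α * w0) ≤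
      c1 / 4 * (-(a / N) * g0 + N * α * w0) := by
    have h1 : a / N ≤ a := div_le_self ha (by linarith)
    have h2 : c1 / 4 * (a / N * g0) ≤ 2 * (c1 * a * g0) := by
      have h3 : a / N * g0 ≤ a * g0 := mul_le_mul_of_nonneg_right h1 hg
      have h4 : 0 ≤ a * g0 := mul_nonneg ha hg
      nlinarith
    have h5 : 2 * (1000 * e6 * C) ≤ c1 / 4 * N := by nlinarith
    have h6 : 0 ≤ α * w0 := mul_nonneg (by linarith) hw
    have h7 := mul_le_mul_of_nonneg_right h5 h6
    linarith
  have f4 := mul_le_mul_of_nonneg_left f3 hs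
  have : c1 / 4 * L ≤ c1 / 4 * (N * I3 + D' * S0 + s * (-(a / N) * g0 + N * α * w0)) := by
    linarith
  exact le_of_mul_le_mul_left this (by positivity)

end last

/-- Carleman estimate with time-frozen coefficients and potential (Step 1). -/
theorem stmt7 (n : ℕ) (Λ K : ℝ) (hΛ : 1 ≤ Λ) (hK : 0 ≤ K) :
    ∃ N δ : ℝ, 0 < N ∧ 0 < δ ∧ δ < 1 ∧
      ∀ (A : Eu n → ℝ → Matrix (Fin n) (Fin n) ℝ) (V0 : Eu n → ℝ),
        IsEllipLip n Λ K A → A 0 0 = 1 →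
        ContDiffOn ℝ 1 V0 (Metric.ball (0:Eu n) 4) →
        (∃ C, ∀ x ∈ Metric.ball (0:Eu n) 4, |V0 x| + ‖gradient V0 x‖ ≤ C) →
        ∀ α : ℝ, N * (1 + (V0sup n V0 + V0gradSup n V0) ^ ((1:ℝ)/2)) ≤ α →
        ∀ lam : ℝ, lam = α / δ ^ 2 →
        ∀ σ σ' : ℝ → ℝ, SigmaODE lam σ σ' →
        ∀ a : ℝ, 0 < a → a ≤ 1 / (4 * lam) →
        ∀ w : Eu n → ℝ → ℝ, TestFn n (Metric.ball (0:Eu n) 4) (1 / (2 * lam)) w →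
          α ^ 2 * (∫ p in (univ : Set (Eu n)) ×ˢ Ioo a (1/(2*lam)),
                σ p.2 ^ (-(2*α)) * (w p.1 p.2) ^ 2 * Gk n p.1 p.2)
            + (∫ p in (univ : Set (Eu n)) ×ˢ Ioo a (1/(2*lam)),
                σ p.2 ^ (1 - 2*α) * ‖gradient (fun y => w y p.2) p.1‖ ^ 2
                  * (thetaFn (lam * p.2) / p.2) * Gk n p.1 p.2)
          ≤ N * (∫ p in (univ : Set (Eu n)) ×ˢ Ioo a (1/(2*lam)),
                σ p.2 ^ (1 - 2*α)
                  * (divAGrad n (fun y _ => A y 0) w p.1 p.2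
                      + deriv (fun s => w p.1 s) p.2 + V0 p.1 * w p.1 p.2) ^ 2
                  * Gk n p.1 p.2)
            + N ^ (2*α) * lam ^ (2*α + N) *
                sSup {y | ∃ t : ℝ, a ≤ t ∧
                  y = ∫ x : Eu n, ((w x t) ^ 2 + t * ‖gradient (fun z => w z t) x‖ ^ 2)}
            + σ a ^ (-(2*α)) *
                (-(a / N) * (∫ x : Eu n, ‖gradient (fun z => w z a) x‖ ^ 2 * Gk n x a)
                  + N * α * (∫ x : Eu n, (w x a) ^ 2 * Gk n x a)) := by
  have hC := Cc_ge (n := n) hK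
  set C := Cc n K hK with hCdef
  have hΛ0 : 0 < Λ := by linarith
  set c1 := Λ⁻¹ * Real.exp (-60) with hc1def
  have hc1 : 0 < c1 := by positivity
  have hΛi : Λ⁻¹ ≤ 1 := inv_le_one_of_one_le₀ hΛ
  have he60 : Real.exp (-60) ≤ 1 := Real.exp_le_one_iff.2 (by norm_num)
  have hc160 : c1 ≤ Real.exp (-60) := by
    rw [hc1def]; exact mul_le_of_le_one_left (Real.exp_pos _).le hΛi
  have hc1Λ : c1 ≤ Λ⁻¹ := by
    rw [hc1def]; exact mul_le_of_le_one_right (by positivity) he60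
  have hc11 : c1 ≤ 1 := hc160.trans he60
  have hE : 1 ≤ Real.exp 300 := Real.one_le_exp (by norm_num)
  have hE6 : Real.exp 60 ≤ Real.exp 300 := Real.exp_le_exp.2 (by norm_num)
  set N := 8000 * C * Real.exp 300 / c1 + (4 + (n:ℝ) / 2) with hNdef
  have hN1 : 8000 * C * Real.exp 300 / c1 ≤ N := by
    rw [hNdef]; have : 0 ≤ (n:ℝ) / 2 := by positivity
    linarith
  have hpos : 0 < 8000 * C * Real.exp 300 / c1 := by positivity
  have hN2 : 4 + (n:ℝ) / 2 ≤ N := by rw [hNdef]; linarith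
  have hn2 : 0 ≤ (n:ℝ) / 2 := by positivity
  have hN4 : 4 ≤ N := by linarith
  have hNc : 8000 * C * Real.exp 300 ≤ N * c1 := by rwa [div_le_iff₀ hc1] at hN1
  set δ := c1 / (800 * C) with hδdef
  have hδ : 0 < δ := by positivity
  have hδ1 : δ < 1 := by
    rw [hδdef, div_lt_one (by positivity)]; linarith
  refine ⟨N, δ, by linarith, hδ, hδ1, ?_⟩
  intro A V0 hA hA0 hV0 hVb α hα lam hlam σ σ' hσ a ha ha4 w hw
  obtain ⟨hNα, hVB⟩ := V0_bounds V0 hVb (by linarith) hα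
  have hα1 : 1 ≤ α := by linarith
  have hl1 : 1 ≤ lam := by
    rw [hlam, le_div_iff₀ (by positivity)]
    nlinarith
  obtain ⟨p, hp⟩ := sigma_facts (by linarith) hσ
  set B : Fin n → Fin n → Eu n → ℝ := fun i j y => A y 0 i j with hB
  have hsc : IsCompact (Prod.fst '' tsupport (fun p : Eu n × ℝ => w p.1 p.2)) :=
    IsCompact.image hw.2.1 continuous_fst
  obtain ⟨V, hVc, hVe⟩ := exists_cutV V0 hV0 _ hsc (by
    rintro _ ⟨q, hq, rfl⟩
    exact (hw.2.2 hq).1)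
  have S : Su n K hK c1 α δ lam B V w σ p :=
    { hBs := fun i j y => ((hA.1 y 0).apply i j).symm
      hBl := fun i j x y => by
        have := hA.2.2 x y 0 0 i j
        simpa using this
      hB0 := fun i j => by simp [hB, hA0, Matrix.one_apply]
      hBe := fun x ξ => by
        refine le_trans (mul_le_mul_of_nonneg_right hc1Λ (sq_nonneg _)) ((hA.2.1 x 0 ξ).1.trans ?_)
        simp [hB, mul_assoc]
      hV := hVc
      hVb := fun q hq => by
        obtain ⟨e1, e2⟩ := hVe q.1 ⟨q, hq, rfl⟩
        obtain ⟨b1, b2⟩ := hVB q.1 (hw.2.2 hq).1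
        rw [e1, e2]
        exact ⟨b1, fun v => (fderiv_le_grad V0 q.1 v).trans
          (mul_le_mul_of_nonneg_right b2 (norm_nonneg v))⟩
      hw := hw
      hα := hα1
      hαn := by linarith
      hδ := hδ
      hδ1 := hδ1.le
      hl := hlam
      hc1 := hc1
      hc160 := hc160
      hsm := by
        have h1 : 100 * C * δ = c1 / 8 := by rw [hδdef]; field_simp; norm_num
        have h2 : 100 * C * (1 / α) ≤ c1 / 8 := by
          rw [mul_one_div, div_le_iff₀ (by linarith)]
          have : N * c1 ≤ α * c1 := mul_le_mul_of_nonneg_right hNα hc1.le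
          nlinarith
        change 100 * C * (δ + 1 / α) ≤ c1 / 4
        linarith
      hσ := hp }
  have hR : ∀ q : Eu n × ℝ, Rd B V w σ α q = σ q.2 ^ (1 - 2*α)
                  * (divAGrad n (fun y _ => A y 0) w q.1 q.2
                      + deriv (fun s => w q.1 s) q.2 + V0 q.1 * w q.1 q.2) ^ 2
                  * Gk n q.1 q.2 := by
    intro q
    have hz : Zop B V w q.1 q.2 = divAGrad n (fun y _ => A y 0) w q.1 q.2
                      + deriv (fun s => w q.1 s) q.2 + V0 q.1 * w q.1 q.2 := by
      have hv : V q.1 * w q.1 q.2 = V0 q.1 * w q.1 q.2 := by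
        by_cases hq : q ∈ tsupport (fun p : Eu n × ℝ => w p.1 p.2)
        · rw [(hVe q.1 ⟨q, hq, rfl⟩).1]
        · have : w q.1 q.2 = 0 := (S.van (x := q.1) (t := q.2) hq).1
          simp [this]
      rw [← hv]
      rfl
    rw [Rd, hz]
  have hm := S.main ha ha4
  simp only [hR] at hm
  have hRnn : 0 ≤ ∫ p in (univ : Set (Eu n)) ×ˢ Ioo a (1/(2*lam)),
                σ p.2 ^ (1 - 2*α)
                  * (divAGrad n (fun y _ => A y 0) w p.1 p.2
                      + deriv (fun s => w p.1 s) p.2 + V0 p.1 * w p.1 p.2) ^ 2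
                  * Gk n p.1 p.2 := by
    refine setIntegral_nonneg (MeasurableSet.univ.prod measurableSet_Ioo) fun q hq => ?_
    have h2 : a < q.2 ∧ q.2 < 1 / (2 * lam) := hq.2
    have h0 : 0 < q.2 := ha.trans h2.1
    have := (S.wt h0 h2.2.le).σpos
    unfold Gk
    positivity
  have hS0 : 0 ≤ sSup {y | ∃ t : ℝ, a ≤ t ∧
                  y = ∫ x : Eu n, ((w x t) ^ 2 + t * ‖gradient (fun z => w z t) x‖ ^ 2)} :=
    le_trans (integral_nonneg fun x => by positivity) (le_csSup (S.bdd (a := a)) ⟨a, le_rfl, rfl⟩)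
  have hg0 : 0 ≤ ∫ x : Eu n, ‖gradient (fun z => w z a) x‖ ^ 2 * Gk n x a :=
    integral_nonneg fun x => by unfold Gk; positivity
  have hw0 : 0 ≤ ∫ x : Eu n, (w x a) ^ 2 * Gk n x a :=
    integral_nonneg fun x => by unfold Gk; positivity
  have hσa : 0 ≤ σ a ^ (-(2*α)) := by
    have haT : a ≤ 1 / (2 * lam) :=
      ha4.trans (one_div_le_one_div_of_le (by positivity) (by linarith))
    have := (S.wt ha haT).σpos
    positivity
  have hD := Dcst_le (n := n) hC hc1 hc11 hα1 hl1 (le_trans (by gcongr; norm_num) hN1) hN2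
  exact fin_arith hc1 hC ha.le hα1 hN4 hNc hE6 hE hm hRnn hS0 hg0 hw0 hσa hD
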